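/- Let λ = (λ_η) be a family of nonnegative loop activities indexed by self-avoiding polygons of ℤ^d satisfying the symmetry assumption and the boundedness assumption. Then there exists d₀ = d₀(λ) such that for every dimension d ≥ d₀ there are constants A > 0 and D > 0 with: (1) χ_λ(z)·(z_c(λ) − z) → A·z_c(λ) as z ↑ z_c(λ); (2) for every δ < 1, c_n^λ = A·z_c(λ)^{−n}·(1 + O(n^{−δ})) as n → ∞; (3) for every δ < 1, the mean-square displacement satisfies ⟨|ω_n|²⟩_n^λ = D·n·(1 + O(n^{−δ})) as n → ∞. -/

import Mathlib

open scoped ENNReal NNReal BigOperators Classical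

noncomputable section

namespace LWW

/-- A point of the lattice ℤ^d. -/
abbrev Pt (d : ℕ) := Fin d → ℤ

/-- ℓ¹ distance on ℤ^d. -/
def dist1 {d : ℕ} (x y : Pt d) : ℕ := ∑ i, (x i - y i).natAbs

/-- Nearest-neighbour adjacency on ℤ^d. -/
def Adj {d : ℕ} (x y : Pt d) : Prop := dist1 x y = 1

/-- Auxiliary function for single loop erasure: scan the list, keeping the
self-avoiding prefix `pre`; when the first repeated vertex is met, return the
loop-erased list together with the removed loop. -/
def le1Aux {α : Type*} [DecidableEq α] : List α → List α → List α × Option (List α)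
  | pre, [] => (pre, none)
  | pre, x :: rest =>
    if x ∈ pre then
      (pre.takeWhile (fun y => y ≠ x) ++ x :: rest,
        some (pre.dropWhile (fun y => y ≠ x) ++ [x]))
    else le1Aux (pre ++ [x]) rest

/-- Single loop erasure LE¹. -/
def LE1 {α : Type*} [DecidableEq α] (l : List α) : List α := (le1Aux [] l).1

/-- The loop removed by a single loop erasure (if the list is not self-avoiding). -/
def removedLoop {α : Type*} [DecidableEq α] (l : List α) : Option (List α) := (le1Aux [] l).2

/-- Iterate single loop erasure (with fuel), collecting the multiset of removed loops. -/
def leAux {α : Type*} [DecidableEq α] : ℕ → List α → List α × Multiset (List α)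
  | 0, l => (l, 0)
  | n + 1, l =>
    match le1Aux ([] : List α) l with
    | (_, none) => (l, 0)
    | (l', some c) => ((leAux n l').1, c ::ₘ (leAux n l').2)

/-- Loop erasure LE. -/
def LE {α : Type*} [DecidableEq α] (l : List α) : List α := (leAux l.length l).1

/-- The multiset of loops removed by loop erasure. -/
def erasedLoops {α : Type*} [DecidableEq α] (l : List α) : Multiset (List α) :=
  (leAux l.length l).2

/-- The number of loops removed by loop erasure. -/
def nLoops {α : Type*} [DecidableEq α] (l : List α) : ℕ := Multiset.card (erasedLoops l)

/-- A (finite) nearest-neighbour walk on ℤ^d, recorded as its (nonempty) list of vertices. -/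
structure Walk (d : ℕ) where
  pts : List (Pt d)
  ne : pts ≠ []
  chain : pts.Chain' Adj

namespace Walk

variable {d : ℕ}

/-- The number of steps of a walk. -/
def len (ω : Walk d) : ℕ := ω.pts.length - 1

/-- The initial vertex of a walk. -/
def start (ω : Walk d) : Pt d := ω.pts.headI

/-- The final vertex of a walk. -/
def finish (ω : Walk d) : Pt d := ω.pts.getLastD default

/-- The range (set of visited vertices) of a walk. -/
def range (ω : Walk d) : Set (Pt d) := {x | x ∈ ω.pts}

/-- The `i`-th vertex of a walk. -/
def nth (ω : Walk d) (i : ℕ) : Pt d := ω.pts.getD i default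

/-- A walk is a loop if it has at least one step and ends where it began. -/
def IsLoop (ω : Walk d) : Prop := 1 ≤ ω.len ∧ ω.finish = ω.start

end Walk

/-- The list of vertices of a self-avoiding polygon: a closed nearest-neighbour
walk all of whose vertices are distinct except that the last equals the first. -/
def IsSAPList {d : ℕ} (l : List (Pt d)) : Prop :=
  l.Chain' Adj ∧ 3 ≤ l.length ∧ l.getLastD default = l.headI ∧ l.dropLast.Nodup

/-- Change the initial vertex of a polygon list by a cyclic rotation. -/
def polyRot {d : ℕ} (l : List (Pt d)) (r : ℕ) : List (Pt d) :=
  l.dropLast.rotate r ++ [(l.dropLast.rotate r).headI]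

/-- An isometry of the lattice ℤ^d: a bijection preserving ℓ¹ distance. -/
def IsLatticeIso {d : ℕ} (R : Pt d ≃ Pt d) : Prop :=
  ∀ x y : Pt d, dist1 (R x) (R y) = dist1 x y

/-- The symmetry assumption on the loop activities: invariance under isometries of ℤ^d
and under change of initial vertex and of orientation of the polygon. -/
def SymmAssumption {d : ℕ} (lam : List (Pt d) → ℝ≥0) : Prop :=
  (∀ R : Pt d ≃ Pt d, IsLatticeIso R → ∀ l : List (Pt d), IsSAPList l →
      lam (l.map R) = lam l) ∧
  (∀ l : List (Pt d), IsSAPList l → ∀ r : ℕ, lam (polyRot l r) = lam l) ∧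
  (∀ l : List (Pt d), IsSAPList l → lam l.reverse = lam l)

/-- The boundedness assumption: sup over self-avoiding polygons of the activity is finite. -/
def BoundedAssumption {d : ℕ} (lam : List (Pt d) → ℝ≥0) : Prop :=
  ∃ M : ℝ≥0, ∀ l : List (Pt d), IsSAPList l → lam l ≤ M

/-- The product of the loop activities over the loops erased from `ω`, i.e. λ^{n_L(ω)}. -/
def wt0 {d : ℕ} (lam : List (Pt d) → ℝ≥0) (ω : Walk d) : ℝ≥0∞ :=
  ((erasedLoops ω.pts).map (fun η => (lam η : ℝ≥0∞))).prod

/-- The λ-LWW weight w_{λ,z}(ω) = z^{|ω|} λ^{n_L(ω)}. -/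
def wt {d : ℕ} (lam : List (Pt d) → ℝ≥0) (z : ℝ≥0) (ω : Walk d) : ℝ≥0∞ :=
  (z : ℝ≥0∞) ^ ω.len * wt0 lam ω

/-- The λ-LWW two-point function. -/
def G {d : ℕ} (lam : List (Pt d) → ℝ≥0) (z : ℝ≥0) (x y : Pt d) : ℝ≥0∞ :=
  ∑' ω : Walk d, if ω.start = x ∧ ω.finish = y then wt lam z ω else 0

/-- The λ-LWW loop measure μ_{λ,z}(A;B). -/
def mu {d : ℕ} (lam : List (Pt d) → ℝ≥0) (z : ℝ≥0) (A B : Set (Pt d)) : ℝ≥0∞ :=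
  ∑' ω : Walk d,
    if ω.IsLoop ∧ (ω.range ∩ A).Nonempty ∧ ω.range ∩ B = ∅
    then wt lam z ω / (ω.len : ℝ≥0∞) else 0

/-- The generalized λ-LWW loop measure μ_{λ,z}(A,B;C) with two hitting sets. -/
def mu2 {d : ℕ} (lam : List (Pt d) → ℝ≥0) (z : ℝ≥0) (A B C : Set (Pt d)) : ℝ≥0∞ :=
  ∑' ω : Walk d,
    if ω.IsLoop ∧ (ω.range ∩ A).Nonempty ∧ (ω.range ∩ B).Nonempty ∧ ω.range ∩ C = ∅
    then wt lam z ω / (ω.len : ℝ≥0∞) else 0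

/-- exp : [0,∞] → [0,∞] with exp(∞) = ∞. -/
def eexp (x : ℝ≥0∞) : ℝ≥0∞ := if x = ⊤ then ⊤ else ENNReal.ofReal (Real.exp x.toReal)

/-- The loop-erased λ-LWW weight w̄_{λ,z}(η) of a self-avoiding walk η. -/
def wbar {d : ℕ} (lam : List (Pt d) → ℝ≥0) (z : ℝ≥0) (η : Walk d) : ℝ≥0∞ :=
  ∑' ω : Walk d, if LE ω.pts = η.pts then wt lam z ω else 0

/-- c_n^λ : the total λ-LWW mass of n-step walks started at the origin. -/
def cN {d : ℕ} (lam : List (Pt d) → ℝ≥0) (n : ℕ) : ℝ≥0∞ :=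
  ∑' ω : Walk d, if ω.start = 0 ∧ ω.len = n then wt0 lam ω else 0

/-- The susceptibility χ_λ(z) = Σ_n c_n^λ z^n. -/
def chi {d : ℕ} (lam : List (Pt d) → ℝ≥0) (z : ℝ) : ℝ≥0∞ :=
  ∑' n : ℕ, cN lam n * ENNReal.ofReal z ^ n

/-- The critical point z_c(λ): the radius of convergence of the susceptibility
(for a power series with nonnegative coefficients this is the supremum of the
set of nonnegative z at which the series converges). -/
def zc {d : ℕ} (lam : List (Pt d) → ℝ≥0) : ℝ :=
  sSup {z : ℝ | 0 ≤ z ∧ chi lam z < ⊤}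


/-- The squared Euclidean norm of a lattice point, in `[0,∞]`. -/
def sqNormE {d : ℕ} (x : Pt d) : ℝ≥0∞ := ∑ i, ((x i).natAbs : ℝ≥0∞) ^ 2

/-- The (unnormalized) mean-square displacement: the λ-weighted sum of `|ω_n|²` over
`n`-step walks started at the origin. -/
def msd {d : ℕ} (lam : List (Pt d) → ℝ≥0) (n : ℕ) : ℝ≥0∞ :=
  ∑' ω : Walk d, if ω.start = 0 ∧ ω.len = n then sqNormE ω.finish * wt0 lam ω else 0

/-- The mean-square displacement `⟨|ω_n|²⟩_n^λ` of `n`-step λ-LWW. -/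
def meanSq {d : ℕ} (lam : List (Pt d) → ℝ≥0) (n : ℕ) : ℝ :=
  (msd lam n / cN lam n).toReal

/-- Formal power series with coefficients in `[0,∞]`, ordered coefficientwise. -/
abbrev Ser := PowerSeries ℝ≥0∞

namespace Ser

open PowerSeries

instance : PartialOrder Ser where
  le f g := ∀ n, coeff n f ≤ coeff n g
  le_refl _ _ := le_rfl
  le_trans _ _ _ h h' n := (h n).trans (h' n)
  le_antisymm _ _ h h' := PowerSeries.ext fun n => le_antisymm (h n) (h' n)

theorem le_def {f g : Ser} : f ≤ g ↔ ∀ n, coeff n f ≤ coeff n g := Iff.rfl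

theorem zero_le (f : Ser) : 0 ≤ f := fun n => by simp

instance : IsOrderedRing Ser where
  add_le_add_left f g h a n := by
    simpa using add_le_add_left (h n) _
  zero_le_one := zero_le _
  mul_le_mul_of_nonneg_left a _ f g h n := by
    simp only [PowerSeries.coeff_mul]
    exact Finset.sum_le_sum fun i _ => mul_le_mul_right (h _) _
  mul_le_mul_of_nonneg_right a _ f g h n := by
    simp only [PowerSeries.coeff_mul]
    exact Finset.sum_le_sum fun i _ => mul_le_mul_left (h _) _

instance : CanonicallyOrderedAdd Ser where
  exists_add_of_le {f g} h := ⟨mk fun n => coeff n g - coeff n f, PowerSeries.ext fun n => by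
    simp [add_tsub_cancel_of_le (h n)]⟩
  le_self_add f g n := by simp
  le_add_self f g n := by simp

/-- Coefficientwise inequality of the terms of degree less than `n`. -/
def LeN (n : ℕ) (f g : Ser) : Prop := ∀ m < n, coeff m f ≤ coeff m g

@[refl] theorem LeN.refl {n : ℕ} (f : Ser) : LeN n f f := fun _ _ => le_rfl

theorem LeN.rfl {n : ℕ} {f : Ser} : LeN n f f := fun _ _ => le_rfl

@[trans] theorem LeN.trans {n : ℕ} {f g h : Ser} (a : LeN n f g) (b : LeN n g h) : LeN n f h :=
  fun m hm => (a m hm).trans (b m hm)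

theorem LeN.of_le {n : ℕ} {f g : Ser} (h : f ≤ g) : LeN n f g := fun m _ => h m

theorem LeN.of_eq {n : ℕ} {f g : Ser} (h : f = g) : LeN n f g := LeN.of_le h.le

instance {n : ℕ} : Trans (LeN n) (LeN n) (LeN n) := ⟨LeN.trans⟩
instance {n : ℕ} : Trans (LeN n) (· ≤ ·) (LeN n) := ⟨fun a b => a.trans (LeN.of_le b)⟩
instance {n : ℕ} : Trans (· ≤ ·) (LeN n) (LeN n) := ⟨fun a b => (LeN.of_le a).trans b⟩

theorem LeN.mono {n m : ℕ} {f g : Ser} (h : LeN n f g) (hm : m ≤ n) : LeN m f g :=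
  fun i hi => h i (hi.trans_le hm)

theorem leN_zero (f g : Ser) : LeN 0 f g := fun m hm => absurd hm (by simp)

@[gcongr] theorem LeN.add {n : ℕ} {f g f' g' : Ser} (h : LeN n f g) (h' : LeN n f' g') :
    LeN n (f + f') (g + g') := fun m hm => by
  simpa using add_le_add (h m hm) (h' m hm)

@[gcongr] theorem LeN.mul {n : ℕ} {f g f' g' : Ser} (h : LeN n f g) (h' : LeN n f' g') :
    LeN n (f * f') (g * g') := fun m hm => by
  simp only [PowerSeries.coeff_mul]
  refine Finset.sum_le_sum fun i hi => ?_
  have := Finset.HasAntidiagonal.mem_antidiagonal.1 hi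
  exact mul_le_mul' (h _ (by omega)) (h' _ (by omega))

/-- If `a` has no constant term, multiplication by `a` improves the order of an inequality. -/
theorem LeN.mul_succ {n : ℕ} {a b f g : Ser} (h : LeN n f g) (hab : a ≤ b)
    (ha : coeff 0 a = 0) : LeN (n + 1) (a * f) (b * g) := fun m hm => by
  simp only [PowerSeries.coeff_mul]
  refine Finset.sum_le_sum fun i hi => ?_
  have := Finset.HasAntidiagonal.mem_antidiagonal.1 hi
  rcases Nat.eq_zero_or_pos i.1 with h0 | h0
  · rw [h0, ha]; simp
  · exact mul_le_mul' (hab _) (h _ (by omega))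

theorem coeff_zero_mul {a : Ser} (ha : coeff 0 a = 0) (b : Ser) : coeff 0 (a * b) = 0 := by
  rw [coeff_zero_eq_constantCoeff_apply] at ha ⊢
  rw [map_mul, ha, zero_mul]

theorem le_of_leN {f g : Ser} (h : ∀ n, LeN n f g) : f ≤ g := fun n => h (n + 1) n (by simp)

/-- Induction on the order for a family of coefficientwise inequalities. -/
theorem le_of_step {ι : Sort*} {f g : ι → Ser}
    (h : ∀ n, (∀ i, LeN n (f i) (g i)) → ∀ i, LeN (n + 1) (f i) (g i)) (i : ι) : f i ≤ g i := by
  have key : ∀ n i, LeN n (f i) (g i) := fun n => by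
    induction n with
    | zero => exact fun i => leN_zero _ _
    | succ n ih => exact h n ih
  exact le_of_leN fun n => key n i

/-- Coefficientwise sum of a family of series. -/
def psum {ι : Type*} (f : ι → Ser) : Ser := mk fun n => ∑' u, coeff n (f u)

@[simp] theorem coeff_psum {ι : Type*} (f : ι → Ser) (n : ℕ) :
    coeff n (psum f) = ∑' u, coeff n (f u) := by simp [psum]

variable {ι κ : Type*}

theorem psum_add (f g : ι → Ser) : psum (fun u => f u + g u) = psum f + psum g := by
  ext n; simp [ENNReal.tsum_add]

theorem mul_psum (a : Ser) (f : ι → Ser) : a * psum f = psum fun u => a * f u := by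
  ext n
  simp only [PowerSeries.coeff_mul, coeff_psum, ← ENNReal.tsum_mul_left]
  exact (Summable.tsum_finsetSum fun i _ => ENNReal.summable).symm

theorem psum_mul (a : Ser) (f : ι → Ser) : psum f * a = psum fun u => f u * a := by
  simp only [mul_comm _ a, mul_psum]

theorem psum_comm (f : ι → κ → Ser) :
    psum (fun u => psum fun v => f u v) = psum fun v => psum fun u => f u v := by
  ext n; simp only [coeff_psum]; exact ENNReal.tsum_comm

@[gcongr] theorem psum_mono {f g : ι → Ser} (h : ∀ u, f u ≤ g u) : psum f ≤ psum g := fun n => by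
  simp only [coeff_psum]; exact ENNReal.tsum_le_tsum fun u => h u n

@[gcongr] theorem LeN.psum {n : ℕ} {f g : ι → Ser} (h : ∀ u, LeN n (f u) (g u)) :
    LeN n (psum f) (psum g) := fun m hm => by
  simp only [coeff_psum]; exact ENNReal.tsum_le_tsum fun u => h u m hm

theorem psum_single (f : ι → Ser) (i : ι) (h : ∀ j, j ≠ i → f j = 0) : psum f = f i := by
  ext n; simp only [coeff_psum]
  exact tsum_eq_single i fun j hj => by simp [h j hj]

theorem le_psum (f : ι → Ser) (i : ι) : f i ≤ psum f := fun n => by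
  simp only [coeff_psum]; exact ENNReal.le_tsum i

theorem psum_equiv (e : ι ≃ κ) (f : κ → Ser) : psum (fun u => f (e u)) = psum f := by
  ext n; simp only [coeff_psum]; exact e.tsum_eq fun u => coeff n (f u)

@[simp] theorem psum_zero : psum (fun _ : ι => (0 : Ser)) = 0 := by ext n; simp

/-- A psum over a type with the term `i` split off. -/
theorem psum_split (f : ι → Ser) (i : ι) :
    psum f = f i + psum fun j => if j = i then 0 else f j := by
  ext n; simp only [coeff_psum, map_add]
  rw [ENNReal.tsum_eq_add_tsum_ite i]
  congr 1
  refine tsum_congr fun j => ?_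
  split_ifs <;> simp

/-- All coefficients are finite. -/
def FinC (f : Ser) : Prop := ∀ n, coeff n f ≠ ⊤

theorem FinC.mono {f g : Ser} (hg : FinC g) (h : f ≤ g) : FinC f :=
  fun n => ne_top_of_le_ne_top (hg n) (h n)

theorem FinC.add {f g : Ser} (hf : FinC f) (hg : FinC g) : FinC (f + g) := fun n => by
  simpa using ⟨hf n, hg n⟩

theorem FinC.mul {f g : Ser} (hf : FinC f) (hg : FinC g) : FinC (f * g) := fun n => by
  rw [PowerSeries.coeff_mul]
  exact ENNReal.sum_ne_top.2 fun i _ => ENNReal.mul_ne_top (hf _) (hg _)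

theorem finC_one : FinC 1 := fun n => by
  rw [PowerSeries.coeff_one]; split_ifs <;> simp

theorem LeN.cancel {n : ℕ} {a b c : Ser} (ha : FinC a) (h : LeN n (a + b) (a + c)) :
    LeN n b c := fun m hm =>
  (ENNReal.add_le_add_iff_left (ha m)).1 (by simpa using h m hm)

/-- Coefficientwise truncated subtraction. -/
def sub (f g : Ser) : Ser := mk fun n => coeff n f - coeff n g

theorem add_sub_of_le {f g : Ser} (h : g ≤ f) : g + sub f g = f := by
  ext n; simp [sub, add_tsub_cancel_of_le (h n)]

theorem sub_le_iff {f g h : Ser} : sub f g ≤ h ↔ f ≤ h + g := by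
  simp [sub, le_def, tsub_le_iff_right]

theorem sub_le (f g : Ser) : sub f g ≤ f := fun n => by simp [sub]

/-- The geometric series `∑ bⁿ`. -/
def geom (b : Ser) : Ser := psum fun n : ℕ => b ^ n

theorem geom_eq (b : Ser) : geom b = 1 + b * geom b := by
  rw [geom, mul_psum]
  ext n
  simp only [coeff_psum, map_add]
  rw [tsum_eq_zero_add' ENNReal.summable, pow_zero]
  congr 1
  exact tsum_congr fun m => by rw [pow_succ']

theorem one_le_geom (b : Ser) : 1 ≤ geom b := by
  rw [geom_eq]; exact le_self_add

theorem geom_mono {a b : Ser} (h : a ≤ b) : geom a ≤ geom b :=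
  psum_mono fun n => pow_le_pow_left' h n

theorem le_geom {f a b : Ser} (hb : coeff 0 b = 0) (h : f ≤ a + b * f) : f ≤ a * geom b := by
  refine le_of_step (ι := Unit) (f := fun _ => f) (g := fun _ => a * geom b) (fun n ih _ => ?_) ()
  refine (LeN.of_le h).trans ?_
  have : a * geom b = a + b * (a * geom b) := by
    conv_lhs => rw [geom_eq]
    ring
  rw [this]
  exact LeN.add LeN.rfl ((ih ()).mul_succ le_rfl hb)

/-- Fixed points of maps that improve the order of agreement. -/
theorem exists_fixed (Φ : (ι → Ser) → ι → Ser)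
    (h : ∀ n f g, (∀ i, LeN n (f i) (g i)) → ∀ i, LeN (n + 1) (Φ f i) (Φ g i)) :
    ∃ f, Φ f = f := by
  have key : ∀ n k i, LeN n (Φ^[n] (fun _ => 0) i) (Φ^[n + k] (fun _ => 0) i) ∧
      LeN n (Φ^[n + k] (fun _ => 0) i) (Φ^[n] (fun _ => 0) i) := fun n => by
    induction n with
    | zero => exact fun k i => ⟨leN_zero _ _, leN_zero _ _⟩
    | succ n ih =>
      intro k i
      rw [show n + 1 + k = (n + k) + 1 by omega, Function.iterate_succ_apply',
        Function.iterate_succ_apply']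
      exact ⟨h n _ _ (fun i => (ih k i).1) i, h n _ _ (fun i => (ih k i).2) i⟩
  have kc : ∀ n k i m, m < n → coeff m (Φ^[n] (fun _ => 0) i) =
      coeff m (Φ^[n + k] (fun _ => 0) i) := fun n k i m hm =>
    le_antisymm ((key n k i).1 m hm) ((key n k i).2 m hm)
  set F : ι → Ser := fun i => mk fun m => coeff m (Φ^[m + 1] (fun _ => 0) i) with hF
  have hFn : ∀ n i m, m < n → coeff m (F i) = coeff m (Φ^[n] (fun _ => 0) i) := by
    intro n i m hm
    rw [hF]; simp only [coeff_mk]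
    obtain ⟨k, rfl⟩ := Nat.exists_eq_add_of_le (Nat.succ_le_of_lt hm)
    exact kc (m + 1) k i m (by omega)
  refine ⟨F, funext fun i => PowerSeries.ext fun m => ?_⟩
  rw [hFn (m + 2) i m (by omega), Function.iterate_succ_apply']
  exact le_antisymm
    (h (m + 1) _ _ (fun i k hk => (hFn (m + 1) i k hk).le) i m (by omega))
    (h (m + 1) _ _ (fun i k hk => (hFn (m + 1) i k hk).ge) i m (by omega))

theorem fixed_unique {Φ : (ι → Ser) → ι → Ser}
    (h : ∀ n f g, (∀ i, LeN n (f i) (g i)) → ∀ i, LeN (n + 1) (Φ f i) (Φ g i))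
    {f g : ι → Ser} (hf : Φ f = f) (hg : Φ g = g) : f = g := by
  have : ∀ {f g : ι → Ser}, Φ f = f → Φ g = g → ∀ i, f i ≤ g i := fun {f g} hf hg =>
    le_of_step fun n ih i => by
      have := h n f g ih i
      rwa [hf, hg] at this
  exact funext fun i => le_antisymm (this hf hg i) (this hg hf i)

theorem eq_geom {f a b : Ser} (hb : coeff 0 b = 0) (h : f = a + b * f) : f = a * geom b := by
  refine congrFun (fixed_unique (ι := Unit) (Φ := fun F i => a + b * F i) (f := fun _ => f)
    (g := fun _ => a * geom b) ?_ (funext fun _ => h.symm) (funext fun _ => ?_)) ()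
  · exact fun n F H ih i => LeN.add LeN.rfl ((ih i).mul_succ le_rfl hb)
  · conv_rhs => rw [geom_eq]
    ring

/-- Composition of kernels. -/
def kmul (A B : ι → ι → Ser) (x y : ι) : Ser := psum fun u => A x u * B u y

theorem kmul_assoc (A B C : ι → ι → Ser) : kmul (kmul A B) C = kmul A (kmul B C) := by
  funext x y
  simp only [kmul, psum_mul, mul_psum]
  rw [psum_comm]
  simp only [mul_assoc]

theorem kmul_mono {A B A' B' : ι → ι → Ser} (h : ∀ x y, A x y ≤ A' x y)
    (h' : ∀ x y, B x y ≤ B' x y) (x y : ι) : kmul A B x y ≤ kmul A' B' x y :=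
  psum_mono fun u => mul_le_mul' (h x u) (h' u y)

end Ser

section Lattice

variable {d : ℕ}

theorem dist1_comm (x y : Pt d) : dist1 x y = dist1 y x :=
  Finset.sum_congr rfl fun i _ => by omega

theorem dist1_self (x : Pt d) : dist1 x x = 0 := by simp [dist1]

theorem dist1_triangle (x y z : Pt d) : dist1 x z ≤ dist1 x y + dist1 y z := by
  simp only [dist1, ← Finset.sum_add_distrib]
  exact Finset.sum_le_sum fun i _ => by omega

theorem adj_comm {x y : Pt d} : Adj x y ↔ Adj y x := by rw [Adj, Adj, dist1_comm]

theorem Adj.ne {x y : Pt d} (h : Adj x y) : x ≠ y := by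
  rintro rfl; simp [Adj, dist1_self] at h

/-- The unit vectors `±eᵢ`. -/
def uvec (i : Fin d × Bool) : Pt d := Pi.single i.1 (if i.2 then 1 else -1)

theorem uvec_injective : Function.Injective (uvec (d := d)) := by
  rintro ⟨i, a⟩ ⟨j, b⟩ h
  have h1 := congrFun h i
  rcases eq_or_ne i j with rfl | hij
  · cases a <;> cases b <;> simp [uvec] at h1 ⊢
  · cases a <;> cases b <;> simp [uvec, hij] at h1

theorem adj_iff (x y : Pt d) : Adj x y ↔ ∃ i, y = x + uvec i := by
  constructor
  · intro h
    have h' : ∑ i, (x i - y i).natAbs = 1 := h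
    obtain ⟨i, hi⟩ : ∃ i, (x i - y i).natAbs ≠ 0 := by
      by_contra hc
      push Not at hc
      simp [hc] at h'
    rw [← Finset.add_sum_erase _ _ (Finset.mem_univ i)] at h'
    have h0 : ∑ j ∈ Finset.univ.erase i, (x j - y j).natAbs = 0 := by omega
    have h1 : (x i - y i).natAbs = 1 := by omega
    rw [Finset.sum_eq_zero_iff] at h0
    refine ⟨(i, decide (y i = x i + 1)), funext fun j => ?_⟩
    by_cases hj : j = i
    · subst hj
      simp only [uvec, Pi.add_apply, Pi.single_eq_same]
      by_cases hc : y j = x j + 1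
      · simp [hc]
      · simp [hc]; omega
    · have := h0 j (by simp [hj])
      simp [uvec, hj]; omega
  · rintro ⟨⟨i, b⟩, rfl⟩
    simp only [Adj, dist1, uvec, Pi.add_apply]
    rw [Finset.sum_eq_single i]
    · cases b <;> simp
    · intro j _ hj; simp [hj]
    · simp

theorem tsum_adj (x : Pt d) (f : Pt d → ℝ≥0∞) :
    ∑' y, (if Adj x y then f y else 0) = ∑ i : Fin d × Bool, f (x + uvec i) := by
  have hinj : Function.Injective fun i : Fin d × Bool => x + uvec i :=
    fun i j h => uvec_injective (add_left_cancel h)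
  rw [← tsum_fintype (L := .unconditional _), ← hinj.tsum_eq]
  · refine tsum_congr fun i => ?_
    rw [if_pos ((adj_iff _ _).2 ⟨i, rfl⟩)]
  · intro y hy
    by_cases h : Adj x y
    · obtain ⟨i, hi⟩ := (adj_iff _ _).1 h
      exact ⟨i, hi.symm⟩
    · simp [h] at hy

theorem dist1_addLeft (a x y : Pt d) : dist1 (a + x) (a + y) = dist1 x y := by
  simp [dist1]

theorem isLatticeIso_addLeft (a : Pt d) : IsLatticeIso (Equiv.addLeft a) :=
  fun x y => dist1_addLeft a x y

theorem isLatticeIso_neg : IsLatticeIso (Equiv.neg (Pt d)) := fun x y =>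
  Finset.sum_congr rfl fun i _ => by simp; omega

theorem isLatticeIso_perm (σ : Equiv.Perm (Fin d)) :
    IsLatticeIso (Equiv.arrowCongr σ (Equiv.refl ℤ)) := fun x y => by
  simp only [dist1, Equiv.arrowCongr_apply, Equiv.coe_refl, Function.comp, id]
  exact σ.symm.sum_comp fun i => (x i - y i).natAbs

end Lattice

section

open Ser PowerSeries

section Machine

variable {d : ℕ} (w : List (Pt d) → ℝ≥0∞)

/-- The step series: `X` for nearest-neighbour steps. -/
def J (v x : Pt d) : Ser := if Adj v x then X else 0

/-- The step series for steps that avoid `S`. -/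
def JA (S : Finset (Pt d)) (v x : Pt d) : Ser := if Adj v x ∧ x ∉ S then X else 0

/-- The weight collected when stepping from `v` to `x`, where `p` is the part of the current
loop erasure preceding `v`. -/
def stepW (p : List (Pt d)) (v x : Pt d) : Ser :=
  if x ∈ p then C (w (p.dropWhile (fun y => y ≠ x) ++ [v, x])) else 1

/-- The part of the loop erasure preceding `x` after a step from `v` to `x`. -/
def stepL (p : List (Pt d)) (v x : Pt d) : List (Pt d) :=
  if x ∈ p then p.takeWhile (fun y => y ≠ x) else p ++ [v]

theorem coeff_zero_J (v x : Pt d) : coeff 0 (J v x) = 0 := by unfold J; split_ifs <;> simp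

theorem coeff_zero_JA (S : Finset (Pt d)) (v x : Pt d) : coeff 0 (JA S v x) = 0 := by
  unfold JA; split_ifs <;> simp

theorem J_self (v : Pt d) : J v v = 0 := if_neg fun h => h.ne rfl

theorem JA_le (S : Finset (Pt d)) (v x : Pt d) : JA S v x ≤ J v x := by
  unfold JA J; split_ifs with h h' <;> first | exact le_rfl | exact Ser.zero_le _ | tauto

theorem JA_of_mem {S : Finset (Pt d)} {x : Pt d} (v : Pt d) (h : x ∈ S) : JA S v x = 0 :=
  if_neg fun h' => h'.2 h

theorem JA_of_notMem {S : Finset (Pt d)} {x : Pt d} (v : Pt d) (h : x ∉ S) :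
    JA S v x = J v x := by simp [JA, J, h]

theorem JA_insert_of_ne {S : Finset (Pt d)} {s x : Pt d} (v : Pt d) (h : x ≠ s) :
    JA (insert s S) v x = JA S v x := by simp [JA, h]

theorem stepW_nil (v x : Pt d) : stepW w [] v x = 1 := by simp [stepW]

theorem stepL_nil (v x : Pt d) : stepL [] v x = [v] := by simp [stepL]

theorem stepW_cons_self (u : Pt d) (q : List (Pt d)) (v : Pt d) :
    stepW w (u :: q) v u = C (w ((u :: q) ++ [v, u])) := by simp [stepW]

theorem stepL_cons_self (u : Pt d) (q : List (Pt d)) (v : Pt d) :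
    stepL (u :: q) v u = [] := by simp [stepL]

theorem stepW_cons_of_ne {u x : Pt d} (q : List (Pt d)) (v : Pt d) (h : x ≠ u) :
    stepW w (u :: q) v x = stepW w q v x := by simp [stepW, h, h.symm]

theorem stepL_cons_of_ne {u x : Pt d} (q : List (Pt d)) (v : Pt d) (h : x ≠ u) :
    stepL (u :: q) v x = u :: stepL q v x := by
  simp only [stepL, List.mem_cons, h, false_or]
  split_ifs <;> simp [h.symm]

/-- The states of the loop-erasure machine. -/
abbrev MState (d : ℕ) := List (Pt d) × Pt d × Finset (Pt d) × Pt d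

theorem exists_CS : ∃ F : MState d → Ser,
    (fun i : MState d => (if i.2.1 = i.2.2.2 then 1 else 0) + psum fun x =>
      JA i.2.2.1 i.2.1 x * (stepW w i.1 i.2.1 x *
        F (stepL i.1 i.2.1 x, x, i.2.2.1, i.2.2.2))) = F := by
  refine exists_fixed (fun F (i : MState d) => (if i.2.1 = i.2.2.2 then 1 else 0) + psum fun x =>
      JA i.2.2.1 i.2.1 x * (stepW w i.1 i.2.1 x *
        F (stepL i.1 i.2.1 x, x, i.2.2.1, i.2.2.2))) fun n F H h i => ?_
  refine LeN.add LeN.rfl (LeN.psum fun x => LeN.mul_succ ?_ le_rfl (coeff_zero_JA _ _ _))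
  exact LeN.mul LeN.rfl (h _)

/-- Generating series of the walks that start at `v` with preceding loop erasure `p`, avoid `S`
after the start, and end at `y`. -/
def CS (p : List (Pt d)) (v : Pt d) (S : Finset (Pt d)) (y : Pt d) : Ser :=
  (exists_CS w).choose (p, v, S, y)

theorem CS_eq (p : List (Pt d)) (v : Pt d) (S : Finset (Pt d)) (y : Pt d) :
    CS w p v S y = (if v = y then 1 else 0) + psum fun x =>
      JA S v x * (stepW w p v x * CS w (stepL p v x) x S y) :=
  (congrFun (exists_CS w).choose_spec (p, v, S, y)).symm

theorem exists_RS : ∃ F : Pt d × List (Pt d) × Pt d × Finset (Pt d) → Ser,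
    (fun i : Pt d × List (Pt d) × Pt d × Finset (Pt d) => psum fun x =>
      JA i.2.2.2 i.2.2.1 x * (if x = i.1 then C (w ((i.1 :: i.2.1) ++ [i.2.2.1, i.1])) else
        stepW w i.2.1 i.2.2.1 x * F (i.1, stepL i.2.1 i.2.2.1 x, x, i.2.2.2))) = F := by
  refine exists_fixed (fun F (i : Pt d × List (Pt d) × Pt d × Finset (Pt d)) => psum fun x =>
      JA i.2.2.2 i.2.2.1 x * (if x = i.1 then C (w ((i.1 :: i.2.1) ++ [i.2.2.1, i.1])) else
        stepW w i.2.1 i.2.2.1 x * F (i.1, stepL i.2.1 i.2.2.1 x, x, i.2.2.2)))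
      fun n F H h i => ?_
  refine LeN.psum fun x => LeN.mul_succ ?_ le_rfl (coeff_zero_JA _ _ _)
  split_ifs
  · exact LeN.rfl
  · exact LeN.mul LeN.rfl (h _)

/-- Generating series of the first returns to `u`, from `v` with preceding loop erasure
`u :: q`, avoiding `S`. -/
def RS (u : Pt d) (q : List (Pt d)) (v : Pt d) (S : Finset (Pt d)) : Ser :=
  (exists_RS w).choose (u, q, v, S)

theorem RS_eq (u : Pt d) (q : List (Pt d)) (v : Pt d) (S : Finset (Pt d)) :
    RS w u q v S = psum fun x =>
      JA S v x * (if x = u then C (w ((u :: q) ++ [v, u])) else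
        stepW w q v x * RS w u (stepL q v x) x S) :=
  (congrFun (exists_RS w).choose_spec (u, q, v, S)).symm

theorem CS_eq_zero {p : List (Pt d)} {v : Pt d} {S : Finset (Pt d)} {y : Pt d}
    (hy : y ∈ S) (hv : v ∉ S) : CS w p v S y = 0 := by
  refine le_antisymm ?_ (Ser.zero_le _)
  refine le_of_step (ι := {i : List (Pt d) × Pt d // i.2 ∉ S})
    (f := fun i => CS w i.1.1 i.1.2 S y) (g := fun _ => 0) (fun n ih => ?_) ⟨(p, v), hv⟩
  rintro ⟨⟨p, v⟩, hv⟩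
  simp only at hv ⊢
  rw [CS_eq, if_neg (show ¬ v = y by rintro rfl; exact hv hy), zero_add,
    show (0 : Ser) = psum fun x => JA S v x * (stepW w p v x * 0) by simp]
  refine LeN.psum fun x => ?_
  by_cases hx : x ∈ S
  · rw [JA_of_mem v hx]; simp; rfl
  · exact LeN.mul_succ (LeN.mul LeN.rfl (ih ⟨(_, x), hx⟩)) le_rfl (coeff_zero_JA _ _ _)

/-- Removing the initial point of the past splits the walks at their first return to it. -/
theorem CS_cons {u : Pt d} {S : Finset (Pt d)} (hu : u ∉ S) (q : List (Pt d)) (v y : Pt d) :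
    CS w (u :: q) v S y = CS w q v (insert u S) y + RS w u q v S * CS w [] u S y := by
  have hfix := fixed_unique (ι := List (Pt d) × Pt d)
    (Φ := fun F i => (if i.2 = y then 1 else 0) + psum fun x =>
      JA S i.2 x * (stepW w (u :: i.1) i.2 x *
        if x = u then CS w [] u S y else F (stepL i.1 i.2 x, x)))
    (f := fun i => CS w (u :: i.1) i.2 S y)
    (g := fun i => CS w i.1 i.2 (insert u S) y + RS w u i.1 i.2 S * CS w [] u S y) ?_ ?_ ?_
  · exact congrFun hfix (q, v)
  · intro n F H h i
    refine LeN.add LeN.rfl (LeN.psum fun x => LeN.mul_succ ?_ le_rfl (coeff_zero_JA _ _ _))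
    split_ifs
    · rfl
    · exact LeN.mul LeN.rfl (h _)
  · funext ⟨q, v⟩
    simp only
    conv_rhs => rw [CS_eq]
    congr 2
    funext x
    by_cases hx : x = u
    · subst hx; rw [if_pos rfl, stepL_cons_self]
    · rw [if_neg hx, stepL_cons_of_ne q v hx]
  · funext ⟨q, v⟩
    simp only
    conv_rhs => rw [CS_eq, RS_eq]
    rw [psum_mul, add_assoc, ← psum_add]
    congr 2
    funext x
    by_cases hx : x = u
    · subst hx
      rw [if_pos rfl, JA_of_mem v (Finset.mem_insert_self _ _), stepW_cons_self]
      simp; ring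
    · rw [if_neg hx, JA_insert_of_ne v hx, stepW_cons_of_ne w q v hx, if_neg hx]
      ring

theorem CS_anti {S T : Finset (Pt d)} (h : S ⊆ T) (p : List (Pt d)) (v y : Pt d) :
    CS w p v T y ≤ CS w p v S y := by
  refine le_of_step (ι := List (Pt d) × Pt d)
    (f := fun i => CS w i.1 i.2 T y) (g := fun i => CS w i.1 i.2 S y) (fun n ih => ?_) (p, v)
  rintro ⟨p, v⟩
  simp only
  rw [CS_eq w p v T, CS_eq w p v S]
  refine LeN.add LeN.rfl (LeN.psum fun x => ?_)
  refine LeN.mul_succ (LeN.mul LeN.rfl (ih (_, x))) ?_ (coeff_zero_JA _ _ _)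
  unfold JA
  split_ifs with h1 h2
  · exact le_rfl
  · exact absurd ⟨h1.1, fun h3 => h1.2 (h h3)⟩ h2
  · exact Ser.zero_le _
  · exact le_rfl

/-- The walks from `v` avoiding `T` that end next to `u`. -/
def DS (u : Pt d) (q : List (Pt d)) (v : Pt d) (T : Finset (Pt d)) : Ser :=
  psum fun x => CS w q v T x * J x u

theorem DS_eq (u : Pt d) (q : List (Pt d)) (v : Pt d) (T : Finset (Pt d)) :
    DS w u q v T = J v u + psum fun x => JA T v x * (stepW w q v x * DS w u (stepL q v x) x T) := by
  rw [DS]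
  simp only [CS_eq w q v, add_mul, psum_add]
  congr 1
  · rw [psum_single _ v]
    · simp
    · intro j hj; simp [hj.symm]
  · simp only [psum_mul, DS, mul_psum]
    rw [psum_comm]
    simp only [mul_assoc]

variable {w} {M : ℝ≥0∞}

theorem RS_le (hw : ∀ l, w l ≤ M) (u : Pt d) (q : List (Pt d)) (v : Pt d) (S : Finset (Pt d)) :
    RS w u q v S ≤ C M * DS w u q v (insert u S) := by
  refine le_of_step (ι := List (Pt d) × Pt d)
    (f := fun i => RS w u i.1 i.2 S) (g := fun i => C M * DS w u i.1 i.2 (insert u S))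
    (fun n ih => ?_) (q, v)
  rintro ⟨q, v⟩
  simp only
  rw [DS_eq, RS_eq, psum_split _ u, mul_add, mul_psum]
  refine LeN.add (LeN.of_le ?_) (LeN.psum fun x => ?_)
  · rw [if_pos rfl, mul_comm]
    refine mul_le_mul' ?_ (JA_le _ _ _)
    intro n
    rw [coeff_C, coeff_C]
    split_ifs
    · exact hw _
    · exact le_rfl
  · by_cases hx : x = u
    · rw [if_pos hx]; exact LeN.of_le (Ser.zero_le _)
    · rw [if_neg hx, if_neg hx, JA_insert_of_ne v hx]
      rw [mul_left_comm (C M)]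
      refine LeN.mul_succ ?_ le_rfl (coeff_zero_JA _ _ _)
      rw [mul_left_comm (C M)]
      exact LeN.mul LeN.rfl (ih (_, x))

theorem RS_insert_le (hw : ∀ l, w l ≤ M) {u s : Pt d} (hs : s ≠ u) (q : List (Pt d)) (v : Pt d)
    (S : Finset (Pt d)) :
    RS w u q v S + C M * DS w u q v (insert s (insert u S)) ≤
      RS w u q v (insert s S) + C M * DS w u q v (insert u S) := by
  refine le_of_step (ι := List (Pt d) × Pt d)
    (f := fun i => RS w u i.1 i.2 S + C M * DS w u i.1 i.2 (insert s (insert u S)))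
    (g := fun i => RS w u i.1 i.2 (insert s S) + C M * DS w u i.1 i.2 (insert u S))
    (fun n ih => ?_) (q, v)
  rintro ⟨q, v⟩
  simp only
  rw [DS_eq, DS_eq w u q v (insert u S), RS_eq, RS_eq w u q v (insert s S), mul_add, mul_add,
    add_left_comm, add_left_comm (psum _), mul_psum, mul_psum, ← psum_add, ← psum_add]
  refine LeN.add LeN.rfl (LeN.psum fun x => ?_)
  by_cases hxs : x = s
  · subst hxs
    rw [if_neg hs, if_neg hs, JA_of_mem v (Finset.mem_insert_self _ _),
      JA_of_mem v (Finset.mem_insert_self _ _), JA_insert_of_ne v hs]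
    refine LeN.of_le ?_
    have := RS_le hw u (stepL q v x) x S
    calc _ = JA S v x * (stepW w q v x * RS w u (stepL q v x) x S) := by ring
      _ ≤ JA S v x * (stepW w q v x * (C M * DS w u (stepL q v x) x (insert u S))) := by gcongr
      _ = _ := by ring
  · rw [JA_insert_of_ne v hxs, JA_insert_of_ne v hxs]
    by_cases hxu : x = u
    · subst hxu
      rw [if_pos rfl, if_pos rfl, JA_of_mem v (Finset.mem_insert_self _ _)]
      simp; rfl
    · rw [if_neg hxu, if_neg hxu, JA_insert_of_ne v hxu]
      have h1 := (LeN.mul (LeN.rfl (f := stepW w q v x)) (ih (stepL q v x, x))).mul_succ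
        (le_refl (JA S v x)) (coeff_zero_JA _ _ _)
      refine LeN.trans (LeN.of_eq ?_) (h1.trans (LeN.of_eq ?_)) <;> simp only <;> ring

end Machine

end

section

open Ser PowerSeries

section TwoPoint

variable {d : ℕ} (w : List (Pt d) → ℝ≥0∞)

/-- Two-point series of walks avoiding `S`. -/
def GS (S : Finset (Pt d)) (x y : Pt d) : Ser := if x ∈ S then 0 else CS w [] x S y

/-- Series of closed walks avoiding `S`. -/
def gS (S : Finset (Pt d)) (x : Pt d) : Ser := GS w S x x

/-- Series of first returns avoiding `S`. -/
def rS (S : Finset (Pt d)) (v : Pt d) : Ser := psum fun x => JA S v x * RS w v [] x S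

/-- Series of walks avoiding `S` and not returning to their starting point. -/
def US (S : Finset (Pt d)) (v y : Pt d) : Ser :=
  (if v = y then 1 else 0) + psum fun x => J v x * GS w (insert v S) x y

theorem GS_of_mem {S : Finset (Pt d)} {x : Pt d} (h : x ∈ S) (y : Pt d) : GS w S x y = 0 :=
  if_pos h

theorem GS_of_mem_right (S : Finset (Pt d)) (x : Pt d) {y : Pt d} (h : y ∈ S) :
    GS w S x y = 0 := by
  unfold GS; split_ifs with hx
  · rfl
  · exact CS_eq_zero w h hx

theorem GS_anti {S T : Finset (Pt d)} (h : S ⊆ T) (x y : Pt d) : GS w T x y ≤ GS w S x y := by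
  unfold GS; split_ifs with h1 h2 h2
  · exact le_rfl
  · exact Ser.zero_le _
  · exact absurd (h h2) h1
  · exact CS_anti w h _ _ _

theorem gS_anti {S T : Finset (Pt d)} (h : S ⊆ T) (x : Pt d) : gS w T x ≤ gS w S x :=
  GS_anti w h x x

theorem coeff_zero_rS (S : Finset (Pt d)) (v : Pt d) : coeff 0 (rS w S v) = 0 := by
  simp only [rS, coeff_psum, coeff_zero_mul (coeff_zero_JA _ _ _), tsum_zero]

theorem GS_rec {S : Finset (Pt d)} {v : Pt d} (hv : v ∉ S) (y : Pt d) :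
    GS w S v y = US w S v y + rS w S v * GS w S v y := by
  conv_lhs => rw [GS, if_neg hv, CS_eq]
  rw [US, rS, psum_mul, add_assoc, ← psum_add]
  congr 2
  funext x
  rw [stepW_nil, stepL_nil, one_mul, CS_cons w hv, GS, GS, if_neg hv]
  by_cases hx : x ∈ S
  · rw [JA_of_mem v hx, if_pos (Finset.mem_insert_of_mem hx)]; simp
  · rw [JA_of_notMem v hx]
    by_cases hxv : x = v
    · subst hxv; simp [J_self]
    · rw [if_neg (by simp [hx, hxv])]; ring

theorem US_self (S : Finset (Pt d)) (v : Pt d) : US w S v v = 1 := by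
  simp [US, GS_of_mem_right]

theorem gS_eq {S : Finset (Pt d)} {v : Pt d} (hv : v ∉ S) : gS w S v = geom (rS w S v) := by
  have := eq_geom (coeff_zero_rS w S v) (GS_rec w hv v)
  rwa [US_self, one_mul] at this

theorem gS_rec {S : Finset (Pt d)} {v : Pt d} (hv : v ∉ S) :
    gS w S v = 1 + rS w S v * gS w S v := by
  rw [gS_eq w hv]; exact geom_eq _

theorem GS_eq {S : Finset (Pt d)} {v : Pt d} (hv : v ∉ S) (y : Pt d) :
    GS w S v y = gS w S v * US w S v y := by
  rw [eq_geom (coeff_zero_rS w S v) (GS_rec w hv y), gS_eq w hv, mul_comm]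

theorem one_le_gS {S : Finset (Pt d)} {v : Pt d} (hv : v ∉ S) : 1 ≤ gS w S v := by
  rw [gS_eq w hv]; exact one_le_geom _

theorem US_le_GS {S : Finset (Pt d)} {v : Pt d} (hv : v ∉ S) (y : Pt d) :
    US w S v y ≤ GS w S v y := by
  rw [GS_eq w hv]; exact le_mul_of_one_le_left (Ser.zero_le _) (one_le_gS w hv)

variable {w} {M : ℝ≥0∞}

theorem DS_nil_le (u x : Pt d) (S : Finset (Pt d)) (hx : x ∉ S) :
    DS w u [] x S = psum fun x' => GS w S x x' * J x' u := by
  simp [DS, GS, hx]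

theorem rS_le (hw : ∀ l, w l ≤ M) (S : Finset (Pt d)) (v : Pt d) :
    rS w S v ≤ C M * kmul J (kmul (GS w (insert v S)) J) v v := by
  rw [rS, kmul, mul_psum]
  refine psum_mono fun x => ?_
  by_cases hx : x ∈ S
  · rw [JA_of_mem v hx]; simp
  by_cases hxv : x = v
  · subst hxv; refine (mul_le_mul' (JA_le _ _ _) le_rfl).trans ?_; simp [J_self]
  rw [JA_of_notMem v hx, mul_left_comm]
  refine mul_le_mul' le_rfl ((RS_le hw v [] x S).trans ?_)
  rw [DS_nil_le v x _ (by simp [hx, hxv])]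
  rfl

theorem rS_insert_le (hw : ∀ l, w l ≤ M) (S : Finset (Pt d)) {v s : Pt d} (hs : s ≠ v) :
    rS w S v + C M * kmul J (kmul (GS w (insert s (insert v S))) J) v v ≤
      rS w (insert s S) v + C M * kmul J (kmul (GS w (insert v S)) J) v v := by
  rw [rS, rS, kmul, kmul, mul_psum, mul_psum, ← psum_add, ← psum_add]
  refine psum_mono fun x => ?_
  by_cases hx : x ∈ S
  · rw [JA_of_mem v hx]; simp [kmul, GS_of_mem, hx]
  by_cases hxv : x = v
  · subst hxv; refine (add_le_add (mul_le_mul' (JA_le _ _ _) le_rfl) le_rfl).trans ?_; simp [J_self]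
  have hD : ∀ T : Finset (Pt d), x ∉ T → kmul (GS w T) J x v = DS w v [] x T :=
    fun T hT => (DS_nil_le v x T hT).symm
  rw [JA_of_notMem v hx, hD (insert v S) (by simp [hx, hxv])]
  by_cases hxs : x = s
  · subst hxs
    rw [JA_of_mem v (Finset.mem_insert_self _ _)]
    simp only [kmul, GS_of_mem w (Finset.mem_insert_self _ _), zero_mul, psum_zero, mul_zero,
      add_zero, zero_add]
    rw [mul_left_comm]
    exact mul_le_mul' le_rfl (RS_le hw v [] x S)
  · rw [hD _ (by simp [hx, hxv, hxs]), JA_of_notMem v (by simp [hx, hxs]),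
      mul_left_comm, mul_left_comm (C M), ← mul_add, ← mul_add]
    exact mul_le_mul' le_rfl (RS_insert_le hw hs [] x S)

theorem GS_le_GS_empty (S : Finset (Pt d)) (x y : Pt d) : GS w S x y ≤ GS w ∅ x y :=
  GS_anti w (Finset.empty_subset S) x y

theorem stepW_eq_C (p : List (Pt d)) (v x : Pt d) :
    stepW w p v x = C (if x ∈ p then w (p.dropWhile (fun y => y ≠ x) ++ [v, x]) else 1) := by
  unfold stepW; split_ifs <;> simp

theorem coeff_zero_CS (p : List (Pt d)) (v : Pt d) (S : Finset (Pt d)) (y : Pt d) :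
    coeff 0 (CS w p v S y) = if v = y then 1 else 0 := by
  rw [CS_eq]
  simp only [map_add, coeff_psum]
  rw [ENNReal.tsum_eq_zero.2 fun x => ?_, add_zero]
  · split_ifs <;> simp
  · exact coeff_zero_mul (coeff_zero_JA _ _ _) _

theorem coeff_succ_CS (n : ℕ) (p : List (Pt d)) (v : Pt d) (S : Finset (Pt d)) (y : Pt d) :
    coeff (n + 1) (CS w p v S y) = ∑' x, if Adj v x ∧ x ∉ S then
      (if x ∈ p then w (p.dropWhile (fun y => y ≠ x) ++ [v, x]) else 1) *
        coeff n (CS w (stepL p v x) x S y) else 0 := by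
  rw [CS_eq]
  simp only [map_add, coeff_psum]
  have : coeff (n + 1) (if v = y then (1 : Ser) else 0) = 0 := by
    split_ifs <;> simp [coeff_one]
  rw [this, zero_add]
  refine tsum_congr fun x => ?_
  rw [JA, stepW_eq_C]
  by_cases h : Adj v x ∧ x ∉ S
  · rw [if_pos h, if_pos h, coeff_succ_X_mul, coeff_C_mul]
  · rw [if_neg h, if_neg h, zero_mul, map_zero]

theorem tsum_coeff_CS_le {M : ℝ≥0∞} (hw : ∀ l, w l ≤ M) (hM : 1 ≤ M) (n : ℕ) :
    ∀ (p : List (Pt d)) (v : Pt d) (S : Finset (Pt d)),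
      ∑' y, coeff n (CS w p v S y) ≤ (2 * d * M) ^ n := by
  induction n with
  | zero => intro p v S; simp [coeff_zero_CS]
  | succ n ih =>
    intro p v S
    simp only [coeff_succ_CS]
    rw [ENNReal.tsum_comm]
    calc _ ≤ ∑' x, (if Adj v x then M * (2 * d * M) ^ n else 0) := by
          refine ENNReal.tsum_le_tsum fun x => ?_
          by_cases hx : Adj v x ∧ x ∉ S
          · simp only [hx, not_false_eq_true, and_self, if_true]
            rw [ENNReal.tsum_mul_left]
            refine mul_le_mul' ?_ (ih _ _ _)
            split_ifs
            · exact hw _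
            · exact hM
          · simp [hx]
      _ = (2 * d * M) ^ (n + 1) := by
          rw [tsum_adj]
          simp [pow_succ]; ring

theorem finC_CS {M : ℝ≥0∞} (hw : ∀ l, w l ≤ M) (hM : M ≠ ⊤)
    (p : List (Pt d)) (v : Pt d) (S : Finset (Pt d)) (y : Pt d) : FinC (CS w p v S y) := by
  intro n
  refine ne_top_of_le_ne_top ?_ ((ENNReal.le_tsum y).trans
    (tsum_coeff_CS_le (w := w) (M := max M 1) (fun l => (hw l).trans (le_max_left _ _))
      (le_max_right _ _) n p v S))
  refine ENNReal.pow_ne_top (ENNReal.mul_ne_top (by finiteness) ?_)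
  simp [hM]

theorem finC_GS {M : ℝ≥0∞} (hw : ∀ l, w l ≤ M) (hM : M ≠ ⊤) (S : Finset (Pt d)) (x y : Pt d) :
    FinC (GS w S x y) := by
  unfold GS; split_ifs
  · exact fun n => by simp
  · exact finC_CS hw hM _ _ _ _

theorem coeff_CS_of_lt (m : ℕ) : ∀ (p : List (Pt d)) (v : Pt d) (S : Finset (Pt d)) (y : Pt d),
    m < dist1 v y → coeff m (CS w p v S y) = 0 := by
  induction m with
  | zero =>
    intro p v S y h
    rw [coeff_zero_CS, if_neg]
    rintro rfl; simp [dist1_self] at h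
  | succ m ih =>
    intro p v S y h
    rw [coeff_succ_CS, ENNReal.tsum_eq_zero]
    intro x
    by_cases hx : Adj v x
    · rw [ih]
      · simp
      · have := dist1_triangle v x y
        have h1 : dist1 v x = 1 := hx
        omega
    · simp [hx]

theorem coeff_GS_of_lt {m : ℕ} (S : Finset (Pt d)) {x y : Pt d} (h : m < dist1 x y) :
    coeff m (GS w S x y) = 0 := by
  unfold GS; split_ifs
  · simp
  · exact coeff_CS_of_lt m _ _ _ _ h

theorem JA_image {R : Pt d ≃ Pt d} (hR : IsLatticeIso R) (S : Finset (Pt d)) (v x : Pt d) :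
    JA (S.image R) (R v) (R x) = JA S v x := by
  have h : (Adj (R v) (R x) ∧ R x ∉ S.image R) ↔ (Adj v x ∧ x ∉ S) := by simp [Adj, hR v x]
  simp only [JA, h]

theorem J_image {R : Pt d ≃ Pt d} (hR : IsLatticeIso R) (v x : Pt d) :
    J (R v) (R x) = J v x := by
  have h : Adj (R v) (R x) ↔ Adj v x := by simp [Adj, hR v x]
  simp only [J, h]

theorem CS_image {R : Pt d ≃ Pt d} (hR : IsLatticeIso R) (hw : ∀ l, w (l.map R) = w l)
    (p : List (Pt d)) (v : Pt d) (S : Finset (Pt d)) (y : Pt d) :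
    CS w (p.map R) (R v) (S.image R) (R y) = CS w p v S y := by
  have hfix := fixed_unique (ι := List (Pt d) × Pt d)
    (Φ := fun F i => (if i.2 = y then 1 else 0) + psum fun x =>
      JA S i.2 x * (stepW w i.1 i.2 x * F (stepL i.1 i.2 x, x)))
    (f := fun i => CS w (i.1.map R) (R i.2) (S.image R) (R y))
    (g := fun i => CS w i.1 i.2 S y) ?_ ?_ ?_
  · exact congrFun hfix (p, v)
  · intro n F H h i
    exact LeN.add LeN.rfl (LeN.psum fun x => LeN.mul_succ (LeN.mul LeN.rfl (h _)) le_rfl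
      (coeff_zero_JA _ _ _))
  · funext ⟨p, v⟩
    simp only
    conv_rhs => rw [CS_eq, ← psum_equiv R]
    simp only [R.injective.eq_iff]
    congr 2
    funext x
    rw [JA_image hR]
    have hfun : (fun y => decide (y ≠ R x)) ∘ R = fun y => decide (y ≠ x) := by
      funext y; simp
    congr 2
    · simp only [stepW, List.mem_map_of_injective R.injective, List.dropWhile_map, hfun]
      rw [← hw]; simp
    · simp only [stepL, List.mem_map_of_injective R.injective, List.takeWhile_map, hfun]
      split_ifs <;> simp
  · funext ⟨p, v⟩
    exact (CS_eq w p v S y).symm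

theorem GS_image {R : Pt d ≃ Pt d} (hR : IsLatticeIso R) (hw : ∀ l, w (l.map R) = w l)
    (S : Finset (Pt d)) (x y : Pt d) : GS w (S.image R) (R x) (R y) = GS w S x y := by
  unfold GS
  rw [← CS_image hR hw [] x S y]
  simp

end TwoPoint

end

section

open Ser PowerSeries

section Bridge

variable {d : ℕ}

theorem le1Aux_append {α : Type*} [DecidableEq α] (pre l rest : List α)
    (h : (pre ++ l).Nodup) : le1Aux pre (l ++ rest) = le1Aux (pre ++ l) rest := by
  induction l generalizing pre with
  | nil => simp
  | cons x l ih =>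
    rw [List.cons_append, le1Aux, if_neg, ih]
    · simp
    · simpa using h
    · rw [List.nodup_append] at h
      intro hx
      exact h.2.2 x hx x (by simp) rfl

/-- The activities, extended by zero to lists which are not self-avoiding polygons. -/
def lw (lam : List (Pt d) → ℝ≥0) (l : List (Pt d)) : ℝ≥0∞ :=
  if IsSAPList l then (lam l : ℝ≥0∞) else 0

theorem lw_le {lam : List (Pt d) → ℝ≥0} {M : ℝ≥0} (h : ∀ l, IsSAPList l → lam l ≤ M)
    (l : List (Pt d)) : lw lam l ≤ M := by
  unfold lw; split_ifs with hl
  · exact_mod_cast h l hl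
  · exact zero_le

theorem isSAPList_map {R : Pt d ≃ Pt d} (hR : IsLatticeIso R) {l : List (Pt d)} :
    IsSAPList (l.map R) ↔ IsSAPList l := by
  unfold IsSAPList
  rw [List.Chain', List.Chain', List.isChain_map]
  have h1 : (fun a b => Adj (R a) (R b)) = Adj := by funext a b; simp [Adj, hR a b]
  rw [h1, List.length_map]
  refine and_congr_right fun _ => and_congr_right fun h3 => ?_
  rw [← List.map_dropLast, List.nodup_map_iff R.injective]
  refine and_congr_left fun _ => ?_
  obtain ⟨a, l, rfl⟩ : ∃ a t, l = a :: t := by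
    cases l with
    | nil => simp at h3
    | cons a t => exact ⟨a, t, rfl⟩
  simp only [List.map_cons, List.getLastD_cons, List.headI_cons, List.getLastD_map, R.injective.eq_iff]

theorem lw_map {lam : List (Pt d) → ℝ≥0} (h : SymmAssumption lam) {R : Pt d ≃ Pt d}
    (hR : IsLatticeIso R) (l : List (Pt d)) : lw lam (l.map R) = lw lam l := by
  simp only [lw, isSAPList_map hR]
  split_ifs with hl
  · rw [h.1 R hR l hl]
  · rfl

/-- The product of the activities of the loops erased along `rest` from the state `(p, v)`. -/
def runW (lam : List (Pt d) → ℝ≥0) : List (Pt d) → Pt d → List (Pt d) → ℝ≥0∞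
  | _, _, [] => 1
  | p, v, x :: rest =>
    (if x ∈ p then lw lam (p.dropWhile (fun y => y ≠ x) ++ [v, x]) else 1) *
      runW lam (stepL p v x) x rest

theorem dropWhile_ne_eq_cons {α : Type*} [DecidableEq α] {p : List α} {x : α} (hx : x ∈ p) :
    ∃ t, p.dropWhile (fun y => y ≠ x) = x :: t := by
  induction p with
  | nil => simp at hx
  | cons a p ih =>
    by_cases h : a = x
    · exact ⟨p, by simp [h]⟩
    · obtain ⟨t, ht⟩ := ih (by simpa [Ne.symm h] using hx)
      exact ⟨t, by rw [List.dropWhile_cons_of_pos (by simpa using h), ht]⟩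

theorem isSAPList_dropWhile {p : List (Pt d)} {v x : Pt d} (hx : x ∈ p)
    (hc : (p ++ [v, x]).IsChain Adj) (hn : (p ++ [v]).Nodup) :
    IsSAPList (p.dropWhile (fun y => y ≠ x) ++ [v, x]) := by
  obtain ⟨t, hat⟩ := dropWhile_ne_eq_cons hx
  have hs : p.dropWhile (fun y => y ≠ x) <:+ p := List.dropWhile_suffix _
  refine ⟨?_, ?_, ?_, ?_⟩
  · refine hc.suffix ?_
    obtain ⟨s, hs⟩ := hs
    exact ⟨s, by rw [← List.append_assoc, hs]⟩
  · rw [hat]; simp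
  · rw [hat, show x :: t ++ [v, x] = (x :: t ++ [v]) ++ [x] by simp, List.getLastD_concat]
    rfl
  · rw [show ∀ l : List (Pt d), l ++ [v, x] = (l ++ [v]) ++ [x] by simp, List.dropLast_concat]
    refine hn.sublist ?_
    exact hs.sublist.append_right _

theorem leAux_prod (lam : List (Pt d) → ℝ≥0) (rest : List (Pt d)) :
    ∀ (p : List (Pt d)) (v : Pt d) (fuel : ℕ), rest.length ≤ fuel →
      (p ++ v :: rest).IsChain Adj → (p ++ [v]).Nodup →
      ((leAux fuel (p ++ v :: rest)).2.map fun η => (lam η : ℝ≥0∞)).prod = runW lam p v rest := by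
  induction rest with
  | nil =>
    intro p v fuel _ _ hn
    cases fuel with
    | zero => simp [leAux, runW]
    | succ n =>
      have h0 := le1Aux_append [] (p ++ [v]) [] (by simpa using hn)
      rw [leAux]
      rw [List.append_nil, List.nil_append] at h0
      rw [h0]
      simp [le1Aux, runW]
  | cons x rest ih =>
    intro p v fuel hf hc hn
    have hvx : v ≠ x := by
      have : Adj v x := by
        have := hc.suffix (l₁ := v :: x :: rest) ⟨p, rfl⟩
        exact this.rel
      exact this.ne
    have hl : p ++ v :: x :: rest = (p ++ [v]) ++ x :: rest := by simp
    rw [runW]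
    by_cases hx : x ∈ p
    · obtain ⟨fuel, rfl⟩ : ∃ m, fuel = m + 1 := ⟨fuel - 1, by simp at hf; omega⟩
      have h0 := le1Aux_append [] (p ++ [v]) (x :: rest) (by simpa using hn)
      rw [List.nil_append, le1Aux, if_pos (by simp [hx])] at h0
      have ht : (p ++ [v]).takeWhile (fun y => y ≠ x) = p.takeWhile (fun y => y ≠ x) := by
        rw [List.takeWhile_append, if_neg]
        intro hlen
        have := (List.takeWhile_prefix (l := p) (fun y => decide (y ≠ x))).eq_of_length hlen
        rw [← this] at hx
        simpa using List.mem_takeWhile_imp hx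
      have hd : (p ++ [v]).dropWhile (fun y => y ≠ x) ++ [x] =
          p.dropWhile (fun y => y ≠ x) ++ [v, x] := by
        have h1 := List.takeWhile_append_dropWhile (p := fun y => decide (y ≠ x)) (l := p ++ [v])
        have h2 := List.takeWhile_append_dropWhile (p := fun y => decide (y ≠ x)) (l := p)
        rw [ht] at h1
        have h3 : p.takeWhile (fun y => y ≠ x) ++ (p ++ [v]).dropWhile (fun y => y ≠ x) =
          p.takeWhile (fun y => y ≠ x) ++ (p.dropWhile (fun y => y ≠ x) ++ [v]) := by
          rw [h1, ← List.append_assoc, h2]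
        rw [List.append_cancel_left h3]; simp
      rw [leAux, hl, h0]
      simp only [Multiset.map_cons, Multiset.prod_cons]
      have hcx : (p ++ [v, x]).IsChain Adj := hc.prefix ⟨rest, by simp⟩
      rw [if_pos hx, stepL, if_pos hx, lw, hd,
        if_pos (isSAPList_dropWhile hx hcx hn), ht]
      congr 1
      refine ih _ _ _ (by simpa using hf) ?_ ?_
      · rw [List.isChain_split]
        refine ⟨?_, hc.suffix ⟨p ++ [v], by simp⟩⟩
        refine hc.prefix ?_
        have h2 := List.takeWhile_append_dropWhile (p := fun y => decide (y ≠ x)) (l := p)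
        obtain ⟨t, hat⟩ := dropWhile_ne_eq_cons hx
        rw [hat] at h2
        exact ⟨t ++ v :: x :: rest, by conv_rhs => rw [← h2]
                                       simp⟩
      · rw [List.nodup_append]
        refine ⟨(List.nodup_append.1 hn).1.sublist (List.takeWhile_sublist _), by simp, ?_⟩
        intro a ha b hb hab
        have := List.mem_takeWhile_imp ha
        simp at this hb
        exact this (hab.trans hb)
    · rw [if_neg hx, stepL, if_neg hx, one_mul, hl]
      refine ih _ _ _ (by simp at hf; omega) (by simpa using hc) ?_
      rw [List.nodup_append]
      refine ⟨hn, by simp, ?_⟩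
      intro a ha b hb hab
      simp at hb ha
      subst hb hab
      rcases ha with h | h
      · exact hx h
      · exact hvx h.symm

theorem wt0_eq (lam : List (Pt d) → ℝ≥0) (ω : Walk d) (v : Pt d) (rest : List (Pt d))
    (h : ω.pts = v :: rest) : wt0 lam ω = runW lam [] v rest := by
  rw [wt0, erasedLoops, h]
  have hc := ω.chain
  rw [h] at hc
  exact leAux_prod lam rest [] v _ (by simp) (show ([] ++ v :: rest).IsChain Adj from hc) (by simp)

theorem tsum_list {α : Type*} (f : List α → ℝ≥0∞) :
    ∑' l, f l = f [] + ∑' x, ∑' l, f (x :: l) := by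
  let e : Option (α × List α) ≃ List α :=
    { toFun := fun o => o.elim [] fun q => q.1 :: q.2
      invFun := fun l => match l with
        | [] => none
        | x :: l => some (x, l)
      left_inv := fun o => by cases o <;> rfl
      right_inv := fun l => by cases l <;> rfl }
  rw [← e.tsum_eq, ENNReal.tsum_eq_add_tsum_ite none, ← ENNReal.tsum_prod]
  congr 1
  rw [← (Option.some_injective (α × List α)).tsum_eq]
  · exact tsum_congr fun q => by simp [e]
  · intro o ho
    cases o with
    | none => simp at ho
    | some q => exact ⟨q, rfl⟩

theorem tsum_runW (lam : List (Pt d) → ℝ≥0) (f : Pt d → ℝ≥0∞) (n : ℕ) :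
    ∀ (p : List (Pt d)) (v : Pt d),
      (∑' rest : List (Pt d), if rest.length = n ∧ (v :: rest).IsChain Adj then
        f (rest.getLastD v) * runW lam p v rest else 0) =
      ∑' y, f y * coeff n (CS (lw lam) p v ∅ y) := by
  induction n with
  | zero =>
    intro p v
    rw [tsum_list]
    simp [runW, coeff_zero_CS]
  | succ n ih =>
    intro p v
    rw [tsum_list]
    simp only [coeff_succ_CS, ← ENNReal.tsum_mul_left]
    conv_rhs => rw [ENNReal.tsum_comm]
    simp only [List.length_nil, List.length_cons, Nat.add_right_cancel_iff]
    rw [if_neg (by simp), zero_add]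
    refine tsum_congr fun x => ?_
    by_cases hx : Adj v x
    · simp only [hx, List.isChain_cons_cons, true_and, Finset.notMem_empty, not_false_eq_true,
        and_self, if_true, runW]
      simp only [mul_left_comm (f _)]
      rw [ENNReal.tsum_mul_left (α := Pt d), ← ih, ← ENNReal.tsum_mul_left]
      refine tsum_congr fun l => ?_
      simp only [List.getLastD_cons, mul_ite, mul_zero]
    · simp [hx]

theorem tsum_walk (lam : List (Pt d) → ℝ≥0) (f : Pt d → ℝ≥0∞) (n : ℕ) :
    (∑' ω : Walk d, if ω.start = 0 ∧ ω.len = n then f ω.finish * wt0 lam ω else 0) =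
      ∑' y, f y * coeff n (GS (lw lam) ∅ 0 y) := by
  have hG : ∀ y, GS (lw lam) ∅ (0 : Pt d) y = CS (lw lam) [] 0 ∅ y := fun y => by simp [GS]
  simp only [hG]
  rw [← tsum_runW]
  let F : List (Pt d) → ℝ≥0∞ := fun rest => if rest.length = n ∧ ((0 : Pt d) :: rest).IsChain Adj
    then f (rest.getLastD 0) * runW lam [] 0 rest else 0
  let E : {rest : List (Pt d) // ((0 : Pt d) :: rest).IsChain Adj} → Walk d :=
    fun r => ⟨0 :: r.1, by simp, r.2⟩
  have hE : Function.Injective E := fun a b h => by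
    have := congrArg Walk.pts h
    simp [E] at this
    exact Subtype.ext this
  rw [← hE.tsum_eq, ← (Subtype.val_injective (p := fun rest : List (Pt d) =>
    ((0 : Pt d) :: rest).IsChain Adj)).tsum_eq]
  · refine tsum_congr fun r => ?_
    rw [wt0_eq lam (E r) 0 r.1 rfl]
    simp only [E, Walk.start, Walk.len, Walk.finish, List.headI, List.length_cons, r.2, and_true,
      true_and, Nat.add_sub_cancel, List.getLastD_cons]
  · intro l hl
    by_cases h : ((0 : Pt d) :: l).IsChain Adj
    · exact ⟨⟨l, h⟩, rfl⟩
    · simp [h] at hl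
  · rintro ⟨pts, ne, chain⟩ hω
    obtain ⟨a, t, rfl⟩ := List.exists_cons_of_ne_nil ne
    by_cases h : a = 0
    · subst h
      exact ⟨⟨t, chain⟩, rfl⟩
    · simp [Walk.start, h] at hω

end Bridge

end

section

open Ser PowerSeries

namespace Ser

/-- The number operator `X d/dX`. -/
def Nd (f : Ser) : Ser := mk fun n => n * coeff n f

@[simp] theorem coeff_Nd (f : Ser) (n : ℕ) : coeff n (Nd f) = n * coeff n f := by simp [Nd]

theorem Nd_eq (f : Ser) : Nd f = X * derivative ℝ≥0∞ f := by
  ext n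
  cases n with
  | zero => simp
  | succ n => rw [coeff_succ_X_mul, coeff_derivative, coeff_Nd]; push_cast; ring

theorem Nd_mul (f g : Ser) : Nd (f * g) = Nd f * g + f * Nd g := by
  simp only [Nd_eq, Derivation.leibniz, smul_eq_mul]; ring

theorem Nd_add (f g : Ser) : Nd (f + g) = Nd f + Nd g := by
  ext n; simp [mul_add]

theorem Nd_psum {ι : Type*} (f : ι → Ser) : Nd (psum f) = psum fun u => Nd (f u) := by
  ext n; simp [ENNReal.tsum_mul_left]

theorem Nd_mono {f g : Ser} (h : f ≤ g) : Nd f ≤ Nd g := fun n => by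
  simpa using mul_le_mul_right (h n) _

theorem Nd_C (a : ℝ≥0∞) : Nd (C a) = 0 := by
  ext n; simp only [coeff_Nd, coeff_C]; split_ifs with h <;> simp [h]

theorem Nd_X : Nd X = X := by
  ext n; simp only [coeff_Nd, coeff_X]; split_ifs with h <;> simp [h]

theorem Nd_one : Nd 1 = 0 := by rw [← map_one (C (R := ℝ≥0∞))]; exact Nd_C 1

theorem Nd_zero : Nd 0 = 0 := by ext n; simp

theorem kmul_comm_of_translation {d : ℕ} {A B : Pt d → Pt d → Ser}
    (hA : ∀ a x y, A (a + x) (a + y) = A x y) (hB : ∀ a x y, B (a + x) (a + y) = B x y) :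
    kmul A B = kmul B A := by
  funext x y
  rw [kmul, kmul, ← psum_equiv ((Equiv.neg (Pt d)).trans (Equiv.addLeft (x + y)))]
  congr 1
  funext u
  have h1 : x + y + -u = (x - u) + y := by abel
  have h2 : A x (x - u + y) = A u y := by
    rw [← hA (x - u) u y]; congr 1; abel
  have h3 : B (x - u + y) y = B x u := by
    rw [← hB (y - u) x u]
    congr 1 <;> abel
  simp only [Equiv.trans_apply, Equiv.neg_apply, Equiv.coe_addLeft, h1, h2, h3]
  ring

theorem kmul_translation {d : ℕ} {A B : Pt d → Pt d → Ser}
    (hA : ∀ a x y, A (a + x) (a + y) = A x y) (hB : ∀ a x y, B (a + x) (a + y) = B x y)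
    (a x y : Pt d) : kmul A B (a + x) (a + y) = kmul A B x y := by
  rw [kmul, ← psum_equiv (Equiv.addLeft a)]
  simp [hA, hB, kmul]

end Ser

section Bounds

variable {d : ℕ} (w : List (Pt d) → ℝ≥0∞)

/-- The bubble kernel `(JG)(y,u) (GJ)(u,y)`. -/
def kap (y u : Pt d) : Ser := kmul J (GS w ∅) y u * kmul (GS w ∅) J u y

theorem coeff_zero_kmul_J (A : Pt d → Pt d → Ser) (x y : Pt d) : coeff 0 (kmul J A x y) = 0 := by
  simp only [kmul, coeff_psum, coeff_zero_mul (coeff_zero_J _ _), tsum_zero]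

theorem coeff_zero_kap (y u : Pt d) : coeff 0 (kap w y u) = 0 :=
  coeff_zero_mul (coeff_zero_kmul_J _ _ _) _

variable (M : ℝ≥0∞)

theorem exists_ks : ∃ F : Pt d × Pt d → Ser, (fun i : Pt d × Pt d =>
    (if i.1 = i.2 then gS w ∅ 0 else 0) + psum fun u =>
      kap w i.1 u * (gS w ∅ 0 ^ 2 * C M * F (u, i.2))) = F := by
  refine exists_fixed (fun F (i : Pt d × Pt d) => (if i.1 = i.2 then gS w ∅ 0 else 0) + psum fun u =>
      kap w i.1 u * (gS w ∅ 0 ^ 2 * C M * F (u, i.2))) fun n F H h i => ?_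
  refine LeN.add LeN.rfl (LeN.psum fun x => LeN.mul_succ ?_ le_rfl (coeff_zero_kap _ _ _))
  exact LeN.mul LeN.rfl (h _)

/-- The kernel controlling the effect of adding an obstacle. -/
def ks (y s : Pt d) : Ser := (exists_ks w M).choose (y, s)

theorem ks_eq (y s : Pt d) : ks w M y s = (if y = s then gS w ∅ 0 else 0) + psum fun u =>
    kap w y u * (gS w ∅ 0 ^ 2 * C M * ks w M u s) :=
  (congrFun (exists_ks w M).choose_spec (y, s)).symm

variable {w M}

theorem gS_le (htr : ∀ a x y, GS w ∅ (a + x) (a + y) = GS w ∅ x y) (S : Finset (Pt d)) (x : Pt d) :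
    gS w S x ≤ gS w ∅ 0 := by
  refine (gS_anti w (Finset.empty_subset S) x).trans (le_of_eq ?_)
  rw [gS, gS, ← htr x 0 0, add_zero]

theorem gS_self_le_ks (y : Pt d) : gS w ∅ 0 ≤ ks w M y y := by
  rw [ks_eq, if_pos rfl]; exact le_self_add

theorem GS_eq_kmul {S : Finset (Pt d)} {x : Pt d} (hx : x ∉ S) (f : Pt d → Ser) :
    (psum fun u => GS w S x u * f u) =
      gS w S x * (f x + psum fun u => kmul J (GS w (insert x S)) x u * f u) := by
  simp only [GS_eq w hx, US, mul_assoc, ← mul_psum, add_mul, psum_add]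
  congr 2
  rw [psum_single _ x]
  · simp
  · intro j hj; simp [hj.symm]

theorem geom_sub_le {n : ℕ} {g g' r r' ρ : Ser} (hg : g = 1 + r * g) (hg' : g' = 1 + r' * g')
    (hfin : FinC (r' * g * g')) (h : LeN n r (r' + ρ)) : LeN n g (g' + ρ * g * g') := by
  refine LeN.cancel hfin ?_
  have e1 : r' * g * g' + g = g' + r * (g * g') := by
    have h1 : g * g' = g' + r * (g * g') := by
      calc g * g' = (1 + r * g) * g' := by rw [← hg]
        _ = _ := by ring
    have h2 : g * g' = r' * g * g' + g := by
      calc g * g' = g * (1 + r' * g') := by rw [← hg']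
        _ = _ := by ring
    rw [← h2, ← h1]
  rw [e1]
  refine (LeN.add LeN.rfl (LeN.mul h LeN.rfl)).trans (LeN.of_eq ?_)
  ring

variable (hw : ∀ l, w l ≤ M) (hM : M ≠ ⊤)
  (htr : ∀ a x y, GS w ∅ (a + x) (a + y) = GS w ∅ x y)

include hw hM

theorem finC_kmul_JGJ (S : Finset (Pt d)) (v : Pt d) : FinC (kmul J (kmul (GS w S) J) v v) := by
  intro n
  have hpt : ∀ x x', FinC (J v x * (GS w S x x' * J x' v)) := fun x x' =>
    have hJ : ∀ a b : Pt d, FinC (J a b) := fun a b m => by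
      unfold J; split_ifs
      · rw [coeff_X]; split_ifs <;> simp
      · simp
    (hJ v x).mul ((finC_GS hw hM S x x').mul (hJ x' v))
  have hs : ∀ f : Pt d → ℝ≥0∞, (∀ x, f x ≠ ⊤) → (∀ x, ¬ Adj v x → f x = 0) → ∑' x, f x ≠ ⊤ := by
    intro f h1 h2
    have : ∀ x, f x = if Adj v x then f x else 0 := fun x => by
      split_ifs with h
      · rfl
      · exact h2 x h
    rw [tsum_congr this, tsum_adj]
    exact ENNReal.sum_ne_top.2 fun i _ => h1 _
  simp only [kmul, mul_psum, coeff_psum]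
  refine hs _ (fun x => hs _ (fun x' => hpt x x' n) fun x' hx' => ?_) fun x hx => ?_
  · simp [J, adj_comm (x := x'), hx']
  · simp [J, hx]

include htr

theorem obstacle_step (n : ℕ) :
    (∀ (A : Finset (Pt d)) (y s : Pt d), LeN n (gS w A y) (gS w (insert s A) y + ks w M y s)) ∧
    (∀ (B : Finset (Pt d)) (x x' s : Pt d), LeN n (GS w B x x') (GS w (insert s B) x x' +
      psum fun u => GS w B x u * (ks w M u s * GS w ∅ u x'))) := by
  induction n with
  | zero => exact ⟨fun _ _ _ => leN_zero _ _, fun _ _ _ _ => leN_zero _ _⟩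
  | succ n ih =>
    have hk : ∀ (A : Finset (Pt d)) (y s : Pt d),
        LeN (n + 1) (gS w A y) (gS w (insert s A) y + ks w M y s) := by
      intro A y s
      by_cases hy : y ∈ A
      · rw [gS, GS_of_mem w hy]; exact LeN.of_le (Ser.zero_le _)
      by_cases hsA : s ∈ A
      · rw [Finset.insert_eq_of_mem hsA]; exact LeN.of_le le_self_add
      by_cases hs : s = y
      · subst hs
        exact LeN.of_le ((gS_le htr A s).trans ((gS_self_le_ks s).trans le_add_self))
      have hy' : y ∉ insert s A := by simp [hy, Ne.symm hs]
      set ρ : Ser := C M * psum fun u => kap w y u * ks w M u s with hρ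
      have hr : LeN (n + 1) (rS w A y) (rS w (insert s A) y + ρ) := by
        refine LeN.cancel (a := C M * kmul J (kmul (GS w (insert s (insert y A))) J) y y) ?_ ?_
        · refine FinC.mul (fun n => ?_) (finC_kmul_JGJ hw hM _ _)
          rw [coeff_C]; split_ifs <;> simp [hM]
        rw [add_comm _ (rS w A y)]
        refine (LeN.of_le (rS_insert_le hw A hs)).trans ?_
        have h1 : LeN (n + 1) (kmul J (kmul (GS w (insert y A)) J) y y)
            (kmul J (kmul (GS w (insert s (insert y A))) J) y y +
              psum fun u => kap w y u * ks w M u s) := by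
          have h2 : LeN (n + 1) (kmul J (kmul (GS w (insert y A)) J) y y)
              (kmul J (kmul (fun x x' => GS w (insert s (insert y A)) x x' +
              psum fun u => GS w (insert y A) x u * (ks w M u s * GS w ∅ u x')) J) y y) := by
            refine LeN.psum fun x => LeN.mul_succ (LeN.psum fun x' => ?_) le_rfl (coeff_zero_J _ _)
            exact LeN.mul (ih.2 _ _ _ _) LeN.rfl
          refine h2.trans (LeN.of_le ?_)
          simp only [kmul, add_mul, psum_add, mul_add]
          refine add_le_add le_rfl ?_
          simp only [kap, kmul, psum_mul, mul_psum]
          conv_lhs => enter [1, x]; rw [psum_comm]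
          rw [psum_comm]
          refine psum_mono fun u => ?_
          rw [psum_comm]
          refine psum_mono fun x => psum_mono fun x' => ?_
          calc _ ≤ J y x' * (GS w ∅ x' u * (ks w M u s * GS w ∅ u x) * J x y) := by
                gcongr; exact GS_le_GS_empty _ _ _
            _ = _ := by ring
        refine (LeN.add LeN.rfl (LeN.mul LeN.rfl h1)).trans (LeN.of_eq ?_)
        rw [hρ]; ring
      refine (geom_sub_le (gS_rec w hy) (gS_rec w hy') ?_ hr).trans (LeN.of_le ?_)
      · refine FinC.mono (g := gS w A y * gS w (insert s A) y) ?_ ?_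
        · exact (finC_GS hw hM _ _ _).mul (finC_GS hw hM _ _ _)
        · have h2 : rS w (insert s A) y * gS w (insert s A) y ≤ gS w (insert s A) y := by
            conv_rhs => rw [gS_rec w hy']
            exact le_add_self
          calc _ = gS w A y * (rS w (insert s A) y * gS w (insert s A) y) := by ring
            _ ≤ _ := by gcongr
      · refine add_le_add le_rfl ?_
        rw [ks_eq, if_neg (Ne.symm hs), zero_add, hρ]
        have h3 : ∀ u, kap w y u * (gS w ∅ 0 ^ 2 * C M * ks w M u s) =
            gS w ∅ 0 ^ 2 * C M * (kap w y u * ks w M u s) := fun u => by ring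
        simp only [h3, ← mul_psum]
        have h4 := mul_le_mul' (gS_le htr A y) (gS_le htr (insert s A) y)
        calc _ = gS w A y * gS w (insert s A) y * (C M * psum fun u => kap w y u * ks w M u s) := by
              ring
          _ ≤ gS w ∅ 0 * gS w ∅ 0 * (C M * psum fun u => kap w y u * ks w M u s) := by gcongr
          _ = _ := by ring
    refine ⟨hk, fun B x x' s => ?_⟩
    by_cases hx : x ∈ B
    · rw [GS_of_mem w hx]; exact LeN.of_le (Ser.zero_le _)
    by_cases hsB : s ∈ B
    · rw [Finset.insert_eq_of_mem hsB]; exact LeN.of_le le_self_add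
    have hterm := le_psum (fun u => GS w B x u * (ks w M u s * GS w ∅ u x')) x
    have h1g : (1 : Ser) ≤ GS w B x x := one_le_gS w hx
    by_cases hs : s = x
    · subst hs
      refine LeN.of_le (le_add_of_le_right (le_trans ?_ hterm))
      have h1 : (1 : Ser) ≤ ks w M s s := (one_le_gS w (by simp)).trans (gS_self_le_ks s)
      calc GS w B s x' ≤ GS w ∅ s x' := GS_le_GS_empty _ _ _
        _ = 1 * (1 * GS w ∅ s x') := by ring
        _ ≤ _ := by gcongr
    have hx' : x ∉ insert s B := by simp [hx, Ne.symm hs]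
    have hU : LeN (n + 1) (US w B x x') (US w (insert s B) x x' +
        psum fun u => kmul J (GS w (insert x B)) x u * (ks w M u s * GS w ∅ u x')) := by
      rw [US, US, add_assoc]
      refine LeN.add LeN.rfl ?_
      have h2 : LeN (n + 1) (psum fun z => J x z * GS w (insert x B) z x')
          (psum fun z => J x z * (GS w (insert s (insert x B)) z x' + psum fun u =>
            GS w (insert x B) z u * (ks w M u s * GS w ∅ u x'))) :=
        LeN.psum fun z => LeN.mul_succ (ih.2 _ _ _ _) le_rfl (coeff_zero_J _ _)
      refine h2.trans (LeN.of_eq ?_)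
      simp only [mul_add, psum_add, Finset.insert_comm s x]
      congr 1
      simp only [kmul, psum_mul, mul_psum]
      rw [psum_comm]
      simp only [mul_assoc]
    rw [GS_eq_kmul hx, GS_eq w hx]
    refine (LeN.mul LeN.rfl hU).trans ?_
    rw [mul_add, mul_add (gS w B x), ← add_assoc]
    refine LeN.add ?_ LeN.rfl
    refine (LeN.mul (hk B x s) LeN.rfl).trans (LeN.of_le ?_)
    rw [add_mul, ← GS_eq w hx']
    refine add_le_add le_rfl ?_
    calc ks w M x s * US w (insert s B) x x' ≤ ks w M x s * GS w ∅ x x' := by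
          gcongr; exact (US_le_GS w hx' x').trans (GS_le_GS_empty _ _ _)
      _ = 1 * (ks w M x s * GS w ∅ x x') := by ring
      _ ≤ _ := by gcongr; exact h1g

theorem gS_le_insert (A : Finset (Pt d)) (y s : Pt d) :
    gS w A y ≤ gS w (insert s A) y + ks w M y s :=
  le_of_leN fun n => (obstacle_step hw hM htr n).1 A y s

omit hM

theorem number_step (n : ℕ) :
    (∀ (S : Finset (Pt d)) (v : Pt d), LeN n (Nd (gS w S v)) (gS w S v *
      (2 * C M * gS w ∅ 0 * kmul J (kmul (kmul (GS w ∅) (GS w ∅)) J) 0 0 *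
        geom (2 * C M * gS w ∅ 0 * kmul J (kmul (kmul (GS w ∅) (GS w ∅)) J) 0 0)))) ∧
    (∀ (S : Finset (Pt d)) (x y : Pt d), LeN n (GS w S x y + Nd (GS w S x y))
      (geom (2 * C M * gS w ∅ 0 * kmul J (kmul (kmul (GS w ∅) (GS w ∅)) J) 0 0) *
        kmul (GS w S) (GS w ∅) x y)) := by
  set q : Ser := kmul J (kmul (kmul (GS w ∅) (GS w ∅)) J) 0 0 with hq
  set b : Ser := 2 * C M * gS w ∅ 0 * q with hb
  induction n with
  | zero => exact ⟨fun _ _ => leN_zero _ _, fun _ _ _ => leN_zero _ _⟩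
  | succ n ih =>
    have NdJ : ∀ x y : Pt d, Nd (J x y) = J x y := fun x y => by
      unfold J; split_ifs
      · exact Nd_X
      · exact Nd_zero
    have hqv : ∀ v, kmul J (kmul (kmul (GS w ∅) (GS w ∅)) J) v v = q := fun v => by
      have hJ : ∀ a x y : Pt d, J (a + x) (a + y) = J x y := fun a =>
        J_image (R := Equiv.addLeft a) (isLatticeIso_addLeft a)
      rw [hq, ← kmul_translation hJ (kmul_translation (kmul_translation htr htr) hJ) v 0 0,
        add_zero]
    have hg : ∀ (S : Finset (Pt d)) (v : Pt d),
        LeN (n + 1) (Nd (gS w S v)) (gS w S v * (b * geom b)) := by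
      intro S v
      by_cases hv : v ∈ S
      · rw [gS, GS_of_mem w hv, Nd_zero]; exact LeN.of_le (Ser.zero_le _)
      have h1 : Nd (gS w S v) = Nd (rS w S v) * gS w S v * gS w S v := by
        have h2 : Nd (gS w S v) = Nd (rS w S v) * gS w S v + rS w S v * Nd (gS w S v) := by
          conv_lhs => rw [gS_rec w hv]
          rw [Nd_add, Nd_one, zero_add, Nd_mul]
        have h3 := eq_geom (coeff_zero_rS w S v) h2
        rwa [← gS_eq w hv] at h3
      have h4 : LeN (n + 1) (Nd (rS w S v)) (C M * (2 * (geom b * q))) := by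
        refine (LeN.of_le (Nd_mono (rS_le hw S v))).trans ?_
        rw [Nd_mul, Nd_C, zero_mul, zero_add]
        refine LeN.mul LeN.rfl ?_
        have h5 : Nd (kmul J (kmul (GS w (insert v S)) J) v v) ≤ psum fun x => J v x *
            psum fun x' => 2 * (GS w (insert v S) x x' + Nd (GS w (insert v S) x x')) * J x' v := by
          rw [kmul, Nd_psum]
          refine psum_mono fun x => ?_
          rw [Nd_mul, NdJ, ← mul_add]
          refine mul_le_mul' le_rfl ?_
          rw [kmul, Nd_psum, ← psum_add]
          refine psum_mono fun x' => ?_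
          rw [Nd_mul, NdJ]
          calc _ ≤ GS w (insert v S) x x' * J x' v + (Nd (GS w (insert v S) x x') * J x' v +
                GS w (insert v S) x x' * J x' v) + Nd (GS w (insert v S) x x') * J x' v :=
                le_self_add
            _ = _ := by ring
        refine (LeN.of_le h5).trans ?_
        have h6 : LeN (n + 1) (psum fun x => J v x * psum fun x' =>
            2 * (GS w (insert v S) x x' + Nd (GS w (insert v S) x x')) * J x' v)
            (psum fun x => J v x * psum fun x' =>
            2 * (geom b * kmul (GS w (insert v S)) (GS w ∅) x x') * J x' v) :=
          LeN.psum fun x => LeN.mul_succ (LeN.psum fun x' =>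
            LeN.mul (LeN.mul LeN.rfl (ih.2 _ _ _)) LeN.rfl) le_rfl (coeff_zero_J _ _)
        refine h6.trans (LeN.of_le ?_)
        rw [← hqv v]
        conv_rhs => simp only [kmul, mul_psum]
        simp only [kmul, mul_psum, psum_mul]
        refine psum_mono fun x => psum_mono fun x' => psum_mono fun u => ?_
        calc _ ≤ J v x * (2 * (geom b * (GS w ∅ x u * GS w ∅ u x')) * J x' v) := by
              gcongr; exact GS_le_GS_empty _ _ _
          _ = _ := by ring
      rw [h1]
      refine (LeN.mul (LeN.mul h4 (LeN.of_le (gS_le htr S v))) LeN.rfl).trans (LeN.of_eq ?_)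
      rw [hb]; ring
    refine ⟨hg, fun S x y => ?_⟩
    by_cases hx : x ∈ S
    · rw [GS_of_mem w hx, Nd_zero, add_zero]; exact LeN.of_le (Ser.zero_le _)
    have hNU : LeN (n + 1) (Nd (US w S x y))
        (psum fun z => J x z * (geom b * kmul (GS w (insert x S)) (GS w ∅) z y)) := by
      have h0 : Nd (if x = y then (1 : Ser) else 0) = 0 := by
        split_ifs
        · exact Nd_one
        · exact Nd_zero
      rw [US, Nd_add, h0, zero_add, Nd_psum]
      refine LeN.psum fun z => ?_
      rw [Nd_mul, NdJ, ← mul_add]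
      exact LeN.mul_succ (ih.2 _ _ _) le_rfl (coeff_zero_J _ _)
    have hk : kmul (GS w S) (GS w ∅) x y = gS w S x * (GS w ∅ x y +
        psum fun z => J x z * kmul (GS w (insert x S)) (GS w ∅) z y) := by
      rw [kmul, GS_eq_kmul hx]
      congr 2
      simp only [kmul, psum_mul, mul_psum]
      rw [psum_comm]
      simp only [mul_assoc]
    rw [hk, GS_eq w hx, Nd_mul]
    refine (LeN.add LeN.rfl (LeN.add (LeN.mul (hg S x) LeN.rfl) (LeN.mul LeN.rfl hNU))).trans
      (LeN.of_le ?_)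
    have hU : US w S x y ≤ GS w ∅ x y := (US_le_GS w hx y).trans (GS_le_GS_empty _ _ _)
    calc _ = gS w S x * ((1 + b * geom b) * US w S x y +
          psum fun z => J x z * (geom b * kmul (GS w (insert x S)) (GS w ∅) z y)) := by ring
      _ = gS w S x * (geom b * US w S x y +
          geom b * psum fun z => J x z * kmul (GS w (insert x S)) (GS w ∅) z y) := by
          rw [← geom_eq, mul_psum]; simp only [mul_left_comm (geom b)]
      _ ≤ gS w S x * (geom b * GS w ∅ x y +
          geom b * psum fun z => J x z * kmul (GS w (insert x S)) (GS w ∅) z y) := by gcongr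
      _ = _ := by ring

theorem number_GS_le (S : Finset (Pt d)) (x y : Pt d) : GS w S x y + Nd (GS w S x y) ≤
    geom (2 * C M * gS w ∅ 0 * kmul J (kmul (kmul (GS w ∅) (GS w ∅)) J) 0 0) *
      kmul (GS w S) (GS w ∅) x y :=
  le_of_leN fun n => (number_step hw htr n).2 S x y

end Bounds

end

section

open Ser PowerSeries

section Lace

variable {d : ℕ} (w : List (Pt d) → ℝ≥0∞) (M : ℝ≥0∞)

/-- The kernel `JGGG`. -/
def J3 : Pt d → Pt d → Ser := kmul J (kmul (GS w ∅) (kmul (GS w ∅) (GS w ∅)))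

/-- Coefficientwise supremum of the kernel `JGGG`. -/
def hs : Ser := mk fun n => ⨆ x, ⨆ y, coeff n (J3 w x y)

/-- Bound for the column sums of the obstacle kernel. -/
def kk : Ser := gS w ∅ 0 * geom (gS w ∅ 0 ^ 2 * C M * hs w)

/-- Bound for a closed lace. -/
def bt : Ser := hs w * kk w M

/-- Bound for the total mass of the lace expansion coefficients. -/
def ph : Ser := bt w M * geom (bt w M)

theorem J3_le_hs (x y : Pt d) : J3 w x y ≤ hs w := fun n => by
  rw [hs, coeff_mk]
  exact le_iSup₂ (f := fun x y => coeff n (J3 w x y)) x y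

theorem coeff_zero_hs : coeff 0 (hs w) = 0 := by
  simp only [hs, coeff_mk, J3, coeff_zero_kmul_J, ENNReal.iSup_zero]

theorem ph_eq : ph w M = bt w M + bt w M * ph w M := by
  conv_lhs => rw [ph, geom_eq]
  rw [ph]; ring

theorem delta_le_GS (x y : Pt d) : (if x = y then (1 : Ser) else 0) ≤ GS w ∅ x y := by
  split_ifs with h
  · subst h; exact one_le_gS w (by simp)
  · exact Ser.zero_le _

theorem le_kmul_GS (A : Pt d → Pt d → Ser) (x y : Pt d) : A x y ≤ kmul A (GS w ∅) x y := by
  refine le_trans ?_ (le_psum _ y)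
  exact le_mul_of_one_le_right (Ser.zero_le _) (one_le_gS w (by simp))

theorem J_le_GS (x y : Pt d) : J x y ≤ GS w ∅ x y := by
  refine le_trans ?_ (US_le_GS w (by simp) y)
  refine le_trans ?_ le_add_self
  by_cases hxy : x = y
  · subst hxy; rw [J_self]; exact Ser.zero_le _
  refine le_trans ?_ (le_psum _ y)
  exact le_mul_of_one_le_right (Ser.zero_le _) (one_le_gS w (by simp [Ne.symm hxy]))

theorem kmul_JG_le (x y : Pt d) : kmul J (GS w ∅) x y ≤ kmul (kmul J (GS w ∅)) (GS w ∅) x y :=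
  le_kmul_GS w _ x y

theorem kmul_JGG_le_hs (x y : Pt d) : kmul (kmul J (GS w ∅)) (GS w ∅) x y ≤ hs w := by
  refine (le_kmul_GS w _ x y).trans ?_
  rw [kmul_assoc, kmul_assoc]
  exact J3_le_hs w x y

/-- The effect of the obstacles `S` on the series of closed walks. -/
def dS (A S : Finset (Pt d)) (y : Pt d) : Ser := sub (gS w A y) (gS w (A ∪ S) y)

theorem gS_add_dS (A S : Finset (Pt d)) (y : Pt d) :
    gS w (A ∪ S) y + dS w A S y = gS w A y :=
  add_sub_of_le (gS_anti w Finset.subset_union_left y)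

/-- The index set of the lace expansion coefficients. -/
abbrev LIdx (d : ℕ) := Bool × Finset (Pt d) × Finset (Pt d) × Pt d × Pt d

/-- The recursion for the lace expansion coefficients. -/
def laceMap (F : LIdx d → Ser) (i : LIdx d) : Ser :=
  dS w i.2.1 i.2.2.1 i.2.2.2.1 * ((if i.1 = true ∧ i.2.2.2.1 = i.2.2.2.2 then 1 else 0) +
      psum fun y' => J i.2.2.2.1 y' * F (!i.1, ∅, insert i.2.2.2.1 i.2.1, y', i.2.2.2.2)) +
    gS w (i.2.1 ∪ i.2.2.1) i.2.2.2.1 *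
      psum fun y' => J i.2.2.2.1 y' * F (i.1, insert i.2.2.2.1 i.2.1, i.2.2.1, y', i.2.2.2.2)

theorem laceMap_step (n : ℕ) (F H : LIdx d → Ser) (h : ∀ i, LeN n (F i) (H i)) (i : LIdx d) :
    LeN (n + 1) (laceMap w F i) (laceMap w H i) := by
  refine LeN.add (LeN.mul LeN.rfl (LeN.add LeN.rfl ?_)) (LeN.mul LeN.rfl ?_) <;>
  exact LeN.psum fun x => LeN.mul_succ (h _) le_rfl (coeff_zero_J _ _)

/-- The lace expansion coefficients; the Boolean records the parity. -/
def Th (b : Bool) (A S : Finset (Pt d)) (y v : Pt d) : Ser :=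
  (exists_fixed _ (laceMap_step w)).choose (b, A, S, y, v)

theorem Th_eq (b : Bool) (A S : Finset (Pt d)) (y v : Pt d) :
    Th w b A S y v = dS w A S y * ((if b = true ∧ y = v then 1 else 0) +
        psum fun y' => J y y' * Th w (!b) ∅ (insert y A) y' v) +
      gS w (A ∪ S) y * psum fun y' => J y y' * Th w b (insert y A) S y' v :=
  (congrFun (exists_fixed _ (laceMap_step w)).choose_spec (b, A, S, y, v)).symm

theorem Th_of_mem (b : Bool) {A : Finset (Pt d)} (S : Finset (Pt d)) {y : Pt d} (h : y ∈ A)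
    (v : Pt d) : Th w b A S y v = 0 := by
  have h1 : gS w (A ∪ S) y = 0 := GS_of_mem w (Finset.mem_union_left _ h) _
  have h2 : dS w A S y = 0 := by
    refine le_antisymm ((sub_le _ _).trans (le_of_eq ?_)) (Ser.zero_le _)
    exact GS_of_mem w h _
  rw [Th_eq, h1, h2]; simp

/-- The two-point series with the closed walks at the starting point removed at the start. -/
def Ut (v x : Pt d) : Ser := (if v = x then 1 else 0) + kmul J (GS w ∅) v x

/-- One side of the lace expansion identity. -/
def laceSide (b : Bool) (A S : Finset (Pt d)) (y x : Pt d) : Ser :=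
  psum fun v => Th w b A S y v * Ut w v x

theorem laceSide_eq (b : Bool) (A S : Finset (Pt d)) (y x : Pt d) :
    laceSide w b A S y x = dS w A S y * ((if b = true then Ut w y x else 0) +
        psum fun y' => J y y' * laceSide w (!b) ∅ (insert y A) y' x) +
      gS w (A ∪ S) y * psum fun y' => J y y' * laceSide w b (insert y A) S y' x := by
  rw [laceSide]
  simp only [Th_eq w b A S y, add_mul, psum_add]
  congr 1
  · simp only [mul_assoc, ← mul_psum, add_mul, psum_add]
    congr 2
    · rw [psum_single _ y]
      · by_cases hb : b = true <;> simp [hb]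
      · intro j hj; simp [hj.symm]
    · simp only [psum_mul, laceSide, mul_psum]
      rw [psum_comm]
      simp only [mul_assoc]
  · simp only [mul_assoc, ← mul_psum]
    congr 1
    simp only [psum_mul, laceSide, mul_psum]
    rw [psum_comm]
    simp only [mul_assoc]

theorem lace_step (n : ℕ) : ∀ (A S : Finset (Pt d)) (y x : Pt d),
    LeN n (GS w A y x + laceSide w false A S y x) (GS w (A ∪ S) y x + laceSide w true A S y x) ∧
    LeN n (GS w (A ∪ S) y x + laceSide w true A S y x)
      (GS w A y x + laceSide w false A S y x) := by
  induction n with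
  | zero => exact fun _ _ _ _ => ⟨leN_zero _ _, leN_zero _ _⟩
  | succ n ih =>
    intro A S y x
    by_cases hy : y ∈ A
    · have h0 : ∀ b, laceSide w b A S y x = 0 := fun b => by
        simp [laceSide, Th_of_mem w b S hy]
      rw [h0, h0, GS_of_mem w hy, GS_of_mem w (Finset.mem_union_left _ hy)]
      exact ⟨LeN.rfl, LeN.rfl⟩
    set dl : Ser := if y = x then 1 else 0
    have hL : GS w A y x + laceSide w false A S y x =
        dS w A S y * (dl + psum fun y' => J y y' * (GS w (∅ ∪ insert y A) y' x +
            laceSide w true ∅ (insert y A) y' x)) +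
          gS w (A ∪ S) y * (dl + psum fun y' => J y y' * (GS w (insert y A) y' x +
            laceSide w false (insert y A) S y' x)) := by
      rw [laceSide_eq, GS_eq w hy, ← gS_add_dS w A S y, US]
      simp only [mul_add, psum_add, Finset.empty_union]
      simp only [Bool.false_eq_true, if_false, Bool.not_false]
      ring
    have hR : GS w (A ∪ S) y x + laceSide w true A S y x =
        dS w A S y * (dl + psum fun y' => J y y' * (GS w ∅ y' x +
            laceSide w false ∅ (insert y A) y' x)) +
          gS w (A ∪ S) y * (dl + psum fun y' => J y y' * (GS w (insert y A ∪ S) y' x +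
            laceSide w true (insert y A) S y' x)) := by
      have h1 : GS w (A ∪ S) y x = gS w (A ∪ S) y * US w (A ∪ S) y x := by
        by_cases hyS : y ∈ A ∪ S
        · rw [gS, GS_of_mem w hyS, GS_of_mem w hyS, zero_mul]
        · exact GS_eq w hyS x
      rw [laceSide_eq, h1, US, Ut, kmul]
      simp only [mul_add, psum_add, Finset.insert_union]
      simp only [if_true, Bool.not_true]
      ring
    rw [hL, hR]
    constructor <;>
    refine LeN.add (LeN.mul LeN.rfl (LeN.add LeN.rfl (LeN.psum fun y' => LeN.mul_succ ?_ le_rfl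
        (coeff_zero_J _ _)))) (LeN.mul LeN.rfl (LeN.add LeN.rfl (LeN.psum fun y' =>
        LeN.mul_succ ?_ le_rfl (coeff_zero_J _ _))))
    · exact (ih _ _ _ _).2
    · exact (ih _ _ _ _).1
    · exact (ih _ _ _ _).1
    · exact (ih _ _ _ _).2

theorem lace_identity (A S : Finset (Pt d)) (y x : Pt d) :
    GS w A y x + laceSide w false A S y x = GS w (A ∪ S) y x + laceSide w true A S y x :=
  le_antisymm (le_of_leN fun n => (lace_step w n A S y x).1)
    (le_of_leN fun n => (lace_step w n A S y x).2)

/-- The positive and negative parts of the lace expansion coefficients. -/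
def Pl (b : Bool) (v : Pt d) : Ser :=
  gS w ∅ 0 * psum fun y => J 0 y * Th w b ∅ {0} y v

/-- The lace expansion in convolution form. -/
theorem lace_convolution (x : Pt d) :
    GS w ∅ 0 x + psum (fun v => Pl w true v * Ut w v x) =
      gS w ∅ 0 * Ut w 0 x + psum fun v => Pl w false v * Ut w v x := by
  have h : ∀ b, psum (fun v => Pl w b v * Ut w v x) =
      gS w ∅ 0 * psum fun y => J 0 y * laceSide w b ∅ {0} y x := fun b => by
    simp only [Pl, mul_assoc, ← mul_psum, psum_mul, laceSide]
    rw [psum_comm]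
    simp only [mul_psum]
  rw [h, h, GS_eq w (by simp), US, Ut, kmul]
  simp only [← mul_add, add_assoc, ← psum_add]
  congr 3
  funext y
  rw [lace_identity w ∅ {0} y x]
  rfl

variable {w M} (hw : ∀ l, w l ≤ M) (hM : M ≠ ⊤)
  (htr : ∀ a x y, GS w ∅ (a + x) (a + y) = GS w ∅ x y)

include htr

theorem psum_kap_le (u : Pt d) : (psum fun y => kap w y u) ≤ hs w := by
  have hJ : ∀ a x y : Pt d, J (a + x) (a + y) = J x y := fun a =>
    J_image (R := Equiv.addLeft a) (isLatticeIso_addLeft a)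
  calc (psum fun y => kap w y u) = kmul (kmul (GS w ∅) J) (kmul J (GS w ∅)) u u := by
        simp only [kap]
        rw [kmul]
        simp only [mul_comm]
    _ ≤ kmul (kmul (GS w ∅) J) (kmul (GS w ∅) (GS w ∅)) u u :=
        kmul_mono (fun _ _ => le_rfl) (kmul_mono (J_le_GS w) fun _ _ => le_rfl) u u
    _ = J3 w u u := by
        rw [kmul_comm_of_translation htr hJ, kmul_assoc, J3]
    _ ≤ _ := J3_le_hs w u u

theorem psum_ks_le (s : Pt d) : (psum fun y => ks w M y s) ≤ kk w M := by
  refine le_geom ?_ ?_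
  · rw [mul_comm]; exact coeff_zero_mul (coeff_zero_hs w) _
  conv_lhs => enter [1, y]; rw [ks_eq]
  rw [psum_add]
  refine add_le_add (le_of_eq ?_) ?_
  · rw [psum_single _ s]
    · simp
    · intro j hj; simp [hj]
  · rw [psum_comm]
    simp only [← psum_mul]
    rw [mul_psum]
    refine psum_mono fun u => ?_
    calc _ ≤ hs w * (gS w ∅ 0 ^ 2 * C M * ks w M u s) := by gcongr; exact psum_kap_le htr u
      _ = _ := by ring

theorem kmul_JG_ks_le (x s : Pt d) : kmul (kmul J (GS w ∅)) (ks w M) x s ≤ bt w M := by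
  calc _ ≤ psum fun u => hs w * ks w M u s :=
        psum_mono fun u => mul_le_mul' ((kmul_JG_le w x u).trans (kmul_JGG_le_hs w x u)) le_rfl
    _ ≤ _ := by rw [← mul_psum, bt]; gcongr; exact psum_ks_le htr s

theorem kmul_JGG_ks_le (x s : Pt d) :
    kmul (kmul (kmul J (GS w ∅)) (GS w ∅)) (ks w M) x s ≤ bt w M := by
  calc _ ≤ psum fun u => hs w * ks w M u s :=
        psum_mono fun u => mul_le_mul' (kmul_JGG_le_hs w x u) le_rfl
    _ ≤ _ := by rw [← mul_psum, bt]; gcongr; exact psum_ks_le htr s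

include hw hM

theorem dS_le (A S : Finset (Pt d)) (y : Pt d) : dS w A S y ≤ ∑ s ∈ S, ks w M y s := by
  rw [dS, sub_le_iff, add_comm]
  induction S using Finset.induction_on with
  | empty => simp
  | insert s S hs ih =>
    rw [Finset.sum_insert hs, Finset.union_insert]
    refine ih.trans ?_
    rw [← add_assoc]
    gcongr
    exact gS_le_insert hw hM htr _ _ _

/-- The total mass of the lace expansion coefficients. -/
theorem psum_Th_le (A S : Finset (Pt d)) (y : Pt d) :
    (psum fun v => Th w true A S y v + Th w false A S y v) ≤
      ∑ s ∈ S, ((1 + A.card * ph w M) * kmul (GS w A) (ks w M) y s +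
        ph w M * kmul (GS w A) (kmul (GS w ∅) (ks w M)) y s) := by
  refine le_of_step (ι := Finset (Pt d) × Finset (Pt d) × Pt d)
    (f := fun i => psum fun v => Th w true i.1 i.2.1 i.2.2 v + Th w false i.1 i.2.1 i.2.2 v)
    (g := fun i => ∑ s ∈ i.2.1, ((1 + i.1.card * ph w M) * kmul (GS w i.1) (ks w M) i.2.2 s +
        ph w M * kmul (GS w i.1) (kmul (GS w ∅) (ks w M)) i.2.2 s)) (fun n ih => ?_) (A, S, y)
  rintro ⟨A, S, y⟩
  simp only
  by_cases hy : y ∈ A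
  · simp only [Th_of_mem w _ S hy, add_zero, psum_zero]
    exact LeN.of_le (Ser.zero_le _)
  set T : Finset (Pt d) → Finset (Pt d) → Pt d → Ser :=
    fun A S y => psum fun v => Th w true A S y v + Th w false A S y v with hT
  set B : Finset (Pt d) → Finset (Pt d) → Pt d → Ser :=
    fun A S y => ∑ s ∈ S, ((1 + A.card * ph w M) * kmul (GS w A) (ks w M) y s +
        ph w M * kmul (GS w A) (kmul (GS w ∅) (ks w M)) y s) with hB
  have hrec : T A S y = dS w A S y * (1 + psum fun y' => J y y' * T ∅ (insert y A) y') +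
      gS w (A ∪ S) y * psum fun y' => J y y' * T (insert y A) S y' := by
    simp only [hT]
    conv_lhs => enter [1, v]; rw [Th_eq, Th_eq w false]
    simp only [Bool.not_true, Bool.not_false, Bool.false_eq_true, false_and, true_and, if_false,
      zero_add]
    have e : ∀ v, (dS w A S y * ((if y = v then 1 else 0) +
          psum fun y' => J y y' * Th w false ∅ (insert y A) y' v) +
        gS w (A ∪ S) y * psum fun y' => J y y' * Th w true (insert y A) S y' v) +
        (dS w A S y * (psum fun y' => J y y' * Th w true ∅ (insert y A) y' v) +
        gS w (A ∪ S) y * psum fun y' => J y y' * Th w false (insert y A) S y' v) =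
        dS w A S y * ((if y = v then 1 else 0) +
          psum fun y' => J y y' * (Th w true ∅ (insert y A) y' v +
            Th w false ∅ (insert y A) y' v)) +
        gS w (A ∪ S) y * psum fun y' => J y y' * (Th w true (insert y A) S y' v +
            Th w false (insert y A) S y' v) := fun v => by
      simp only [mul_add, psum_add]; ring
    simp only [e]
    have ec : ∀ F : Pt d → Pt d → Ser, (psum fun v => psum fun y' => J y y' * F y' v) =
        psum fun y' => J y y' * psum fun v => F y' v := fun F => by
      rw [psum_comm]; simp only [← mul_psum]
    rw [psum_add, ← mul_psum, ← mul_psum, psum_add, ec, ec]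
    congr 3
    rw [psum_single _ y]
    · simp
    · intro j hj; simp [hj.symm]
  have h1 : LeN (n + 1) (T A S y)
      (dS w A S y * (1 + psum fun y' => J y y' * B ∅ (insert y A) y') +
      gS w (A ∪ S) y * psum fun y' => J y y' * B (insert y A) S y') := by
    rw [hrec]
    refine LeN.add (LeN.mul LeN.rfl (LeN.add LeN.rfl (LeN.psum fun y' => LeN.mul_succ ?_ le_rfl
        (coeff_zero_J _ _)))) (LeN.mul LeN.rfl (LeN.psum fun y' =>
        LeN.mul_succ ?_ le_rfl (coeff_zero_J _ _)))
    · exact ih (_, _, _)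
    · exact ih (_, _, _)
  refine h1.trans (LeN.of_le ?_)
  have hJB : ∀ A' S', (psum fun y' => J y y' * B A' S' y') =
      ∑ s ∈ S', ((1 + A'.card * ph w M) * kmul (kmul J (GS w A')) (ks w M) y s +
        ph w M * kmul (kmul (kmul J (GS w A')) (GS w ∅)) (ks w M) y s) := fun A' S' => by
    simp only [hB, Finset.mul_sum]
    have e : (psum fun y' => ∑ s ∈ S', J y y' * ((1 + A'.card * ph w M) *
        kmul (GS w A') (ks w M) y' s + ph w M * kmul (GS w A') (kmul (GS w ∅) (ks w M)) y' s)) =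
        ∑ s ∈ S', psum fun y' => J y y' * ((1 + A'.card * ph w M) *
        kmul (GS w A') (ks w M) y' s + ph w M * kmul (GS w A') (kmul (GS w ∅) (ks w M)) y' s) := by
      ext n
      simp only [coeff_psum, map_sum]
      exact Summable.tsum_finsetSum fun _ _ => ENNReal.summable
    rw [e]
    refine Finset.sum_congr rfl fun s _ => ?_
    rw [kmul_assoc, kmul_assoc, kmul_assoc]
    simp only [mul_add, psum_add, mul_left_comm (J y _), ← mul_psum]
    rfl
  have h2 : (psum fun y' => J y y' * B ∅ (insert y A) y') ≤ (A.card + 1) * ph w M := by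
    rw [hJB]
    calc _ ≤ ∑ s ∈ insert y A, (bt w M + ph w M * bt w M) := by
          refine Finset.sum_le_sum fun s _ => ?_
          simp only [Finset.card_empty, Nat.cast_zero, zero_mul, add_zero, one_mul]
          gcongr
          · exact kmul_JG_ks_le htr y s
          · exact kmul_JGG_ks_le htr y s
      _ = _ := by
          rw [mul_comm (ph w M), ← ph_eq, Finset.sum_const, Finset.card_insert_of_notMem hy]
          simp
  refine (add_le_add (mul_le_mul' (dS_le hw hM htr A S y) (add_le_add le_rfl h2))
    (mul_le_mul' (gS_anti w Finset.subset_union_left y) (hJB _ _).le)).trans ?_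
  rw [Finset.sum_mul, Finset.mul_sum, ← Finset.sum_add_distrib]
  refine Finset.sum_le_sum fun s _ => ?_
  rw [Finset.card_insert_of_notMem hy]
  have e1 : kmul (GS w A) (ks w M) y s = gS w A y * (ks w M y s +
      kmul (kmul J (GS w (insert y A))) (ks w M) y s) := by
    rw [kmul, GS_eq_kmul hy]; rfl
  have e2 : kmul (GS w A) (kmul (GS w ∅) (ks w M)) y s = gS w A y * (kmul (GS w ∅) (ks w M) y s +
      kmul (kmul (kmul J (GS w (insert y A))) (GS w ∅)) (ks w M) y s) := by
    rw [kmul, GS_eq_kmul hy, kmul_assoc (kmul J _)]; rfl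
  have e3 : ks w M y s + kmul (kmul J (GS w (insert y A))) (ks w M) y s ≤
      kmul (GS w ∅) (ks w M) y s := by
    rw [kmul, kmul, GS_eq_kmul (S := ∅) (by simp)]
    refine le_trans (add_le_add le_rfl (psum_mono fun u => mul_le_mul' ?_ le_rfl))
      (le_mul_of_one_le_left (Ser.zero_le _) (one_le_gS w (by simp)))
    exact kmul_mono (fun _ _ => le_rfl) (fun a b => GS_anti w
      (Finset.insert_subset_insert y (Finset.empty_subset A)) a b) y u
  rw [e1, e2]
  set K := kmul (kmul J (GS w (insert y A))) (ks w M) y s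
  set K' := kmul (kmul (kmul J (GS w (insert y A))) (GS w ∅)) (ks w M) y s
  set κ := ks w M y s
  set g := gS w A y
  set f := ph w M
  have hg : 1 ≤ g := one_le_gS w hy
  push_cast
  calc κ * (1 + (A.card + 1) * f) + g * ((1 + (A.card + 1) * f) * K + f * K') ≤
      g * κ * (1 + (A.card + 1) * f) + g * ((1 + (A.card + 1) * f) * K + f * K') := by
        gcongr; exact le_mul_of_one_le_left (Ser.zero_le _) hg
    _ = (1 + A.card * f) * (g * (κ + K)) + f * (g * ((κ + K) + K')) := by ring
    _ ≤ _ := by gcongr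

theorem psum_Pl_le : (psum fun v => Pl w true v + Pl w false v) ≤ gS w ∅ 0 * ph w M := by
  simp only [Pl, ← mul_add, ← mul_psum, ← psum_add]
  gcongr
  rw [psum_comm]
  simp only [← mul_psum]
  calc _ ≤ psum fun y => J 0 y * (kmul (GS w ∅) (ks w M) y 0 +
        ph w M * kmul (GS w ∅) (kmul (GS w ∅) (ks w M)) y 0) := by
        refine psum_mono fun y => mul_le_mul' le_rfl ?_
        simpa using psum_Th_le hw hM htr ∅ {0} y
    _ = kmul (kmul J (GS w ∅)) (ks w M) 0 0 +
        ph w M * kmul (kmul (kmul J (GS w ∅)) (GS w ∅)) (ks w M) 0 0 := by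
        rw [kmul_assoc, kmul_assoc, kmul_assoc]
        simp only [mul_add, psum_add, mul_left_comm (J 0 _), ← mul_psum]
        rfl
    _ ≤ bt w M + ph w M * bt w M := by
        gcongr
        · exact kmul_JG_ks_le htr 0 0
        · exact kmul_JGG_ks_le htr 0 0
    _ = _ := by rw [mul_comm (ph w M), ← ph_eq]

end Lace

end

section

open Ser PowerSeries

section Symmetry

variable {d : ℕ} {w : List (Pt d) → ℝ≥0∞}

section Iso

variable {R : Pt d ≃ Pt d} (hR : IsLatticeIso R) (hw : ∀ l, w (l.map R) = w l)
include hR hw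

theorem gS_image (S : Finset (Pt d)) (x : Pt d) : gS w (S.image R) (R x) = gS w S x :=
  GS_image hR hw S x x

theorem dS_image (A S : Finset (Pt d)) (x : Pt d) :
    dS w (A.image R) (S.image R) (R x) = dS w A S x := by
  rw [dS, dS, ← Finset.image_union, gS_image hR hw, gS_image hR hw]

theorem Th_image (b : Bool) (A S : Finset (Pt d)) (y v : Pt d) :
    Th w b (A.image R) (S.image R) (R y) (R v) = Th w b A S y v := by
  have key := fixed_unique (Φ := laceMap w)
    (f := fun i : LIdx d => Th w i.1 (i.2.1.image R) (i.2.2.1.image R) (R i.2.2.2.1) (R i.2.2.2.2))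
    (g := fun i : LIdx d => Th w i.1 i.2.1 i.2.2.1 i.2.2.2.1 i.2.2.2.2) (laceMap_step w) ?_ ?_
  · exact congrFun key (b, A, S, y, v)
  · funext ⟨b, A, S, y, v⟩
    have pe : ∀ b' A' S', (psum fun y' => J (R y) y' * Th w b' A' S' y' (R v)) =
        psum fun y' => J (R y) (R y') * Th w b' A' S' (R y') (R v) := fun b' A' S' =>
      (psum_equiv R fun y' => J (R y) y' * Th w b' A' S' y' (R v)).symm
    conv_rhs => rw [Th_eq, dS_image hR hw, ← Finset.image_union, gS_image hR hw, pe, pe]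
    simp only [J_image hR, R.injective.eq_iff, laceMap, Finset.image_insert, Finset.image_empty]
  · funext ⟨b, A, S, y, v⟩
    exact (Th_eq w b A S y v).symm

theorem Pl_image (h0 : R 0 = 0) (b : Bool) (v : Pt d) : Pl w b (R v) = Pl w b v := by
  rw [Pl, Pl, ← psum_equiv R]
  congr 2
  funext y
  conv_lhs => rw [← h0]
  rw [J_image hR, ← Th_image hR hw b ∅ {0} y v, Finset.image_empty, Finset.image_singleton, h0]

end Iso

theorem leN_Th (n : ℕ) : ∀ (b : Bool) (A S : Finset (Pt d)) (y v : Pt d),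
    LeN (min n (dist1 y v)) (Th w b A S y v) 0 := by
  induction n with
  | zero => intro b A S y v; rw [Nat.zero_min]; exact leN_zero _ _
  | succ n ih =>
    intro b A S y v
    by_cases hyv : y = v
    · subst hyv; rw [dist1_self, Nat.min_zero]; exact leN_zero _ _
    have h : ∀ b' A' S', LeN (min (n + 1) (dist1 y v))
        (psum fun y' => J y y' * Th w b' A' S' y' v) (psum fun y' => J y y' * 0) :=
      fun b' A' S' => LeN.psum fun y' => by
        by_cases ha : Adj y y'
        · refine (LeN.mul_succ (ih b' A' S' y' v) le_rfl (coeff_zero_J _ _)).mono ?_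
          have := dist1_triangle y y' v
          have h1 : dist1 y y' = 1 := ha
          omega
        · rw [J, if_neg ha, zero_mul, zero_mul]
    have hz : (psum fun y' => J y y' * 0) = 0 := by simp only [mul_zero, psum_zero]
    rw [Th_eq, if_neg (fun h => hyv h.2), zero_add]
    refine (LeN.add (LeN.mul LeN.rfl (h _ _ _)) (LeN.mul LeN.rfl (h _ _ _))).trans ?_
    rw [hz, mul_zero, mul_zero, add_zero]

theorem coeff_Pl_of_lt (b : Bool) (v : Pt d) {m : ℕ} (h : m < dist1 0 v) :
    coeff m (Pl w b v) = 0 := by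
  have h1 : LeN (dist1 0 v) (Pl w b v) 0 := by
    have : LeN (dist1 0 v) (psum fun y => J 0 y * Th w b ∅ {0} y v) (psum fun y => J 0 y * 0) :=
      LeN.psum fun y => by
        by_cases ha : Adj 0 y
        · refine (LeN.mul_succ (leN_Th (dist1 y v) b ∅ {0} y v) le_rfl
            (coeff_zero_J _ _)).mono ?_
          have := dist1_triangle 0 y v
          have h1 : dist1 0 y = 1 := ha
          omega
        · rw [J, if_neg ha, zero_mul, zero_mul]
    refine (LeN.mul (LeN.rfl (f := gS w ∅ 0)) this).trans (LeN.of_eq ?_)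
    simp only [mul_zero, psum_zero]
  simpa using h1 m h

variable {lam : List (Pt d) → ℝ≥0} (hs : SymmAssumption lam)
include hs

theorem GS_lw_translation (a x y : Pt d) :
    GS (lw lam) ∅ (a + x) (a + y) = GS (lw lam) ∅ x y := by
  simpa using GS_image (isLatticeIso_addLeft a) (lw_map hs (isLatticeIso_addLeft a)) ∅ x y

theorem GS_lw_neg (x y : Pt d) : GS (lw lam) ∅ (-x) (-y) = GS (lw lam) ∅ x y := by
  simpa using GS_image isLatticeIso_neg (lw_map hs isLatticeIso_neg) ∅ x y

theorem Pl_lw_perm (σ : Equiv.Perm (Fin d)) (b : Bool) (v : Pt d) :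
    Pl (lw lam) b (v ∘ σ.symm) = Pl (lw lam) b v :=
  Pl_image (isLatticeIso_perm σ) (lw_map hs (isLatticeIso_perm σ)) (by ext; simp) b v

end Symmetry

end

namespace Ser

open PowerSeries

/-- The series with the `n`-th coefficient multiplied by `(n+1)^j`. -/
def Wd (j : ℕ) (f : Ser) : Ser := mk fun n => ((n + 1 : ℕ) : ℝ≥0∞) ^ j * coeff n f

@[simp] theorem coeff_Wd (j n : ℕ) (f : Ser) :
    coeff n (Wd j f) = ((n + 1 : ℕ) : ℝ≥0∞) ^ j * coeff n f := by simp [Wd]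

@[simp] theorem Wd_zero_left (f : Ser) : Wd 0 f = f := by ext n; simp

theorem Wd_succ (j : ℕ) (f : Ser) : Wd (j + 1) f = Wd j (f + Nd f) := by
  ext n; simp only [coeff_Wd, map_add, coeff_Nd]; push_cast; ring

theorem Wd_mono (j : ℕ) {f g : Ser} (h : f ≤ g) : Wd j f ≤ Wd j g := fun n => by
  simp only [coeff_Wd]; gcongr; exact h n

theorem le_Wd (j : ℕ) (f : Ser) : f ≤ Wd j f := fun n => by
  rw [coeff_Wd]
  refine le_mul_of_one_le_left bot_le (one_le_pow₀ ?_)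
  simp

theorem Wd_le_Wd {i j : ℕ} (h : i ≤ j) (f : Ser) : Wd i f ≤ Wd j f := fun n => by
  simp only [coeff_Wd]
  gcongr
  simp

theorem Wd_add (j : ℕ) (f g : Ser) : Wd j (f + g) = Wd j f + Wd j g := by
  ext n; simp [mul_add]

theorem Wd_psum {ι : Type*} (j : ℕ) (f : ι → Ser) : Wd j (psum f) = psum fun u => Wd j (f u) := by
  ext n; simp [ENNReal.tsum_mul_left]

theorem Wd_C (j : ℕ) (a : ℝ≥0∞) : Wd j (C a) = C a := by
  ext n; simp only [coeff_Wd, coeff_C]; split_ifs with h <;> simp [h]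

@[simp] theorem Wd_zero (j : ℕ) : Wd j 0 = 0 := by ext n; simp

theorem Wd_one (j : ℕ) : Wd j 1 = 1 := by rw [← map_one (C (R := ℝ≥0∞))]; exact Wd_C j 1

theorem Wd_X (j : ℕ) : Wd j X = C (2 ^ j) * X := by
  ext n
  simp only [coeff_Wd, coeff_X, coeff_C_mul]
  split_ifs with h
  · subst h; norm_num
  · simp

theorem Wd_mul_le (j : ℕ) (f g : Ser) : Wd j (f * g) ≤ Wd j f * Wd j g := fun n => by
  simp only [coeff_Wd, coeff_mul, Finset.mul_sum]
  refine Finset.sum_le_sum fun p hp => ?_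
  calc _ ≤ (((p.1 + 1 : ℕ) : ℝ≥0∞) ^ j * ((p.2 + 1 : ℕ) : ℝ≥0∞) ^ j) *
        (coeff p.1 f * coeff p.2 g) := by
        rw [← mul_pow, ← Nat.cast_mul]
        have := Finset.HasAntidiagonal.mem_antidiagonal.1 hp
        gcongr
        nlinarith
    _ = _ := by ring

theorem Wd_pow_le (j n : ℕ) (f : Ser) : Wd j (f ^ n) ≤ Wd j f ^ n := by
  induction n with
  | zero => simp [Wd_one]
  | succ n ih =>
    rw [pow_succ, pow_succ]
    exact (Wd_mul_le _ _ _).trans (mul_le_mul' ih le_rfl)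

theorem Wd_geom_le (j : ℕ) (b : Ser) : Wd j (geom b) ≤ geom (Wd j b) := by
  rw [geom, Wd_psum]
  exact psum_mono fun n => Wd_pow_le j n b

theorem Wd_kmul_le {ι : Type*} (j : ℕ) (A B : ι → ι → Ser) (x y : ι) :
    Wd j (kmul A B x y) ≤ kmul (fun u v => Wd j (A u v)) (fun u v => Wd j (B u v)) x y := by
  rw [kmul, Wd_psum]
  exact psum_mono fun u => Wd_mul_le _ _ _

/-- Evaluation of a series. -/
def ev (z : ℝ≥0∞) : Ser →+* ℝ≥0∞ where
  toFun f := ∑' n, coeff n f * z ^ n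
  map_one' := by
    rw [tsum_eq_single 0 fun n hn => by simp [coeff_one, hn]]; simp
  map_zero' := by simp
  map_add' f g := by simp only [map_add, add_mul]; exact ENNReal.tsum_add
  map_mul' f g := by
    rw [← ENNReal.tsum_mul_right]
    simp_rw [← ENNReal.tsum_mul_left]
    rw [← ENNReal.tsum_prod (f := fun a b => coeff a f * z ^ a * (coeff b g * z ^ b)),
      ← Finset.HasAntidiagonal.sigmaAntidiagonalEquivProd.tsum_eq, ENNReal.tsum_sigma']
    refine tsum_congr fun n => ?_
    rw [tsum_fintype, coeff_mul, Finset.sum_mul, ← Finset.sum_coe_sort]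
    refine Finset.sum_congr rfl fun p _ => ?_
    have hp := Finset.HasAntidiagonal.mem_antidiagonal.1 p.2
    simp only [Finset.HasAntidiagonal.sigmaAntidiagonalEquivProd_apply]
    rw [show z ^ n = z ^ p.1.1 * z ^ p.1.2 by rw [← pow_add, hp]]; ring

theorem ev_apply (z : ℝ≥0∞) (f : Ser) : ev z f = ∑' n, coeff n f * z ^ n := rfl

theorem ev_mono (z : ℝ≥0∞) {f g : Ser} (h : f ≤ g) : ev z f ≤ ev z g :=
  ENNReal.tsum_le_tsum fun n => mul_le_mul_left (h n) _

theorem ev_mono_left {z z' : ℝ≥0∞} (h : z ≤ z') (f : Ser) : ev z f ≤ ev z' f :=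
  ENNReal.tsum_le_tsum fun n => by gcongr

theorem ev_psum {ι : Type*} (z : ℝ≥0∞) (f : ι → Ser) : ev z (psum f) = ∑' u, ev z (f u) := by
  simp only [ev_apply, coeff_psum, ← ENNReal.tsum_mul_right]
  exact ENNReal.tsum_comm

@[simp] theorem ev_C (z a : ℝ≥0∞) : ev z (C a) = a := by
  rw [ev_apply, tsum_eq_single 0 fun n hn => by simp [coeff_C, hn]]; simp

@[simp] theorem ev_X (z : ℝ≥0∞) : ev z X = z := by
  rw [ev_apply, tsum_eq_single 1 fun n hn => by simp [coeff_X, hn]]; simp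

theorem ev_geom (z : ℝ≥0∞) (b : Ser) : ev z (geom b) = (1 - ev z b)⁻¹ := by
  rw [geom, ev_psum]
  simp only [map_pow]
  exact ENNReal.tsum_geometric _

theorem ev_geom_le {z : ℝ≥0∞} {b : Ser} (h : ev z b ≤ 2⁻¹) : ev z (geom b) ≤ 2 := by
  rw [ev_geom]
  rw [ENNReal.inv_le_iff_inv_le, ← ENNReal.one_sub_inv_two]
  exact tsub_le_tsub_left h 1

theorem ev_Wd_mul_le (j : ℕ) (z : ℝ≥0∞) (f g : Ser) :
    ev z (Wd j (f * g)) ≤ ev z (Wd j f) * ev z (Wd j g) :=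
  (ev_mono z (Wd_mul_le j f g)).trans (map_mul _ _ _).le

theorem ev_Wd_geom_le {j : ℕ} {z : ℝ≥0∞} {b : Ser} (h : ev z (Wd j b) ≤ 2⁻¹) :
    ev z (Wd j (geom b)) ≤ 2 :=
  (ev_mono z (Wd_geom_le j b)).trans (ev_geom_le h)

theorem tsum_inv_succ_sq_le : ∑' n : ℕ, (((n + 1 : ℕ) : ℝ≥0∞) ^ 2)⁻¹ ≤ 2 := by
  have key : ∀ N : ℕ, ∑ n ∈ Finset.range (N + 1), (((n + 1 : ℕ) : ℝ) ^ 2)⁻¹ ≤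
      2 - ((N + 1 : ℕ) : ℝ)⁻¹ := fun N => by
    induction N with
    | zero => norm_num
    | succ N ih =>
      rw [Finset.sum_range_succ]
      have : (((N + 1 + 1 : ℕ) : ℝ) ^ 2)⁻¹ ≤ ((N + 1 : ℕ) : ℝ)⁻¹ - ((N + 1 + 1 : ℕ) : ℝ)⁻¹ := by
        push_cast
        rw [inv_sub_inv (by positivity) (by positivity), inv_eq_one_div]
        rw [div_le_div_iff₀ (by positivity) (by positivity)]
        nlinarith [(Nat.cast_nonneg N : (0 : ℝ) ≤ N)]
      linarith
  refine ENNReal.tsum_le_of_sum_range_le fun N => ?_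
  refine (Finset.sum_le_sum_of_subset (Finset.range_subset_range.2 N.le_succ)).trans ?_
  have h : ∀ n : ℕ, (((n + 1 : ℕ) : ℝ≥0∞) ^ 2)⁻¹ = ENNReal.ofReal ((((n + 1 : ℕ) : ℝ) ^ 2)⁻¹) :=
    fun n => by
      rw [ENNReal.ofReal_inv_of_pos (by positivity), ENNReal.ofReal_pow (by positivity),
        ENNReal.ofReal_natCast]
  simp only [h]
  rw [← ENNReal.ofReal_sum_of_nonneg fun _ _ => by positivity]
  refine ENNReal.ofReal_le_of_le_toReal ((key N).trans ?_)
  simp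
  positivity

/-- Moments of a coefficientwise supremum. -/
theorem ev_Wd_iSup_le {ι : Type*} (j : ℕ) (z B : ℝ≥0∞) (f : ι → Ser)
    (h : ∀ i, ev z (Wd (j + 2) (f i)) ≤ B) :
    ev z (Wd j (mk fun n => ⨆ i, coeff n (f i))) ≤ 2 * B := by
  rw [ev_apply]
  calc _ ≤ ∑' n : ℕ, (((n + 1 : ℕ) : ℝ≥0∞) ^ 2)⁻¹ * B := by
        refine ENNReal.tsum_le_tsum fun n => ?_
        have h0 : (((n + 1 : ℕ) : ℝ≥0∞) ^ 2) ≠ 0 := by positivity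
        have h1 : (((n + 1 : ℕ) : ℝ≥0∞) ^ 2) ≠ ⊤ := by finiteness
        rw [coeff_Wd, coeff_mk, ENNReal.mul_iSup, ENNReal.iSup_mul]
        refine iSup_le fun i => ?_
        rw [mul_comm _ B, ← div_eq_mul_inv, ENNReal.le_div_iff_mul_le (Or.inl h0) (Or.inl h1)]
        refine le_trans (le_of_eq ?_) ((ENNReal.le_tsum n).trans (h i))
        rw [coeff_Wd]; ring
    _ ≤ _ := by rw [ENNReal.tsum_mul_right]; gcongr; exact tsum_inv_succ_sq_le

/-- Powers of a kernel. -/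
def kpow {ι : Type*} (A : ι → ι → Ser) : ℕ → ι → ι → Ser
  | 0 => fun x y => if x = y then 1 else 0
  | n + 1 => kmul A (kpow A n)

section kpow

variable {ι : Type*} (A : ι → ι → Ser)

theorem kmul_delta_left (B : ι → ι → Ser) : kmul (kpow A 0) B = B := by
  funext x y
  rw [kmul, psum_single _ x (fun j hj => by simp [kpow, hj.symm])]
  simp [kpow]

theorem kmul_delta_right (B : ι → ι → Ser) : kmul B (kpow A 0) = B := by
  funext x y
  rw [kmul, psum_single _ y (fun j hj => by simp [kpow, hj])]
  simp [kpow]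

theorem kpow_one : kpow A 1 = A := kmul_delta_right A A

theorem kpow_add (m n : ℕ) : kmul (kpow A m) (kpow A n) = kpow A (m + n) := by
  induction m with
  | zero => rw [kmul_delta_left, zero_add]
  | succ m ih => rw [kpow, kmul_assoc, ih, Nat.add_right_comm, kpow]

theorem kpow_mono {A} (hA : ∀ x y, kpow A 0 x y ≤ A x y) {m n : ℕ} (h : m ≤ n) (x y : ι) :
    kpow A m x y ≤ kpow A n x y := by
  induction n, h using Nat.le_induction with
  | base => exact le_rfl
  | succ n _ ih =>
    refine ih.trans ?_
    calc kpow A n x y = kmul (kpow A 0) (kpow A n) x y := by rw [kmul_delta_left]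
      _ ≤ _ := kmul_mono hA (fun _ _ => le_rfl) x y

theorem kmul_mul_mul (a b : Ser) (A B : ι → ι → Ser) (x y : ι) :
    kmul (fun x y => a * A x y) (fun x y => b * B x y) x y = a * b * kmul A B x y := by
  rw [kmul, kmul, mul_psum]
  congr 1; funext u; ring

end kpow

theorem kpow_translation {d : ℕ} {A : Pt d → Pt d → Ser}
    (hA : ∀ a x y, A (a + x) (a + y) = A x y) (n : ℕ) :
    ∀ a x y, kpow A n (a + x) (a + y) = kpow A n x y := by
  induction n with
  | zero => intro a x y; simp [kpow]
  | succ n ih => exact kmul_translation hA ih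

end Ser

section

open Ser PowerSeries

section Moments

variable {d : ℕ} (w : List (Pt d) → ℝ≥0∞) (M : ℝ≥0∞)

/-- Bound for the relative number operator of the series of closed walks. -/
def bN : Ser := 2 * C M * gS w ∅ 0 * kmul J (kmul (kmul (GS w ∅) (GS w ∅)) J) 0 0

/-- Prefactors in the moment bounds. -/
def cser : ℕ → Ser
  | 0 => 1
  | j + 1 => Wd j (geom (bN w M)) * cser j ^ 2

variable {w M} (htr : ∀ a x y, GS w ∅ (a + x) (a + y) = GS w ∅ x y)

theorem kpow_zero_le_GS (A : Pt d → Pt d → Ser) (x y : Pt d) : kpow A 0 x y ≤ GS w ∅ x y := by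
  convert delta_le_GS w x y using 1
  simp only [kpow]
  congr

theorem J_translation (a x y : Pt d) : J (a + x) (a + y) = J x y :=
  J_image (R := Equiv.addLeft a) (isLatticeIso_addLeft a) x y

include htr

theorem gS_eq_zero (x : Pt d) : gS w ∅ x = gS w ∅ 0 := by
  rw [gS, gS, ← htr x 0 0, add_zero]

theorem GS_le_mul_add (x y : Pt d) :
    GS w ∅ x y ≤ gS w ∅ 0 * (kpow (GS w ∅) 0 x y + kmul J (GS w ∅) x y) := by
  rw [GS_eq w (by simp), gS_eq_zero htr, US]
  refine mul_le_mul' le_rfl (add_le_add (le_of_eq ?_) ?_)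
  · simp only [kpow]
    congr
  exact psum_mono fun u => mul_le_mul' le_rfl (GS_anti w (Finset.empty_subset _) u y)

theorem kpow_GS_le (m : ℕ) (x y : Pt d) : kpow (GS w ∅) m x y ≤
    gS w ∅ 0 ^ m * (kpow (GS w ∅) 0 x y + m * kmul J (kpow (GS w ∅) m) x y) := by
  set G := GS w ∅
  have h1 : 1 ≤ gS w ∅ (0 : Pt d) := one_le_gS w (by simp)
  induction m generalizing x y with
  | zero => simp
  | succ m ih =>
    have hc : kmul G (kmul J (kpow G m)) = kmul J (kpow G (m + 1)) := by
      rw [← kmul_assoc, kmul_comm_of_translation htr J_translation, kmul_assoc, kpow]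
    calc kpow G (m + 1) x y = kmul G (kpow G m) x y := rfl
      _ ≤ kmul G (fun x y => gS w ∅ 0 ^ m * (kpow G 0 x y + m * kmul J (kpow G m) x y)) x y :=
        kmul_mono (fun _ _ => le_rfl) ih x y
      _ = gS w ∅ 0 ^ m * (kmul G (kpow G 0) x y + m * kmul G (kmul J (kpow G m)) x y) := by
        rw [kmul, kmul, kmul, mul_psum, ← psum_add, mul_psum]
        congr 1; funext u; ring
      _ = gS w ∅ 0 ^ m * (G x y + m * kmul J (kpow G (m + 1)) x y) := by
        rw [kmul_delta_right, hc]
      _ ≤ gS w ∅ 0 ^ m * (gS w ∅ 0 * (kpow G 0 x y + kmul J (kpow G (m + 1)) x y) +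
          m * (gS w ∅ 0 * kmul J (kpow G (m + 1)) x y)) := by
        gcongr
        · refine (GS_le_mul_add htr x y).trans ?_
          gcongr
          refine kmul_mono (fun _ _ => le_rfl) (fun a b => ?_) x y
          calc GS w ∅ a b = kpow G 1 a b := by rw [kpow_one]
            _ ≤ _ := kpow_mono (kpow_zero_le_GS G) (by omega) a b
        · exact le_mul_of_one_le_left (Ser.zero_le _) h1
      _ = _ := by push_cast; ring

theorem Wd_GS_le (hw : ∀ l, w l ≤ M) (j : ℕ) (x y : Pt d) :
    Wd j (GS w ∅ x y) ≤ cser w M j * kpow (GS w ∅) (2 ^ j) x y := by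
  induction j generalizing x y with
  | zero => simp [cser, kpow_one]
  | succ j ih =>
    rw [Wd_succ]
    refine (Wd_mono j (number_GS_le hw htr ∅ x y)).trans ((Wd_mul_le _ _ _).trans ?_)
    rw [cser, mul_assoc (Wd j _)]
    refine mul_le_mul' le_rfl ((Wd_kmul_le _ _ _ _ _).trans ((kmul_mono ih ih x y).trans ?_))
    rw [kmul_mul_mul, kpow_add, pow_succ 2 j, mul_two, sq]

omit htr in
theorem Wd_J (j : ℕ) (x y : Pt d) : Wd j (J x y) = C (2 ^ j) * J x y := by
  unfold J; split_ifs
  · exact Wd_X j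
  · simp

variable {z q : ℝ≥0∞} (hw : ∀ l, w l ≤ M) (hM1 : 1 ≤ M)
  (hQ : ∀ x y, ev z (kmul J (kpow (GS w ∅) 100) x y) ≤ q) (hq : 2 ^ 400 * M * q ≤ 1)

omit htr in
include hQ in
theorem ev_JG_le {m : ℕ} (hm : m ≤ 100) (x y : Pt d) :
    ev z (kmul J (kpow (GS w ∅) m) x y) ≤ q :=
  (ev_mono z (kmul_mono (fun _ _ => le_rfl) (kpow_mono (kpow_zero_le_GS _) hm) x y)).trans (hQ x y)

omit htr in
theorem two_pow_mul_le {a : ℝ≥0∞} (i : ℕ) {k : ℕ} (h : i + k = 400) (ha : 2 ^ 400 * M * a ≤ 1) :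
    2 ^ i * M * a ≤ (2 ^ k)⁻¹ := by
  rw [ENNReal.le_inv_iff_mul_le]
  refine le_trans (le_of_eq ?_) ha
  rw [← h, pow_add]; ring

omit htr in
theorem two_pow_mul_le' {a : ℝ≥0∞} (hM1 : 1 ≤ M) (i : ℕ) {k : ℕ} (h : i + k = 400)
    (ha : 2 ^ 400 * M * a ≤ 1) : 2 ^ i * a ≤ (2 ^ k)⁻¹ := by
  refine le_trans ?_ (two_pow_mul_le i h ha)
  gcongr
  exact le_mul_of_one_le_right bot_le hM1

omit htr in
theorem kmul_GJ_le (k : ℕ) (x y : Pt d) :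
    kmul J (kmul (kpow (GS w ∅) k) J) x y ≤ kmul J (kpow (GS w ∅) (k + 1)) x y := by
  refine kmul_mono (fun _ _ => le_rfl) (fun a b => ?_) x y
  rw [← kpow_add, kpow_one]
  exact kmul_mono (fun _ _ => le_rfl) (J_le_GS w) a b

omit htr in
theorem rS_le_JG (hw : ∀ l, w l ≤ M) (S : Finset (Pt d)) (v : Pt d) :
    rS w S v ≤ C M * kmul J (kmul (GS w ∅) J) v v := by
  refine (rS_le hw S v).trans ?_
  gcongr
  exact kmul_mono (fun _ _ => le_rfl) (kmul_mono (fun a b => GS_anti w (Finset.empty_subset _) a b)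
    fun _ _ => le_rfl) v v

include hw hM1 hQ hq

omit htr in
omit hM1 in
theorem ev_gS_le : ev z (gS w ∅ 0) ≤ 2 := by
  rw [gS_eq w (by simp)]
  refine ev_geom_le ((ev_mono z (rS_le_JG hw _ _)).trans ?_)
  have h1 := ev_mono z (kmul_GJ_le (w := w) 1 0 0)
  rw [kpow_one] at h1
  rw [map_mul, ev_C]
  calc M * ev z (kmul J (kmul (GS w ∅) J) 0 0) ≤ M * q := by
        gcongr; exact h1.trans (ev_JG_le hQ (by norm_num) _ _)
    _ ≤ 2 ^ 399 * M * q := by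
        rw [mul_assoc]
        exact le_mul_of_one_le_left bot_le (one_le_pow₀ (by norm_num))
    _ ≤ (2 ^ 1)⁻¹ := two_pow_mul_le 399 (by norm_num) hq
    _ = _ := by rw [pow_one]

theorem ev_kpow_le {m : ℕ} (hm : m ≤ 100) (x y : Pt d) :
    ev z (kpow (GS w ∅) m x y) ≤ 2 ^ (m + 1) := by
  refine (ev_mono z (kpow_GS_le htr m x y)).trans ?_
  rw [map_mul, map_pow, map_add, map_mul, map_natCast, pow_succ]
  have h1 : ev z (kpow (GS w ∅) 0 x y) ≤ 1 := by
    simp only [kpow]; split_ifs <;> simp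
  have h2 : (m : ℝ≥0∞) * ev z (kmul J (kpow (GS w ∅) m) x y) ≤ 1 := by
    calc _ ≤ 2 ^ 7 * q := by
          gcongr
          · exact_mod_cast hm.trans (by norm_num)
          · exact ev_JG_le hQ hm x y
      _ ≤ (2 ^ 393)⁻¹ := two_pow_mul_le' hM1 7 (by norm_num) hq
      _ ≤ 1 := ENNReal.inv_le_one.2 (one_le_pow₀ (by norm_num))
  gcongr
  · exact ev_gS_le hw hQ hq
  · calc _ ≤ (1 : ℝ≥0∞) + 1 := add_le_add h1 h2
      _ = 2 := by norm_num

theorem ev_Wd_GS_le {j : ℕ} (hj : j ≤ 5) {c : ℝ≥0∞} (hc : ev z (cser w M j) ≤ c) (x y : Pt d) :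
    ev z (Wd j (GS w ∅ x y)) ≤ c * 2 ^ 33 := by
  refine (ev_mono z (Wd_GS_le htr hw j x y)).trans ?_
  rw [map_mul]
  have h5 : 2 ^ j ≤ 2 ^ 5 := Nat.pow_le_pow_right (by norm_num) hj
  gcongr
  refine (ev_kpow_le htr hw hM1 hQ hq (by omega) x y).trans ?_
  gcongr
  · norm_num
  · omega

omit hM1 hq in
theorem ev_Wd_JGJ_le {j k : ℕ} (hk : k * 2 ^ j + 1 ≤ 100) (hj : j ≤ 5) {c : ℝ≥0∞}
    (hc : ev z (cser w M j) ≤ c) (x y : Pt d) :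
    ev z (Wd j (kmul J (kmul (kpow (GS w ∅) k) J) x y)) ≤ 2 ^ 10 * c ^ k * q := by
  have hp : ∀ k (a b : Pt d), Wd j (kpow (GS w ∅) k a b) ≤
      cser w M j ^ k * kpow (GS w ∅) (k * 2 ^ j) a b := fun k => by
    induction k with
    | zero => intro a b; simp only [kpow]; split_ifs <;> simp [Wd_one, kpow, *]
    | succ k ih =>
      intro a b
      rw [kpow]
      refine (Wd_kmul_le _ _ _ _ _).trans ((kmul_mono (Wd_GS_le htr hw j) ih a b).trans ?_)
      rw [kmul_mul_mul, kpow_add, ← pow_succ']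
      rw [show 2 ^ j + k * 2 ^ j = (k + 1) * 2 ^ j by ring]
  have h1 : Wd j (kmul J (kmul (kpow (GS w ∅) k) J) x y) ≤
      C (2 ^ (2 * j)) * cser w M j ^ k * kmul J (kpow (GS w ∅) (k * 2 ^ j + 1)) x y := by
    calc _ ≤ kmul (fun a b => C (2 ^ j) * J a b) (fun a b => (cser w M j ^ k * C (2 ^ j)) *
            kmul (kpow (GS w ∅) (k * 2 ^ j)) J a b) x y := by
          refine (Wd_kmul_le _ _ _ _ _).trans (kmul_mono (fun a b => (Wd_J j a b).le)
            (fun a b => (Wd_kmul_le _ _ _ _ _).trans ?_) x y)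
          refine (kmul_mono (hp k) (fun a b => (Wd_J j a b).le) a b).trans ?_
          rw [kmul_mul_mul]
      _ = C (2 ^ (2 * j)) * cser w M j ^ k *
            kmul J (kmul (kpow (GS w ∅) (k * 2 ^ j)) J) x y := by
          rw [kmul_mul_mul, two_mul, pow_add, map_mul]; ring
      _ ≤ _ := by gcongr; exact kmul_GJ_le _ x y
  refine (ev_mono z h1).trans ?_
  rw [map_mul, map_mul, ev_C, map_pow]
  gcongr
  · norm_num
  · omega
  · exact ev_JG_le hQ hk x y

theorem ev_Wd_bN_le {j : ℕ} (hj : j ≤ 4) (hc : ev z (cser w M j) ≤ 2 ^ 32) :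
    ev z (Wd j (bN w M)) ≤ 2⁻¹ := by
  have h5 : 2 ^ j ≤ 2 ^ 4 := Nat.pow_le_pow_right (by norm_num) hj
  have h2 : (kmul (GS w ∅) (GS w ∅)) = kpow (GS w (∅ : Finset (Pt d))) 2 := by
    rw [← kpow_add _ 1 1, kpow_one]
  have h3 : (2 : Ser) * C M = C (2 * M) := by rw [map_mul]; rfl
  rw [bN, h2, h3]
  refine (ev_Wd_mul_le _ _ _ _).trans ?_
  calc _ ≤ ((2 * M) * (2 ^ 32 * 2 ^ 33)) * (2 ^ 10 * (2 ^ 32) ^ 2 * q) := by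
        gcongr
        · refine (ev_Wd_mul_le _ _ _ _).trans ?_
          rw [Wd_C, ev_C]
          gcongr
          exact ev_Wd_GS_le htr hw hM1 hQ hq (by omega) hc 0 0
        · exact ev_Wd_JGJ_le htr hw hQ (by omega) (by omega) hc 0 0
    _ = 2 ^ 140 * M * q := by ring
    _ ≤ 2 ^ 399 * M * q := by gcongr <;> norm_num
    _ ≤ (2 ^ 1)⁻¹ := two_pow_mul_le 399 (by norm_num) hq
    _ = _ := by rw [pow_one]

theorem ev_cser_le {j : ℕ} (hj : j ≤ 5) : ev z (cser w M j) ≤ 2 ^ 32 := by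
  have key : ∀ j ≤ 5, 2 * ev z (cser w M j) ≤ 2 ^ 2 ^ j := fun j => by
    induction j with
    | zero => intro _; simp [cser]
    | succ j ih =>
      intro hj
      have h0 := ih (by omega)
      have h5 : (2 : ℝ≥0∞) ^ 2 ^ j ≤ 2 ^ 32 := by
        gcongr
        · norm_num
        · exact (Nat.pow_le_pow_right (by norm_num) (by omega : j ≤ 5)).trans (by norm_num)
      have h1 : ev z (cser w M j) ≤ 2 ^ 32 :=
        (le_mul_of_one_le_left bot_le (by norm_num)).trans (h0.trans h5)
      have h2 := ev_Wd_geom_le (ev_Wd_bN_le htr hw hM1 hQ hq (by omega) h1)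
      rw [cser, map_mul, map_pow]
      calc _ ≤ 2 * (2 * ev z (cser w M j) ^ 2) := by gcongr
        _ = (2 * ev z (cser w M j)) ^ 2 := by ring
        _ ≤ (2 ^ 2 ^ j) ^ 2 := by gcongr
        _ = _ := by rw [← pow_mul, ← pow_succ]
  refine (le_mul_of_one_le_left bot_le (by norm_num)).trans ((key j hj).trans ?_)
  gcongr
  · norm_num
  · exact (Nat.pow_le_pow_right (by norm_num) hj).trans (by norm_num)

theorem ev_Wd_gS_le {j : ℕ} (hj : j ≤ 5) : ev z (Wd j (gS w ∅ 0)) ≤ 2 ^ 65 :=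
  (ev_Wd_GS_le htr hw hM1 hQ hq hj (ev_cser_le htr hw hM1 hQ hq hj) 0 0).trans (by norm_num)

theorem ev_Wd_hs_le : ev z (Wd 3 (hs w)) ≤ 2 ^ 102 * q := by
  have h : ∀ i : Pt d × Pt d, ev z (Wd (3 + 2) (J3 w i.1 i.2)) ≤ 2 ^ 101 * q := fun i => by
    have h1 : Wd 5 (J3 w i.1 i.2) ≤
        C (2 ^ 5) * cser w M 5 ^ 3 * kmul J (kpow (GS w ∅) 96) i.1 i.2 := by
      have e := Wd_GS_le htr hw 5
      calc _ ≤ kmul (fun a b => C (2 ^ 5) * J a b)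
            (kmul (fun a b => cser w M 5 * kpow (GS w ∅) 32 a b)
            (kmul (fun a b => cser w M 5 * kpow (GS w ∅) 32 a b)
            (fun a b => cser w M 5 * kpow (GS w ∅) 32 a b))) i.1 i.2 :=
            (Wd_kmul_le _ _ _ _ _).trans (kmul_mono (fun a b => (Wd_J 5 a b).le)
              (fun a b => (Wd_kmul_le _ _ _ _ _).trans (kmul_mono e
              (fun a b => (Wd_kmul_le _ _ _ _ _).trans (kmul_mono e e a b)) a b)) i.1 i.2)
        _ = kmul (fun a b => C (2 ^ 5) * J a b) (fun a b => cser w M 5 * (cser w M 5 * cser w M 5) *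
            kpow (GS w ∅) 96 a b) i.1 i.2 := by
            congr 1
            funext a b
            have : (kmul (fun a b => cser w M 5 * kpow (GS w ∅) 32 a b)
              (fun a b => cser w M 5 * kpow (GS w ∅) 32 a b)) = fun a b : Pt d =>
                (cser w M 5 * cser w M 5) * kpow (GS w ∅) 64 a b := by
              funext a b; rw [kmul_mul_mul, kpow_add]
            rw [this, kmul_mul_mul, kpow_add]
        _ = _ := by rw [kmul_mul_mul]; ring
    refine (ev_mono z h1).trans ?_
    rw [map_mul, map_mul, ev_C, map_pow]
    calc _ ≤ 2 ^ 5 * (2 ^ 32) ^ 3 * q := by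
          gcongr
          · exact ev_cser_le htr hw hM1 hQ hq le_rfl
          · exact ev_JG_le hQ (by norm_num) _ _
      _ = _ := by ring
  have h2 := ev_Wd_iSup_le 3 z _ _ h
  have h3 : hs w = mk fun n => ⨆ i : Pt d × Pt d, coeff n (J3 w i.1 i.2) := by
    ext n; simp only [hs, coeff_mk]; rw [iSup_prod]
  rw [h3]
  refine h2.trans (le_of_eq ?_)
  rw [← mul_assoc, ← pow_succ']

/-- Moments of the lace expansion coefficients. -/
theorem ev_Wd_ph_le : ev z (Wd 3 (gS w ∅ 0 * ph w M)) ≤ (2 ^ 20)⁻¹ := by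
  have hh := ev_Wd_hs_le htr hw hM1 hQ hq
  have hg := ev_Wd_gS_le htr hw hM1 hQ hq (j := 3) (by norm_num)
  have hk : ev z (Wd 3 (kk w M)) ≤ 2 ^ 66 := by
    rw [kk]
    refine (ev_Wd_mul_le _ _ _ _).trans ?_
    calc _ ≤ (2 ^ 65 : ℝ≥0∞) * 2 := by
          gcongr
          refine ev_Wd_geom_le ?_
          calc _ ≤ ((2 ^ 65) ^ 2 * M) * (2 ^ 102 * q) := by
                refine (ev_Wd_mul_le _ _ _ _).trans ?_
                gcongr
                refine (ev_Wd_mul_le _ _ _ _).trans ?_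
                rw [Wd_C, ev_C]
                gcongr
                refine (ev_mono z (Wd_pow_le _ _ _)).trans ?_
                rw [map_pow]
                gcongr
            _ = 2 ^ 232 * M * q := by ring
            _ ≤ 2 ^ 399 * M * q := by gcongr <;> norm_num
            _ ≤ (2 ^ 1)⁻¹ := two_pow_mul_le 399 (by norm_num) hq
            _ = _ := by rw [pow_one]
      _ = _ := by norm_num
  have hb : ev z (Wd 3 (bt w M)) ≤ 2 ^ 168 * q := by
    rw [bt]
    refine (ev_Wd_mul_le _ _ _ _).trans ?_
    calc _ ≤ (2 ^ 102 * q) * 2 ^ 66 := by gcongr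
      _ = _ := by ring
  have hb2 : ev z (Wd 3 (bt w M)) ≤ 2⁻¹ := by
    refine hb.trans ?_
    calc _ ≤ 2 ^ 399 * q := by gcongr <;> norm_num
      _ ≤ (2 ^ 1)⁻¹ := two_pow_mul_le' hM1 399 (by norm_num) hq
      _ = _ := by rw [pow_one]
  refine (ev_Wd_mul_le _ _ _ _).trans ?_
  rw [ph]
  calc _ ≤ 2 ^ 65 * ((2 ^ 168 * q) * 2) := by
        gcongr
        refine (ev_Wd_mul_le _ _ _ _).trans ?_
        gcongr
        exact ev_Wd_geom_le hb2
    _ = 2 ^ 234 * q := by ring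
    _ ≤ 2 ^ 380 * q := by gcongr <;> norm_num
    _ ≤ _ := two_pow_mul_le' hM1 380 (by norm_num) hq

/-- Moments of the series of closed walks. -/
theorem ev_Wd_sub_gS_le : ev z (Wd 3 (rS w ∅ 0 * gS w ∅ 0)) ≤ (2 ^ 20)⁻¹ := by
  have hg := ev_Wd_gS_le htr hw hM1 hQ hq (j := 3) (by norm_num)
  have hr : ev z (Wd 3 (rS w ∅ 0)) ≤ M * (2 ^ 10 * 2 ^ 32 * q) := by
    refine (ev_mono z (Wd_mono 3 (rS_le_JG hw _ _))).trans ((ev_Wd_mul_le _ _ _ _).trans ?_)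
    rw [Wd_C, ev_C]
    gcongr
    have := ev_Wd_JGJ_le htr hw hQ (k := 1) (j := 3) (by norm_num) (by norm_num)
      (ev_cser_le htr hw hM1 hQ hq (by norm_num)) 0 0
    rwa [kpow_one, pow_one] at this
  refine (ev_Wd_mul_le _ _ _ _).trans ?_
  calc _ ≤ M * (2 ^ 10 * 2 ^ 32 * q) * 2 ^ 65 := by gcongr
    _ = 2 ^ 107 * M * q := by ring
    _ ≤ 2 ^ 380 * M * q := by gcongr <;> norm_num
    _ ≤ _ := two_pow_mul_le 380 (by norm_num) hq

end Moments

end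

section

open Ser PowerSeries

section Fourier

open MeasureTheory Complex

/-- Normalized measure on the fundamental cell of the dual torus. -/
def cell : Measure ℝ := volume.restrict (Set.Ioc (-(1 / 2)) (1 / 2))

instance : IsProbabilityMeasure cell := ⟨by simp [cell]; norm_num⟩

/-- Normalized measure on the fundamental cell of the dual torus of `ℤ^d`. -/
def tor (d : ℕ) : Measure (Fin d → ℝ) := Measure.pi fun _ => cell

instance (d : ℕ) : IsProbabilityMeasure (tor d) := by unfold tor; infer_instance

/-- One-dimensional characters. -/
def ex (n : ℤ) (t : ℝ) : ℂ := cexp ((2 * Real.pi * n * t : ℝ) * I)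

theorem norm_ex (n : ℤ) (t : ℝ) : ‖ex n t‖ = 1 := norm_exp_ofReal_mul_I _

theorem ex_add (m n : ℤ) (t : ℝ) : ex (m + n) t = ex m t * ex n t := by
  rw [ex, ex, ex, ← Complex.exp_add]; congr 1; push_cast; ring

theorem ex_zero (t : ℝ) : ex 0 t = 1 := by simp [ex]

theorem ex_zero_right (n : ℤ) : ex n 0 = 1 := by simp [ex]

theorem continuous_ex (n : ℤ) : Continuous (ex n) := by unfold ex; fun_prop

theorem re_ex_one (t : ℝ) : (ex 1 t).re = Real.cos (2 * Real.pi * t) := by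
  rw [ex, exp_ofReal_mul_I_re]; simp

theorem integral_ex (n : ℤ) : ∫ t, ex n t ∂cell = if n = 0 then 1 else 0 := by
  split_ifs with h
  · subst h; simp [ex_zero]
  · rw [cell, ← intervalIntegral.integral_of_le (by norm_num)]
    have hc : (2 * Real.pi * n * I : ℂ) ≠ 0 := by
      simp [h, Real.pi_ne_zero]
    have : ∀ t : ℝ, ex n t = cexp ((2 * Real.pi * n * I) * t) := fun t => by
      rw [ex]; congr 1; push_cast; ring
    simp only [this]
    rw [integral_exp_mul_complex hc, div_eq_zero_iff]
    left
    rw [sub_eq_zero, exp_eq_exp_iff_exists_int]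
    exact ⟨n, by push_cast; ring⟩

variable {d : ℕ}

/-- Characters of `ℤ^d`. -/
def chr (x : Pt d) (k : Fin d → ℝ) : ℂ := ∏ j, ex (x j) (k j)

theorem norm_chr (x : Pt d) (k : Fin d → ℝ) : ‖chr x k‖ = 1 := by simp [chr, norm_ex]

theorem chr_add (x y : Pt d) (k : Fin d → ℝ) : chr (x + y) k = chr x k * chr y k := by
  simp [chr, ex_add, Finset.prod_mul_distrib]

theorem chr_zero (k : Fin d → ℝ) : chr (0 : Pt d) k = 1 := by simp [chr, ex_zero]

theorem chr_zero_right (x : Pt d) : chr x 0 = 1 := by simp [chr, ex_zero_right]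

theorem continuous_chr (x : Pt d) : Continuous (chr x) := by
  unfold chr
  exact continuous_finsetProd _ fun j _ => (continuous_ex _).comp (continuous_apply j)

theorem integral_chr (x : Pt d) : ∫ k, chr x k ∂tor d = if x = 0 then 1 else 0 := by
  unfold chr tor
  rw [integral_fintype_prod_eq_prod (f := fun j t => ex (x j) t)]
  simp only [integral_ex, Finset.prod_ite_zero, Finset.prod_const_one]
  congr 1
  simp [funext_iff]

theorem integrable_chr (x : Pt d) : Integrable (chr x) (tor d) :=
  Integrable.of_bound (continuous_chr x).aestronglyMeasurable 1 (.of_forall fun k =>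
    (norm_chr x k).le)

/-- Fourier series of a nonnegative function on `ℤ^d`. -/
def ft (a : Pt d → ℝ≥0∞) (k : Fin d → ℝ) : ℂ := ∑' x, ((a x).toReal : ℂ) * chr x k

variable {a b : Pt d → ℝ≥0∞}

theorem summable_toReal (ha : ∑' x, a x ≠ ⊤) : Summable fun x => (a x).toReal :=
  ENNReal.summable_toReal ha

theorem norm_toReal_mul_chr (x : Pt d) (k : Fin d → ℝ) :
    ‖((a x).toReal : ℂ) * chr x k‖ = (a x).toReal := by
  rw [norm_mul, norm_chr, mul_one, norm_real, Real.norm_of_nonneg ENNReal.toReal_nonneg]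

theorem summable_norm_ft (ha : ∑' x, a x ≠ ⊤) (k : Fin d → ℝ) :
    Summable fun x => ‖((a x).toReal : ℂ) * chr x k‖ := by
  simp only [norm_toReal_mul_chr]; exact summable_toReal ha

theorem summable_ft (ha : ∑' x, a x ≠ ⊤) (k : Fin d → ℝ) :
    Summable fun x => ((a x).toReal : ℂ) * chr x k := (summable_norm_ft ha k).of_norm

theorem toReal_tsum (ha : ∑' x, a x ≠ ⊤) : (∑' x, a x).toReal = ∑' x, (a x).toReal :=
  ENNReal.tsum_toReal_eq fun x => ENNReal.ne_top_of_tsum_ne_top ha x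

theorem norm_ft_le (ha : ∑' x, a x ≠ ⊤) (k : Fin d → ℝ) : ‖ft a k‖ ≤ (∑' x, a x).toReal := by
  rw [toReal_tsum ha]
  refine (norm_tsum_le_tsum_norm (summable_norm_ft ha k)).trans (le_of_eq ?_)
  simp only [norm_toReal_mul_chr]

theorem ft_zero_right (ha : ∑' x, a x ≠ ⊤) : ft a 0 = ((∑' x, a x).toReal : ℝ) := by
  rw [toReal_tsum ha, ft, ofReal_tsum]; simp only [chr_zero_right, mul_one]

theorem ft_add (ha : ∑' x, a x ≠ ⊤) (hb : ∑' x, b x ≠ ⊤) (k : Fin d → ℝ) :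
    ft (fun x => a x + b x) k = ft a k + ft b k := by
  rw [ft, ft, ft, ← (summable_ft ha k).tsum_add (summable_ft hb k)]
  refine tsum_congr fun x => ?_
  rw [ENNReal.toReal_add (ENNReal.ne_top_of_tsum_ne_top ha x) (ENNReal.ne_top_of_tsum_ne_top hb x)]
  push_cast; ring

theorem ft_const_mul (c : ℝ≥0∞) (k : Fin d → ℝ) :
    ft (fun x => c * a x) k = c.toReal * ft a k := by
  rw [ft, ft, ← tsum_mul_left]
  refine tsum_congr fun x => ?_
  rw [ENNReal.toReal_mul]; push_cast; ring

theorem ft_delta (k : Fin d → ℝ) : ft (fun x : Pt d => if (0 : Pt d) = x then 1 else 0) k = 1 := by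
  rw [ft, tsum_eq_single 0]
  · simp [chr_zero]
  · intro x hx; simp [hx.symm]

theorem tsum_conv : ∑' x, ∑' u, a u * b (x - u) = (∑' x, a x) * ∑' x, b x := by
  rw [ENNReal.tsum_comm, ← ENNReal.tsum_mul_right]
  refine tsum_congr fun u => ?_
  rw [ENNReal.tsum_mul_left, ← (Equiv.addRight u).tsum_eq]
  simp

theorem ft_conv (ha : ∑' x, a x ≠ ⊤) (hb : ∑' x, b x ≠ ⊤) (k : Fin d → ℝ) :
    ft (fun x => ∑' u, a u * b (x - u)) k = ft a k * ft b k := by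
  have hab : ∑' x, ∑' u, a u * b (x - u) ≠ ⊤ := by
    rw [tsum_conv]; exact ENNReal.mul_ne_top ha hb
  rw [ft, ft, ft, tsum_mul_tsum_of_summable_norm (summable_norm_ft ha k) (summable_norm_ft hb k)]
  let e : Pt d × Pt d ≃ Pt d × Pt d :=
    ⟨fun p => (p.2, p.1 - p.2), fun p => (p.1 + p.2, p.1), fun p => by simp, fun p => by simp⟩
  have hs := e.summable_iff.2
    (summable_mul_of_summable_norm (summable_norm_ft ha k) (summable_norm_ft hb k))
  rw [Function.comp_def] at hs
  rw [← e.tsum_eq, hs.tsum_prod]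
  refine tsum_congr fun x => ?_
  rw [ENNReal.tsum_toReal_eq fun u => ENNReal.ne_top_of_tsum_ne_top
    (ENNReal.ne_top_of_tsum_ne_top hab x) u, ofReal_tsum, ← tsum_mul_right]
  refine tsum_congr fun u => ?_
  simp only [e, Equiv.coe_fn_mk, ENNReal.toReal_mul, ofReal_mul]
  have : chr x k = chr u k * chr (x - u) k := by rw [← chr_add, add_sub_cancel]
  rw [this]; ring

theorem integral_ft_mul_chr (ha : ∑' x, a x ≠ ⊤) (x : Pt d) :
    ∫ k, ft a k * chr (-x) k ∂tor d = (a x).toReal := by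
  simp only [ft, ← tsum_mul_right, mul_assoc, ← chr_add]
  rw [← integral_tsum_of_summable_integral_norm]
  · simp only [integral_const_mul, integral_chr]
    rw [tsum_eq_single x]
    · simp
    · intro y hy
      rw [if_neg, mul_zero]
      rwa [← sub_eq_add_neg, sub_eq_zero]
  · exact fun y => (integrable_chr _).const_mul _
  · simp only [norm_mul, norm_chr, mul_one, norm_real, Real.norm_of_nonneg ENNReal.toReal_nonneg,
      integral_const, probReal_univ, one_smul]
    exact summable_toReal ha

theorem le_lintegral_ft (ha : ∑' x, a x ≠ ⊤) (x : Pt d) : a x ≤ ∫⁻ k, ‖ft a k‖ₑ ∂tor d := by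
  have h := enorm_integral_le_lintegral_enorm (μ := tor d) (fun k => ft a k * chr (-x) k)
  rw [integral_ft_mul_chr ha] at h
  have h1 : ‖((a x).toReal : ℂ)‖ₑ = a x := by
    rw [← ofReal_norm, norm_real, Real.norm_of_nonneg ENNReal.toReal_nonneg,
      ENNReal.ofReal_toReal (ENNReal.ne_top_of_tsum_ne_top ha x)]
  rw [h1] at h
  refine h.trans (le_of_eq (lintegral_congr fun k => ?_))
  rw [enorm_mul, ← ofReal_norm (chr _ _), norm_chr]; simp

end Fourier

end

section

open Ser PowerSeries

section Torus

open MeasureTheory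

/-- One minus the cosine. -/
def uu (t : ℝ) : ℝ := 1 - Real.cos (2 * Real.pi * t)

theorem uu_nonneg (t : ℝ) : 0 ≤ uu t := sub_nonneg.2 (Real.cos_le_one _)

theorem continuous_uu : Continuous uu := by unfold uu; fun_prop

theorem lintegral_uu_rpow_ne_top :
    ∫⁻ t, ENNReal.ofReal (uu t) ^ (-(1 / 4) : ℝ) ∂cell ≠ ⊤ := by
  have h1 : IntegrableOn (fun t : ℝ => t ^ (-(1 / 2) : ℝ)) (Set.Ioc 0 (1 / 2)) :=
    (intervalIntegrable_iff_integrableOn_Ioc_of_le (by norm_num)).1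
      (intervalIntegral.intervalIntegrable_rpow' (by norm_num))
  have h2 : ∫⁻ t in Set.Ioc (0 : ℝ) (1 / 2), ENNReal.ofReal (t ^ (-(1 / 2) : ℝ)) ≠ ⊤ := by
    have := h1.lintegral_lt_top
    exact this.ne
  have h3 : ∫⁻ t in Set.Ioc (0 : ℝ) (1 / 2), ENNReal.ofReal (uu t) ^ (-(1 / 4) : ℝ) ≠ ⊤ := by
    refine ne_top_of_le_ne_top h2 (setLIntegral_mono' measurableSet_Ioc fun t ht => ?_)
    have h4 : 8 * t ^ 2 ≤ uu t := by
      have := Real.cos_le_one_sub_mul_cos_sq (x := 2 * Real.pi * t) (by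
        rw [abs_of_nonneg (by have := ht.1; positivity)]
        nlinarith [ht.2, Real.pi_pos])
      have e : 2 / Real.pi ^ 2 * (2 * Real.pi * t) ^ 2 = 8 * t ^ 2 := by
        field_simp; ring
      rw [uu]; linarith
    have ht0 : (0 : ℝ) < t := ht.1
    rw [ENNReal.ofReal_rpow_of_pos (by nlinarith [sq_pos_of_pos ht0])]
    refine ENNReal.ofReal_le_ofReal ?_
    calc uu t ^ (-(1 / 4) : ℝ) ≤ (t ^ 2) ^ (-(1 / 4) : ℝ) :=
          Real.rpow_le_rpow_of_nonpos (by positivity) (by nlinarith [sq_pos_of_pos ht0])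
            (by norm_num)
      _ = t ^ (-(1 / 2) : ℝ) := by
          rw [← Real.rpow_natCast, ← Real.rpow_mul ht0.le]; norm_num
  have h5 : ∫⁻ t in Set.Ioc (-(1 / 2) : ℝ) 0, ENNReal.ofReal (uu t) ^ (-(1 / 4) : ℝ) ≠ ⊤ := by
    have e := (Measure.measurePreserving_neg (volume : Measure ℝ)).setLIntegral_comp_preimage_emb
      (MeasurableEquiv.neg ℝ).measurableEmbedding
      (fun t => ENNReal.ofReal (uu t) ^ (-(1 / 4) : ℝ)) (Set.Ico 0 (1 / 2))
    have h6 : (Neg.neg : ℝ → ℝ) ⁻¹' Set.Ico 0 (1 / 2) = Set.Ioc (-(1 / 2)) 0 := by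
      ext t; simp [neg_lt, and_comm]
    have h7 : ∀ t, uu (-t) = uu t := fun t => by simp [uu]
    simp only [h6, h7] at e
    rw [e, setLIntegral_congr Ico_ae_eq_Ioc]
    exact h3
  rw [cell, ← Set.Ioc_union_Ioc_eq_Ioc (b := 0) (by norm_num) (by norm_num)]
  refine ne_top_of_le_ne_top ?_ (lintegral_union_le _ _ _)
  exact ENNReal.add_ne_top.2 ⟨h5, h3⟩

variable {d : ℕ}

/-- One minus the characteristic function of the simple random walk step. -/
def ss (k : Fin d → ℝ) : ℝ := (∑ j, uu (k j)) / d

theorem ss_nonneg (k : Fin d → ℝ) : 0 ≤ ss k :=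
  div_nonneg (Finset.sum_nonneg fun _ _ => uu_nonneg _) (Nat.cast_nonneg d)

theorem ss_le_two (k : Fin d → ℝ) : ss k ≤ 2 := by
  refine div_le_of_le_mul₀ (Nat.cast_nonneg d) (by norm_num) ?_
  calc ∑ j, uu (k j) ≤ ∑ _j : Fin d, (2 : ℝ) := Finset.sum_le_sum fun j _ => by
        rw [uu]; linarith [Real.neg_one_le_cos (2 * Real.pi * k j)]
    _ = 2 * d := by simp [mul_comm]

theorem continuous_ss : Continuous (ss (d := d)) := by
  unfold ss
  exact (continuous_finsetSum _ fun j _ => continuous_uu.comp (continuous_apply j)).div_const _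

theorem ofReal_ss_inv_le (hd : 0 < d) (k : Fin d → ℝ) :
    (ENNReal.ofReal (ss k))⁻¹ ≤ ∏ j, ENNReal.ofReal (uu (k j)) ^ (-(1 / d : ℝ)) := by
  have hd' : (0 : ℝ) < d := by exact_mod_cast hd
  have h := NNReal.geom_mean_le_arith_mean_weighted (Finset.univ : Finset (Fin d))
    (fun _ => (d : ℝ≥0)⁻¹) (fun j => (uu (k j)).toNNReal) (by
      have : (d : ℝ≥0) ≠ 0 := by exact_mod_cast hd.ne'
      simp [this])
  have h2 : ∏ j, ENNReal.ofReal (uu (k j)) ^ (1 / d : ℝ) ≤ ENNReal.ofReal (ss k) := by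
    have : ENNReal.ofReal (ss k) = ((∑ j, (d : ℝ≥0)⁻¹ * (uu (k j)).toNNReal : ℝ≥0) : ℝ≥0∞) := by
      rw [ENNReal.ofReal, ENNReal.coe_inj, ← Finset.mul_sum, ss, div_eq_inv_mul,
        Real.toNNReal_mul (by positivity), Real.toNNReal_sum_of_nonneg fun _ _ => uu_nonneg _]
      simp [Real.toNNReal_inv]
    rw [this]
    refine le_trans (le_of_eq ?_) (ENNReal.coe_le_coe.2 h)
    rw [ENNReal.ofNNReal_finsetProd]
    refine Finset.prod_congr rfl fun j _ => ?_
    rw [ENNReal.coe_rpow_of_nonneg _ (by positivity)]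
    simp [ENNReal.ofReal]
  have h3 : ∏ j, ENNReal.ofReal (uu (k j)) ^ (-(1 / d : ℝ)) =
      (∏ j, ENNReal.ofReal (uu (k j)) ^ (1 / d : ℝ))⁻¹ := by
    rw [ENNReal.prod_inv_distrib]
    · exact Finset.prod_congr rfl fun j _ => ENNReal.rpow_neg _ _
    · intro i _ j _ _
      right
      exact ENNReal.rpow_ne_top_of_nonneg (by positivity) ENNReal.ofReal_ne_top
  rw [h3]
  exact ENNReal.inv_le_inv.2 h2

theorem lintegral_ss_inv_pow_le (hd : 800 ≤ d) :
    ∫⁻ k, (ENNReal.ofReal (ss k))⁻¹ ^ 200 ∂tor d ≤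
      (∫⁻ t, ENNReal.ofReal (uu t) ^ (-(1 / 4) : ℝ) ∂cell) ^ 800 := by
  have hd0 : 0 < d := by omega
  have hd' : (0 : ℝ) < d := by exact_mod_cast hd0
  have hd8 : (800 : ℝ) ≤ d := by exact_mod_cast hd
  have hm : Measurable fun t : ℝ => ENNReal.ofReal (uu t) := continuous_uu.measurable.ennreal_ofReal
  set f : ℝ → ℝ≥0∞ := fun t => ENNReal.ofReal (uu t) ^ (-(1 / 4) : ℝ) with hf
  have hfm : Measurable f := hm.pow_const _
  calc _ ≤ ∫⁻ k, ∏ j, f (k j) ^ (800 / d : ℝ) ∂tor d := by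
        refine lintegral_mono fun k => ?_
        refine (pow_le_pow_left₀ bot_le (ofReal_ss_inv_le hd0 k) 200).trans (le_of_eq ?_)
        rw [← Finset.prod_pow]
        refine Finset.prod_congr rfl fun j _ => ?_
        rw [hf, ← ENNReal.rpow_natCast, ← ENNReal.rpow_mul, ← ENNReal.rpow_mul]
        congr 1; push_cast; ring
    _ = ∏ j : Fin d, ∫⁻ t, f t ^ (800 / d : ℝ) ∂cell := by
        rw [ProbabilityTheory.lintegral_prod_eq_prod_lintegral_of_indepFun _
          (fun j (k : Fin d → ℝ) => f (k j) ^ (800 / d : ℝ))]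
        · refine Finset.prod_congr rfl fun j _ => ?_
          exact (measurePreserving_eval (fun _ : Fin d => cell) j).lintegral_comp
            (hfm.pow_const _)
        · exact ProbabilityTheory.iIndepFun_pi (X := fun _ t => f t ^ (800 / d : ℝ))
            fun _ => (hfm.pow_const _).aemeasurable
        · exact fun j => (hfm.pow_const _).comp (measurable_pi_apply j)
    _ ≤ ∏ _j : Fin d, (∫⁻ t, f t ∂cell) ^ (800 / d : ℝ) := by
        refine Finset.prod_le_prod' fun j _ => ?_
        have := ENNReal.lintegral_mul_norm_pow_le (μ := cell) (p := (800 / d : ℝ))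
          (q := 1 - (800 / d : ℝ)) hfm.aemeasurable (aemeasurable_const (b := 1)) (by positivity)
          (by rw [sub_nonneg, div_le_one hd']; exact hd8) (by ring)
        simpa using this
    _ = _ := by
        rw [Finset.prod_const, Finset.card_univ, Fintype.card_fin, ← ENNReal.rpow_natCast,
          ← ENNReal.rpow_mul, div_mul_cancel₀ _ hd'.ne']
        exact ENNReal.rpow_natCast _ 800

/-- The step distribution, with weight `z` for each step. -/
def jst (z : ℝ≥0∞) (x : Pt d) : ℝ≥0∞ := if Adj 0 x then z else 0

theorem tsum_jst (z : ℝ≥0∞) : ∑' x : Pt d, jst z x = 2 * d * z := by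
  unfold jst
  rw [tsum_adj 0 fun _ => z]
  simp [mul_comm]

theorem chr_uvec (i : Fin d × Bool) (k : Fin d → ℝ) :
    chr (uvec i) k = ex (if i.2 then 1 else -1) (k i.1) := by
  rw [chr, Finset.prod_eq_single i.1]
  · simp [uvec]
  · intro j _ hj; simp [uvec, hj, ex_zero]
  · simp

theorem ex_add_ex_neg (t : ℝ) : ex 1 t + ex (-1) t = ((2 * (1 - uu t) : ℝ) : ℂ) := by
  rw [uu, sub_sub_cancel]
  push_cast
  rw [ex, ex, Complex.cos, mul_div_cancel₀ _ two_ne_zero]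
  congr 2 <;> (push_cast; ring)

theorem ft_jst (hd : 0 < d) {z : ℝ≥0∞} (k : Fin d → ℝ) :
    ft (jst z) k = ((2 * z.toReal * d * (1 - ss k) : ℝ) : ℂ) := by
  have hd' : (d : ℝ) ≠ 0 := by exact_mod_cast hd.ne'
  have h1 : ft (jst z) k = ∑ i : Fin d × Bool, (z.toReal : ℂ) * chr (uvec i) k := by
    rw [ft, ← Finset.sum_image (f := fun x => (z.toReal : ℂ) * chr x k) (g := uvec)
      uvec_injective.injOn, tsum_eq_sum (s := Finset.univ.image uvec)]
    · refine Finset.sum_congr rfl fun x hx => ?_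
      obtain ⟨i, -, rfl⟩ := Finset.mem_image.1 hx
      rw [jst, if_pos]
      exact (adj_iff 0 _).2 ⟨i, by simp⟩
    · intro x hx
      rw [jst, if_neg]
      · simp
      · intro h
        obtain ⟨i, hi⟩ := (adj_iff 0 x).1 h
        exact hx (Finset.mem_image.2 ⟨i, Finset.mem_univ _, by simpa using hi.symm⟩)
  rw [h1, ← Finset.mul_sum, Fintype.sum_prod_type]
  simp only [chr_uvec, Fintype.sum_bool, if_true, Bool.false_eq_true, if_false, ex_add_ex_neg]
  rw [← Complex.ofReal_sum, ← Complex.ofReal_mul, ss, ← Finset.mul_sum, Finset.sum_sub_distrib]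
  congr 1
  field_simp
  simp

theorem lintegral_one_sub_ss_sq (hd : 0 < d) :
    ∫⁻ k, ‖1 - ss k‖ₑ ^ (2 : ℝ) ∂tor d ≤ (d : ℝ≥0∞)⁻¹ := by
  have hd' : (d : ℝ) ≠ 0 := by exact_mod_cast hd.ne'
  have hj : ∑' x : Pt d, jst 1 x ≠ ⊤ := by rw [tsum_jst]; finiteness
  have hjj : ∑' x : Pt d, ∑' u, jst 1 u * jst 1 (x - u) ≠ ⊤ := by
    rw [tsum_conv]; exact ENNReal.mul_ne_top hj hj
  have h := integral_ft_mul_chr hjj (0 : Pt d)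
  simp only [ft_conv hj hj, ft_jst hd, neg_zero, chr_zero, mul_one, ENNReal.toReal_one] at h
  have h2 : (∑' u : Pt d, jst 1 u * jst 1 (0 - u)) ≤ 2 * d := by
    calc _ ≤ ∑' u : Pt d, jst 1 u := ENNReal.tsum_le_tsum fun u => by
          refine mul_le_of_le_one_right bot_le ?_
          rw [jst]; split_ifs <;> simp
      _ = _ := by rw [tsum_jst, mul_one]
  have h3 : ∀ k : Fin d → ℝ, ((2 * d * (1 - ss k) : ℝ) : ℂ) * ((2 * d * (1 - ss k) : ℝ) : ℂ) =
      ((4 * d ^ 2 * (1 - ss k) ^ 2 : ℝ) : ℂ) := fun k => by push_cast; ring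
  simp only [h3] at h
  rw [integral_complex_ofReal, Complex.ofReal_inj, integral_const_mul] at h
  have h4 : (∑' u : Pt d, jst 1 u * jst 1 (0 - u)).toReal ≤ 2 * d := by
    refine ENNReal.toReal_le_of_le_ofReal (by positivity) (h2.trans (le_of_eq ?_))
    rw [ENNReal.ofReal_mul (by norm_num)]; simp
  have hi : Integrable (fun k : Fin d → ℝ => (1 - ss k) ^ 2) (tor d) := by
    refine Integrable.of_bound (by
      exact (((continuous_const.sub continuous_ss).pow 2)).aestronglyMeasurable) 1
      (.of_forall fun k => ?_)
    rw [Real.norm_of_nonneg (sq_nonneg _), sq_le_one_iff_abs_le_one, abs_le]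
    constructor <;> linarith [ss_nonneg k, ss_le_two k]
  have h5 : ∀ k : Fin d → ℝ, ‖1 - ss k‖ₑ ^ (2 : ℝ) = ENNReal.ofReal ((1 - ss k) ^ 2) := fun k => by
    rw [← sq_abs, ENNReal.ofReal_pow (abs_nonneg _), ← Real.norm_eq_abs, ofReal_norm]
    exact ENNReal.rpow_natCast _ 2
  simp only [h5]
  rw [← ofReal_integral_eq_lintegral_ofReal hi (.of_forall fun k => sq_nonneg _)]
  rw [← ENNReal.ofReal_natCast, ← ENNReal.ofReal_inv_of_pos (by positivity)]
  refine ENNReal.ofReal_le_ofReal ?_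
  have hdp : (0 : ℝ) < d := by exact_mod_cast hd
  rw [inv_eq_one_div, le_div_iff₀ hdp]
  rw [← h] at h4
  nlinarith

/-- Smallness of the basic integral in high dimensions. -/
theorem exists_lintegral_le : ∃ K : ℝ≥0∞, K ≠ ⊤ ∧ ∀ d : ℕ, 800 ≤ d →
    ∫⁻ k, ‖1 - ss k‖ₑ * (ENNReal.ofReal (ss k))⁻¹ ^ 100 ∂tor d ≤
      (d : ℝ≥0∞)⁻¹ ^ (1 / 2 : ℝ) * K := by
  refine ⟨((∫⁻ t, ENNReal.ofReal (uu t) ^ (-(1 / 4) : ℝ) ∂cell) ^ 800) ^ (1 / 2 : ℝ),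
    ENNReal.rpow_ne_top_of_nonneg (by norm_num) (ENNReal.pow_ne_top lintegral_uu_rpow_ne_top),
    fun d hd => ?_⟩
  have hm : Measurable (ss (d := d)) := continuous_ss.measurable
  refine (ENNReal.lintegral_mul_le_Lp_mul_Lq (tor d) Real.HolderConjugate.two_two
    (f := fun k => ‖1 - ss k‖ₑ) (g := fun k => (ENNReal.ofReal (ss k))⁻¹ ^ 100)
    (by fun_prop) (by fun_prop)).trans ?_
  gcongr
  · exact lintegral_one_sub_ss_sq (by omega)
  · refine le_trans (le_of_eq (lintegral_congr fun k => ?_)) (lintegral_ss_inv_pow_le hd)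
    rw [ENNReal.rpow_ofNat, ← pow_mul]

end Torus

end

section

open Ser PowerSeries

section Infrared

open MeasureTheory

variable {d : ℕ}

theorem norm_one_sub_ex_le (n : ℤ) (t : ℝ) : ‖1 - ex n t‖ ≤ n.natAbs * ‖1 - ex 1 t‖ := by
  have hnat : ∀ m : ℕ, ‖1 - ex m t‖ ≤ m * ‖1 - ex 1 t‖ := fun m => by
    induction m with
    | zero => simp [ex_zero]
    | succ m ih =>
      have : (1 : ℂ) - ex ((m + 1 : ℕ) : ℤ) t = (1 - ex m t) + ex m t * (1 - ex 1 t) := by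
        push_cast; rw [ex_add]; ring
      rw [this]
      refine (norm_add_le _ _).trans ?_
      rw [norm_mul, norm_ex]
      push_cast; linarith
  obtain ⟨m, rfl | rfl⟩ := n.eq_nat_or_neg
  · simpa using hnat m
  · have : (1 : ℂ) - ex (-(m : ℤ)) t = -(ex (-(m : ℤ)) t * (1 - ex m t)) := by
      rw [mul_sub, ← ex_add, neg_add_cancel, ex_zero]; ring
    rw [this, norm_neg, norm_mul, norm_ex, one_mul]
    simpa using hnat m

theorem sq_norm_one_sub {c : ℂ} (h : ‖c‖ = 1) : ‖1 - c‖ ^ 2 = 2 * (1 - c.re) := by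
  have h1 : c.re * c.re + c.im * c.im = 1 := by
    rw [← Complex.normSq_apply, Complex.normSq_eq_norm_sq, h, one_pow]
  rw [← Complex.normSq_eq_norm_sq, Complex.normSq_apply]
  simp only [Complex.sub_re, Complex.one_re, Complex.sub_im, Complex.one_im]
  linarith

theorem norm_one_sub_prod_le {ι : Type*} (s : Finset ι) (f : ι → ℂ) (hf : ∀ i, ‖f i‖ = 1) :
    ‖1 - ∏ i ∈ s, f i‖ ≤ ∑ i ∈ s, ‖1 - f i‖ := by
  induction s using Finset.induction_on with
  | empty => simp
  | insert i s hi ih =>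
    rw [Finset.prod_insert hi, Finset.sum_insert hi]
    have : (1 : ℂ) - f i * ∏ j ∈ s, f j = (1 - f i) + f i * (1 - ∏ j ∈ s, f j) := by ring
    rw [this]
    refine (norm_add_le _ _).trans ?_
    rw [norm_mul, hf, one_mul]
    linarith

theorem one_sub_re_chr_le (x : Pt d) (k : Fin d → ℝ) :
    1 - (chr x k).re ≤ dist1 0 x * ∑ j, (x j).natAbs * uu (k j) := by
  have h1 : ‖1 - chr x k‖ ≤ ∑ j, ((x j).natAbs : ℝ) * ‖1 - ex 1 (k j)‖ :=
    (norm_one_sub_prod_le _ _ fun j => norm_ex _ _).trans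
      (Finset.sum_le_sum fun j _ => norm_one_sub_ex_le _ _)
  have h2 : (∑ j, ((x j).natAbs : ℝ) * ‖1 - ex 1 (k j)‖) ^ 2 ≤
      (∑ j, ((x j).natAbs : ℝ)) * ∑ j, ((x j).natAbs : ℝ) * ‖1 - ex 1 (k j)‖ ^ 2 :=
    Finset.sum_sq_le_sum_mul_sum_of_sq_le_mul _ (fun _ _ => by positivity)
      (fun _ _ => by positivity) fun _ _ => le_of_eq (by ring)
  have h3 : ∀ j, ‖1 - ex 1 (k j)‖ ^ 2 = 2 * uu (k j) := fun j => by
    rw [sq_norm_one_sub (norm_ex _ _), re_ex_one, uu]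
  have h4 : (dist1 0 x : ℝ) = ∑ j, ((x j).natAbs : ℝ) := by simp [dist1]
  have h5 := pow_le_pow_left₀ (norm_nonneg _) h1 2
  rw [sq_norm_one_sub (norm_chr x k)] at h5
  simp only [h3] at h2
  have h6 : ∑ j, ((x j).natAbs : ℝ) * (2 * uu (k j)) = 2 * ∑ j, ((x j).natAbs : ℝ) * uu (k j) := by
    rw [Finset.mul_sum]; exact Finset.sum_congr rfl fun _ _ => by ring
  rw [h6] at h2
  rw [h4]
  nlinarith

theorem re_chr_le_one (x : Pt d) (k : Fin d → ℝ) : (chr x k).re ≤ 1 :=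
  (Complex.re_le_norm _).trans (norm_chr x k).le

/-- Second order Taylor bound for the Fourier transform of a symmetric function. -/
theorem tsum_mul_one_sub_re_chr_le {a : Pt d → ℝ≥0∞} (hd : 0 < d)
    (hp : ∀ (σ : Equiv.Perm (Fin d)) (x : Pt d), a (x ∘ σ.symm) = a x) (k : Fin d → ℝ) :
    ∑' x, a x * ENNReal.ofReal (1 - (chr x k).re) ≤
      ENNReal.ofReal (ss k) * ∑' x, a x * (dist1 0 x : ℝ≥0∞) ^ 2 := by
  set c : Fin d → ℝ≥0∞ := fun j => ∑' x : Pt d, a x * (dist1 0 x * (x j).natAbs) with hc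
  have hcc : ∀ i j, c i = c j := fun i j => by
    rw [hc]
    simp only
    rw [← (Equiv.arrowCongr (Equiv.swap i j) (Equiv.refl ℤ)).tsum_eq]
    refine tsum_congr fun x => ?_
    have h1 : (Equiv.arrowCongr (Equiv.swap i j) (Equiv.refl ℤ)) x = x ∘ (Equiv.swap i j).symm := by
      ext; simp
    have h2 : dist1 0 (x ∘ (Equiv.swap i j).symm) = dist1 0 x := by
      rw [← h1]
      exact isLatticeIso_perm (Equiv.swap i j) 0 x
    rw [h1, hp, h2]
    simp
  have hs : (d : ℝ≥0∞) * c ⟨0, hd⟩ = ∑' x, a x * (dist1 0 x : ℝ≥0∞) ^ 2 := by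
    have h1 : (d : ℝ≥0∞) * c ⟨0, hd⟩ = ∑ j, c j := by
      rw [Finset.sum_congr rfl fun j _ => hcc j ⟨0, hd⟩]; simp
    rw [h1, hc, ← Summable.tsum_finsetSum fun _ _ => ENNReal.summable]
    refine tsum_congr fun x => ?_
    rw [← Finset.mul_sum, ← Finset.mul_sum, sq]
    congr 2
    simp [dist1]
  have hd' : (0 : ℝ) < d := by exact_mod_cast hd
  calc _ ≤ ∑' x, a x * ∑ j, ENNReal.ofReal (uu (k j)) * (dist1 0 x * (x j).natAbs) := by
        refine ENNReal.tsum_le_tsum fun x => mul_le_mul_right ?_ _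
        refine (ENNReal.ofReal_le_ofReal (one_sub_re_chr_le x k)).trans (le_of_eq ?_)
        rw [Finset.mul_sum, ENNReal.ofReal_sum_of_nonneg fun j _ => by
          have := uu_nonneg (k j); positivity]
        refine Finset.sum_congr rfl fun j _ => ?_
        rw [ENNReal.ofReal_mul (by positivity), ENNReal.ofReal_mul (by positivity),
          ENNReal.ofReal_natCast, ENNReal.ofReal_natCast]
        ring
    _ = ∑ j, ENNReal.ofReal (uu (k j)) * c j := by
        simp only [Finset.mul_sum]
        rw [Summable.tsum_finsetSum fun _ _ => ENNReal.summable]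
        refine Finset.sum_congr rfl fun j _ => ?_
        rw [← ENNReal.tsum_mul_left]
        exact tsum_congr fun x => by ring
    _ = ENNReal.ofReal (ss k) * (d * c ⟨0, hd⟩) := by
        rw [Finset.sum_congr rfl fun j _ => by rw [hcc j ⟨0, hd⟩], ← Finset.sum_mul,
          ← ENNReal.ofReal_sum_of_nonneg fun j _ => uu_nonneg _, ← mul_assoc,
          ← ENNReal.ofReal_natCast (n := d), ← ENNReal.ofReal_mul (ss_nonneg k), ss,
          div_mul_cancel₀ _ hd'.ne']
    _ = _ := by rw [hs]

theorem abs_re_ft_sub_le {a : Pt d → ℝ≥0∞} (hd : 0 < d) (ha : ∑' x, a x ≠ ⊤)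
    (hp : ∀ (σ : Equiv.Perm (Fin d)) (x : Pt d), a (x ∘ σ.symm) = a x) {m : ℝ} (hm : 0 ≤ m)
    (h2 : ∑' x, a x * (dist1 0 x : ℝ≥0∞) ^ 2 ≤ ENNReal.ofReal m) (k : Fin d → ℝ) :
    |(ft a k).re - (ft a 0).re| ≤ m * ss k := by
  have h1 := (tsum_mul_one_sub_re_chr_le hd hp k).trans (mul_le_mul_right h2 _)
  rw [← ENNReal.ofReal_mul (ss_nonneg k)] at h1
  have h3 : (∑' x, a x * ENNReal.ofReal (1 - (chr x k).re)).toReal =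
      (ft a 0).re - (ft a k).re := by
    rw [toReal_tsum (ne_top_of_le_ne_top ENNReal.ofReal_ne_top h1), ← Complex.sub_re, ft, ft,
      ← (summable_ft ha 0).tsum_sub (summable_ft ha k), Complex.re_tsum
        ((summable_ft ha 0).sub (summable_ft ha k))]
    refine tsum_congr fun x => ?_
    rw [ENNReal.toReal_mul, ENNReal.toReal_ofReal (sub_nonneg.2 (re_chr_le_one x k)),
      chr_zero_right, ← mul_sub, Complex.re_ofReal_mul]
    simp
  have h4 : (ft a 0).re - (ft a k).re ≤ m * ss k := by
    rw [← h3]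
    refine ENNReal.toReal_le_of_le_ofReal (mul_nonneg hm (ss_nonneg k)) (h1.trans (le_of_eq ?_))
    rw [mul_comm]
  rw [abs_sub_comm, abs_of_nonneg (by rw [← h3]; exact ENNReal.toReal_nonneg)]
  exact h4

theorem ev_mul_pow_le {f : Ser} {N : ℕ} (h : ∀ m < N, coeff m f = 0) (j : ℕ) (z : ℝ≥0∞) :
    ev z f * (N : ℝ≥0∞) ^ j ≤ ev z (Wd j f) := by
  rw [ev_apply, ev_apply, ← ENNReal.tsum_mul_right]
  refine ENNReal.tsum_le_tsum fun n => ?_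
  by_cases hn : n < N
  · simp [h n hn]
  · rw [coeff_Wd]
    have : (N : ℝ≥0∞) ≤ (n + 1 : ℕ) := by exact_mod_cast by omega
    calc _ ≤ coeff n f * z ^ n * ((n + 1 : ℕ) : ℝ≥0∞) ^ j := by gcongr
      _ = _ := by push_cast; ring

/-- A bound of infrared type for the solution of a convolution equation. -/
theorem norm_mul_le_of_mul_eq {G ψ : ℂ} {t s ψ₀ m : ℝ} (hs0 : 0 ≤ s) (hs2 : s ≤ 2)
    (h : G * (1 - (t * (1 - s) : ℝ) * ψ) = ψ) (hψ : ‖ψ‖ ≤ 3) (ht0 : 0 ≤ t) (ht : t ≤ 2)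
    (h0 : 0 ≤ ψ₀) (h1 : t * ψ₀ < 1) (hm : |ψ.re - ψ₀| ≤ m * s) (hm2 : m ≤ 1 / 8) :
    ‖G‖ * s ≤ 12 := by
  have hF : s / 4 ≤ ‖1 - ((t * (1 - s) : ℝ) : ℂ) * ψ‖ := by
    refine le_trans ?_ (Complex.re_le_norm _)
    rw [Complex.sub_re, Complex.re_ofReal_mul, Complex.one_re]
    have hms : |ψ.re - ψ₀| ≤ s / 8 := hm.trans (by nlinarith)
    have h3 : |t * (1 - s) * (ψ.re - ψ₀)| ≤ 2 * (s / 8) := by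
      rw [abs_mul, abs_mul, abs_of_nonneg ht0]
      have : |1 - s| ≤ 1 := by rw [abs_le]; constructor <;> linarith
      calc t * |1 - s| * |ψ.re - ψ₀| ≤ 2 * 1 * (s / 8) := by gcongr
        _ = _ := by ring
    have h4 := (abs_le.1 h3).2
    have h5 : s / 2 ≤ 1 - t * ψ₀ * (1 - s) := by
      have : 0 ≤ t * ψ₀ := mul_nonneg ht0 h0
      rcases le_total s 1 with hs | hs
      · nlinarith
      · nlinarith
    nlinarith
  have h6 := congrArg (‖·‖) h
  simp only [norm_mul] at h6
  have : ‖G‖ * (s / 4) ≤ 3 := (mul_le_mul_of_nonneg_left hF (norm_nonneg _)).trans (h6.le.trans hψ)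
  linarith

end Infrared

end

section

open Ser PowerSeries

section Susceptibility

open MeasureTheory

variable {d : ℕ}

theorem ev_J (z : ℝ≥0∞) (x : Pt d) : ev z (J 0 x) = jst z x := by
  unfold J jst; split_ifs <;> simp

theorem ev_mul_translation {A B : Pt d → Pt d → Ser} (hB : ∀ a x y, B (a + x) (a + y) = B x y)
    (z : ℝ≥0∞) (x : Pt d) :
    ev z (kmul A B 0 x) = ∑' u, ev z (A 0 u) * ev z (B 0 (x - u)) := by
  rw [kmul, ev_psum]
  refine tsum_congr fun u => ?_
  rw [map_mul]
  congr 2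
  simpa using hB u 0 (x - u)

/-- The susceptibility as a power series. -/
def Ch (w : List (Pt d) → ℝ≥0∞) : Ser := psum fun x => GS w ∅ 0 x

variable {w : List (Pt d) → ℝ≥0∞} {z : ℝ≥0∞} (htr : ∀ a x y, GS w ∅ (a + x) (a + y) = GS w ∅ x y)

theorem psum_J : (psum fun x : Pt d => J 0 x) = C (2 * d : ℝ≥0∞) * X := by
  ext n
  rw [coeff_psum, coeff_C_mul, coeff_X]
  have : ∀ x : Pt d, coeff n (J 0 x) = if Adj 0 x then (if n = 1 then 1 else 0 : ℝ≥0∞) else 0 :=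
    fun x => by unfold J; split_ifs <;> simp_all [coeff_X]
  simp only [this]
  rw [tsum_adj 0 fun _ => (if n = 1 then 1 else 0 : ℝ≥0∞)]
  simp [mul_comm]

theorem psum_kmul {A B : Pt d → Pt d → Ser} (hB : ∀ a x y, B (a + x) (a + y) = B x y) :
    (psum fun x => kmul A B 0 x) = (psum fun u => A 0 u) * psum fun x => B 0 x := by
  simp only [kmul]
  rw [psum_comm, psum_mul]
  congr 1; funext u
  rw [← mul_psum, ← psum_equiv (Equiv.addLeft u)]
  congr 2; funext x
  simpa using hB u 0 x

include htr

theorem Ut_translation (a x y : Pt d) : Ut w (a + x) (a + y) = Ut w x y := by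
  rw [Ut, Ut, kmul_translation J_translation htr]; simp

theorem psum_Ut : (psum fun x => Ut w 0 x) = 1 + C (2 * d : ℝ≥0∞) * X * Ch w := by
  simp only [Ut, psum_add]
  rw [psum_kmul htr, psum_J, Ch]
  congr 1
  rw [psum_single _ 0 fun x hx => if_neg hx.symm, if_pos rfl]

theorem psum_Pl_mul_Ut (b : Bool) : (psum fun x => psum fun v => Pl w b v * Ut w v x) =
    (psum fun v => Pl w b v) * (1 + C (2 * d : ℝ≥0∞) * X * Ch w) := by
  rw [← psum_Ut htr]
  have := psum_kmul (A := fun _ v => Pl w b v) (Ut_translation htr)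
  simpa [kmul] using this

/-- The lace expansion summed over the endpoint. -/
theorem lace_sum :
    Ch w + (psum fun v => Pl w true v) * (1 + C (2 * d : ℝ≥0∞) * X * Ch w) =
      (gS w ∅ 0 + psum fun v => Pl w false v) * (1 + C (2 * d : ℝ≥0∞) * X * Ch w) := by
  rw [add_mul, ← psum_Pl_mul_Ut htr, ← psum_Pl_mul_Ut htr, ← psum_Ut htr, mul_psum, Ch,
    ← psum_add, ← psum_add]
  congr 1; funext x
  exact lace_convolution w x

omit htr in
/-- Fourier transform of a convolution, with evaluation at an activity. -/
theorem ft_kmul {A B : Pt d → Pt d → Ser} (hB : ∀ a x y, B (a + x) (a + y) = B x y)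
    (ha : ∑' x, ev z (A 0 x) ≠ ⊤) (hb : ∑' x, ev z (B 0 x) ≠ ⊤) (k : Fin d → ℝ) :
    ft (fun x => ev z (kmul A B 0 x)) k =
      ft (fun x => ev z (A 0 x)) k * ft (fun x => ev z (B 0 x)) k := by
  simp only [ev_mul_translation hB]
  exact ft_conv ha hb k

omit htr in
theorem tsum_kmul {A B : Pt d → Pt d → Ser} (hB : ∀ a x y, B (a + x) (a + y) = B x y) :
    ∑' x, ev z (kmul A B 0 x) = (∑' x, ev z (A 0 x)) * ∑' x, ev z (B 0 x) := by
  simp only [ev_mul_translation hB]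
  exact tsum_conv (a := fun u => ev z (A 0 u)) (b := fun u => ev z (B 0 u))

theorem tsum_kpow (n : ℕ) :
    ∑' x, ev z (kpow (GS w ∅) n 0 x) = (∑' x, ev z (GS w ∅ 0 x)) ^ n := by
  induction n with
  | zero =>
    rw [pow_zero, tsum_eq_single 0]
    · simp [kpow]
    · intro x hx; simp [kpow, hx.symm]
  | succ n ih => rw [pow_succ', ← ih, ← tsum_kmul (kpow_translation htr n)]; rfl

theorem ft_kpow (hχ : ∑' x, ev z (GS w ∅ 0 x) ≠ ⊤) (n : ℕ) (k : Fin d → ℝ) :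
    ft (fun x => ev z (kpow (GS w ∅) n 0 x)) k = ft (fun x => ev z (GS w ∅ 0 x)) k ^ n := by
  induction n with
  | zero =>
    rw [pow_zero, ← ft_delta k]
    congr 1; funext x
    simp only [kpow]; split_ifs <;> simp
  | succ n ih =>
    rw [pow_succ', ← ih, ← ft_kmul (kpow_translation htr n) hχ]
    · rfl
    · rw [tsum_kpow htr]; exact ENNReal.pow_ne_top hχ

theorem ft_Ut (hχ : ∑' x, ev z (GS w ∅ 0 x) ≠ ⊤) (hz : z ≠ ⊤) (k : Fin d → ℝ) :
    ft (fun x => ev z (Ut w 0 x)) k = 1 + ft (jst z) k * ft (fun x => ev z (GS w ∅ 0 x)) k := by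
  have hj : ∑' x : Pt d, ev z (J 0 x) ≠ ⊤ := by
    simp only [ev_J, tsum_jst]; finiteness
  have h1 := ft_kmul htr hj hχ k
  have h2 : ∑' x : Pt d, (if (0 : Pt d) = x then 1 else 0 : ℝ≥0∞) ≠ ⊤ := by
    rw [tsum_eq_single 0 fun x hx => if_neg hx.symm]; simp
  have h3 : ∑' x : Pt d, ev z (kmul J (GS w ∅) 0 x) ≠ ⊤ := by
    rw [tsum_kmul htr]; exact ENNReal.mul_ne_top hj hχ
  simp only [ev_J] at h1
  rw [← ft_delta k, ← h1, ← ft_add h2 h3]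
  congr 1; funext x
  rw [Ut, map_add]
  congr 1; split_ifs <;> simp

theorem tsum_Ut_ne_top (hχ : ∑' x, ev z (GS w ∅ 0 x) ≠ ⊤) (hz : z ≠ ⊤) :
    ∑' x, ev z (Ut w 0 x) ≠ ⊤ := by
  rw [← ev_psum, psum_Ut htr, map_add, map_mul, map_mul, map_one, ev_C, ev_X, Ch, ev_psum]
  finiteness

/-- The lace expansion in Fourier space. -/
theorem ft_lace (hχ : ∑' x, ev z (GS w ∅ 0 x) ≠ ⊤) (hz : z ≠ ⊤) (hg : ev z (gS w ∅ 0) ≠ ⊤)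
    (hP : ∀ b, ∑' v, ev z (Pl w b v) ≠ ⊤) (k : Fin d → ℝ) {ψ : ℂ}
    (hψ : ψ = (ev z (gS w ∅ 0)).toReal + ft (fun v => ev z (Pl w false v)) k -
      ft (fun v => ev z (Pl w true v)) k) :
    ft (fun x => ev z (GS w ∅ 0 x)) k * (1 - ft (jst z) k * ψ) = ψ := by
  have hU := tsum_Ut_ne_top htr hχ hz
  have hPU : ∀ b, ∑' x, ∑' v, ev z (Pl w b v) * ev z (Ut w 0 (x - v)) ≠ ⊤ := fun b => by
    rw [tsum_conv (a := fun v => ev z (Pl w b v)) (b := fun v => ev z (Ut w 0 v))]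
    exact ENNReal.mul_ne_top (hP b) hU
  have hgU : ∑' x, ev z (gS w ∅ 0) * ev z (Ut w 0 x) ≠ ⊤ := by
    rw [ENNReal.tsum_mul_left]; exact ENNReal.mul_ne_top hg hU
  have key : ∀ x, ev z (GS w ∅ 0 x) + ∑' v, ev z (Pl w true v) * ev z (Ut w 0 (x - v)) =
      ev z (gS w ∅ 0) * ev z (Ut w 0 x) + ∑' v, ev z (Pl w false v) * ev z (Ut w 0 (x - v)) :=
    fun x => by
      have := congrArg (ev z) (lace_convolution w x)
      simp only [map_add, map_mul, ev_psum] at this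
      convert this using 5 <;>
      · have := Ut_translation htr ‹Pt d› 0 (x - ‹Pt d›)
        rw [add_zero, add_sub_cancel] at this
        rw [this]
  have h1 := congrArg (fun f => ft f k) (funext key)
  rw [ft_add hχ (hPU true), ft_add hgU (hPU false), ft_const_mul,
    ft_conv (hP true) hU, ft_conv (hP false) hU, ft_Ut htr hχ hz] at h1
  rw [hψ]
  linear_combination h1

/-- The infrared bound. -/
theorem norm_ft_mul_ss_le (hd : 0 < d) (hχ : ∑' x, ev z (GS w ∅ 0 x) ≠ ⊤) (hz : z ≠ ⊤)
    (hg : ev z (gS w ∅ 0) ≤ 2) (hP : ∀ b, ∑' v, ev z (Pl w b v) ≤ 8⁻¹)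
    (hP2 : ∀ b, ∑' v, ev z (Pl w b v) * (dist1 0 v : ℝ≥0∞) ^ 2 ≤ 16⁻¹)
    (hp : ∀ (σ : Equiv.Perm (Fin d)) b v, Pl w b (v ∘ σ.symm) = Pl w b v) :
    z.toReal * d ≤ 1 ∧ ∀ k, ‖ft (fun x => ev z (GS w ∅ 0 x)) k‖ * ss k ≤ 12 := by
  have hgt : ev z (gS w ∅ 0) ≠ ⊤ := ne_top_of_le_ne_top (by simp) hg
  have hPt : ∀ b, ∑' v, ev z (Pl w b v) ≠ ⊤ := fun b => ne_top_of_le_ne_top (by simp) (hP b)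
  have hg1 : 1 ≤ (ev z (gS w ∅ 0)).toReal := by
    have : (1 : ℝ≥0∞) ≤ ev z (gS w ∅ 0) := by
      simpa using ev_mono z (one_le_gS w (S := ∅) (v := 0) (by simp))
    simpa using ENNReal.toReal_mono hgt this
  have hg2 : (ev z (gS w ∅ 0)).toReal ≤ 2 := by simpa using ENNReal.toReal_mono (by simp) hg
  have hPr : ∀ b, (∑' v, ev z (Pl w b v)).toReal ≤ 1 / 8 := fun b => by
    simpa using ENNReal.toReal_mono (by simp) (hP b)
  have hPn : ∀ b k, ‖ft (fun v => ev z (Pl w b v)) k‖ ≤ 1 / 8 := fun b k =>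
    (norm_ft_le (hPt b) k).trans (hPr b)
  set g := (ev z (gS w ∅ 0)).toReal
  set P : Bool → (Fin d → ℝ) → ℂ := fun b k => ft (fun v => ev z (Pl w b v)) k
  set G : (Fin d → ℝ) → ℂ := fun k => ft (fun x => ev z (GS w ∅ 0 x)) k
  have hlace : ∀ k, G k * (1 - ft (jst z) k * (g + P false k - P true k)) =
      g + P false k - P true k := fun k => ft_lace htr hχ hz hgt hPt k rfl
  set t := 2 * z.toReal * d with ht
  have ht0 : 0 ≤ t := by positivity
  have hP0 : ∀ b, ((P b 0).re : ℂ) = P b 0 ∧ 0 ≤ (P b 0).re ∧ (P b 0).re ≤ 1 / 8 := fun b => by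
    have : P b 0 = ((∑' v, ev z (Pl w b v)).toReal : ℝ) := ft_zero_right (hPt b)
    rw [this, Complex.ofReal_re]
    exact ⟨rfl, ENNReal.toReal_nonneg, hPr b⟩
  set ψ₀ := g + (P false 0).re - (P true 0).re with hψ₀
  have hψ₀' : 1 / 2 ≤ ψ₀ := by linarith [(hP0 false).2.1, (hP0 true).2.2]
  have hss0 : ss (0 : Fin d → ℝ) = 0 := by simp [ss, uu]
  have h1 : t * ψ₀ < 1 := by
    have h := hlace 0
    have hG0 : G 0 = ((∑' x, ev z (GS w ∅ 0 x)).toReal : ℝ) := ft_zero_right hχ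
    rw [ft_jst hd, hss0, ← (hP0 false).1, ← (hP0 true).1, hG0, sub_zero, mul_one] at h
    have h' : (∑' x, ev z (GS w ∅ 0 x)).toReal * (1 - t * ψ₀) = ψ₀ := by exact_mod_cast h
    by_contra hc
    have := mul_nonpos_of_nonneg_of_nonpos
      (ENNReal.toReal_nonneg (a := ∑' x, ev z (GS w ∅ 0 x))) (by linarith : 1 - t * ψ₀ ≤ 0)
    linarith
  have ht2 : t ≤ 2 := by nlinarith
  refine ⟨by linarith, fun k => ?_⟩
  have hm : ∀ b, |(P b k).re - (P b 0).re| ≤ 1 / 16 * ss k := fun b =>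
    abs_re_ft_sub_le hd (hPt b) (fun σ x => by rw [hp σ b x]) (by norm_num)
      ((hP2 b).trans (le_of_eq (by
        rw [one_div, ENNReal.ofReal_inv_of_pos (by norm_num)]; norm_num))) k
  refine norm_mul_le_of_mul_eq (ψ := g + P false k - P true k) (t := t) (ψ₀ := ψ₀) (m := 1 / 8)
    (ss_nonneg k) (ss_le_two k) ?_ ?_ ht0 ht2 (by linarith) h1 ?_ le_rfl
  · rw [← ft_jst hd]; exact hlace k
  · refine (norm_sub_le _ _).trans ?_
    have := norm_add_le (g : ℂ) (P false k)
    have h3 : ‖(g : ℂ)‖ = g := by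
      rw [Complex.norm_real, Real.norm_of_nonneg (by linarith)]
    linarith [hPn false k, hPn true k]
  · have h3 : ((g : ℂ) + P false k - P true k).re - ψ₀ =
        ((P false k).re - (P false 0).re) - ((P true k).re - (P true 0).re) := by
      rw [hψ₀]; simp; ring
    rw [h3]
    refine (abs_sub _ _).trans ?_
    linarith [hm false, hm true]

/-- The bound for the basic convolution in terms of the simple random walk integral. -/
theorem ev_kmul_J_kpow_le (hd : 0 < d) (hχ : ∑' x, ev z (GS w ∅ 0 x) ≠ ⊤) (hz : z ≠ ⊤)
    (hzd : z.toReal * d ≤ 1) (hG : ∀ k, ‖ft (fun x => ev z (GS w ∅ 0 x)) k‖ * ss k ≤ 12) (n : ℕ)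
    (x y : Pt d) : ev z (kmul J (kpow (GS w ∅) n) x y) ≤
      2 * 12 ^ n * ∫⁻ k, ‖1 - ss k‖ₑ * (ENNReal.ofReal (ss k))⁻¹ ^ n ∂tor d := by
  have hk := kmul_translation J_translation (kpow_translation htr n) x 0 (y - x)
  rw [add_zero, add_sub_cancel] at hk
  have hj : ∑' x : Pt d, ev z (J 0 x) ≠ ⊤ := by
    simp only [ev_J, tsum_jst]; finiteness
  have hp : ∑' x, ev z (kpow (GS w ∅) n 0 x) ≠ ⊤ := by
    rw [tsum_kpow htr]; exact ENNReal.pow_ne_top hχ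
  rw [hk]
  refine (le_lintegral_ft (a := fun x => ev z (kmul J (kpow (GS w ∅) n) 0 x)) ?_ _).trans ?_
  · rw [tsum_kmul (kpow_translation htr n)]; exact ENNReal.mul_ne_top hj hp
  rw [← lintegral_const_mul' _ _ (by finiteness)]
  refine lintegral_mono fun k => ?_
  have h12 : ‖ft (fun x => ev z (GS w ∅ 0 x)) k‖ₑ ≤ 12 * (ENNReal.ofReal (ss k))⁻¹ := by
    rw [← div_eq_mul_inv]
    rcases (ss_nonneg k).eq_or_lt with h | h
    · rw [← h, ENNReal.ofReal_zero, ENNReal.div_zero (by norm_num)]; exact le_top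
    · rw [ENNReal.le_div_iff_mul_le (.inl (by simpa using h)) (.inl ENNReal.ofReal_ne_top),
        ← ofReal_norm, ← ENNReal.ofReal_mul (norm_nonneg _)]
      exact (ENNReal.ofReal_le_ofReal (hG k)).trans (by simp)
  have hJ : ‖ft (jst z) k‖ₑ ≤ 2 * ‖1 - ss k‖ₑ := by
    rw [ft_jst hd, ← ofReal_norm, ← ofReal_norm, Complex.norm_real, norm_mul,
      Real.norm_of_nonneg (by positivity), show (2 : ℝ≥0∞) = ENNReal.ofReal 2 by simp,
      ← ENNReal.ofReal_mul (by norm_num)]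
    refine ENNReal.ofReal_le_ofReal ?_
    gcongr
    linarith
  rw [ft_kmul (kpow_translation htr n) hj hp, ft_kpow htr hχ]
  simp only [ev_J]
  rw [enorm_mul, enorm_pow]
  calc _ ≤ 2 * ‖1 - ss k‖ₑ * (12 * (ENNReal.ofReal (ss k))⁻¹) ^ n := by gcongr
    _ = _ := by rw [mul_pow]; ring

end Susceptibility

end

namespace Ser

open PowerSeries

/-- Increments of evaluations are monotone in the series. -/
theorem ev_add_ev_le {p r : Ser} (h : p ≤ r) {s t : ℝ≥0∞} (hst : s ≤ t) :
    ev t p + ev s r ≤ ev s p + ev t r := by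
  rw [← add_sub_of_le h, map_add, map_add]
  have := ev_mono_left hst (sub r p)
  calc _ = ev t p + ev s p + ev s (sub r p) := by ring
    _ ≤ ev t p + ev s p + ev t (sub r p) := by gcongr
    _ = _ := by ring

theorem toReal_ev {f : Ser} {t : ℝ} (ht : 0 ≤ t) (h : ev (ENNReal.ofReal t) f ≠ ⊤) :
    (ev (ENNReal.ofReal t) f).toReal = ∑' n, (coeff n f).toReal * t ^ n := by
  rw [ev_apply, ENNReal.tsum_toReal_eq (ENNReal.ne_top_of_tsum_ne_top (by rwa [ev_apply] at h))]
  refine tsum_congr fun n => ?_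
  rw [ENNReal.toReal_mul, ENNReal.toReal_pow, ENNReal.toReal_ofReal ht]

theorem summable_of_ev_ne_top {f : Ser} {t : ℝ} (ht : 0 ≤ t) (h : ev (ENNReal.ofReal t) f ≠ ⊤) :
    Summable fun n => (coeff n f).toReal * t ^ n := by
  have := ENNReal.summable_toReal (by rwa [ev_apply] at h)
  refine this.congr fun n => ?_
  rw [ENNReal.toReal_mul, ENNReal.toReal_pow, ENNReal.toReal_ofReal ht]

theorem ev_ofReal_ne_top {f : Ser} {s t : ℝ} (hst : s ≤ t) (h : ev (ENNReal.ofReal t) f ≠ ⊤) :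
    ev (ENNReal.ofReal s) f ≠ ⊤ :=
  ne_top_of_le_ne_top h (ev_mono_left (ENNReal.ofReal_le_ofReal hst) f)

theorem continuousOn_ev {f : Ser} {z : ℝ} (h : ev (ENNReal.ofReal z) f ≠ ⊤) :
    ContinuousOn (fun t : ℝ => (ev (ENNReal.ofReal t) f).toReal) (Set.Icc 0 z) := by
  rcases lt_or_ge z 0 with hz | hz
  · simp [Set.Icc_eq_empty_of_lt hz]
  refine ContinuousOn.congr (f := fun t : ℝ => ∑' n, (coeff n f).toReal * t ^ n) ?_
    fun t ht => toReal_ev ht.1 (ev_ofReal_ne_top ht.2 h)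
  refine continuousOn_tsum (fun n => by fun_prop) (summable_of_ev_ne_top hz h) fun n t ht => ?_
  rw [Real.norm_of_nonneg (mul_nonneg ENNReal.toReal_nonneg (pow_nonneg ht.1 _))]
  have := ht.1
  gcongr
  exact ht.2

/-- A function that cannot take values in `(a, b]` and starts below stays below. -/
theorem le_of_forbidden {F : ℝ → ℝ} {x y a b : ℝ} (hxy : x ≤ y) (hF : ContinuousOn F (Set.Icc x y))
    (hab : a < b) (hx : F x ≤ a) (h : ∀ t ∈ Set.Icc x y, F t ≤ b → F t ≤ a) : F y ≤ a := by
  by_contra hc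
  have hb : b < F y := lt_of_not_ge fun hb => hc (h y ⟨hxy, le_rfl⟩ hb)
  obtain ⟨t, ht, hFt⟩ := intermediate_value_Icc hxy hF ⟨by linarith, hb.le⟩
  linarith [h t ht hFt.le]

/-- A supremum of series with a common majorant that is finite up to `z` obeys a bootstrap
principle. -/
theorem iSup_ev_le_of_bootstrap {ι : Type*} {f : ι → Ser} {H : Ser} (hf : ∀ i, f i ≤ H)
    (hH0 : coeff 0 H = 0) {z : ℝ} (hz : 0 ≤ z) (hH : ev (ENNReal.ofReal z) H ≠ ⊤) {a b : ℝ≥0∞}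
    (hab : a < b) (hb : b ≠ ⊤)
    (h : ∀ t, 0 ≤ t → t ≤ z → (∀ i, ev (ENNReal.ofReal t) (f i) ≤ b) →
      ∀ i, ev (ENNReal.ofReal t) (f i) ≤ a) (i : ι) : ev (ENNReal.ofReal z) (f i) ≤ a := by
  have : Nonempty ι := ⟨i⟩
  set Q : ℝ → ℝ≥0∞ := fun t => ⨆ i, ev (ENNReal.ofReal t) (f i) with hQ
  have hQH : ∀ t, Q t ≤ ev (ENNReal.ofReal t) H := fun t => iSup_le fun i => ev_mono _ (hf i)
  have hHt : ∀ t, t ≤ z → ev (ENNReal.ofReal t) H ≠ ⊤ := fun t ht => ev_ofReal_ne_top ht hH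
  have hQt : ∀ t, t ≤ z → Q t ≠ ⊤ := fun t ht => ne_top_of_le_ne_top (hHt t ht) (hQH t)
  have hat : a ≠ ⊤ := (hab.trans_le le_top).ne
  have hmono : ∀ s t, s ≤ t → t ≤ z → |(Q t).toReal - (Q s).toReal| ≤
      (ev (ENNReal.ofReal t) H).toReal - (ev (ENNReal.ofReal s) H).toReal := fun s t hst ht => by
    have hst' := ENNReal.ofReal_le_ofReal hst
    have h1 : Q s ≤ Q t := iSup_mono fun i => ev_mono_left hst' _
    have h2 : Q t + ev (ENNReal.ofReal s) H ≤ Q s + ev (ENNReal.ofReal t) H := by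
      rw [hQ]; simp only
      rw [ENNReal.iSup_add]
      refine iSup_le fun i => (ev_add_ev_le (hf i) hst').trans ?_
      gcongr
      exact le_iSup (fun i => ev (ENNReal.ofReal s) (f i)) i
    have h1' := ENNReal.toReal_mono (hQt t ht) h1
    have h2' := ENNReal.toReal_mono
      (ENNReal.add_ne_top.2 ⟨hQt s (hst.trans ht), hHt t ht⟩) h2
    rw [ENNReal.toReal_add (hQt t ht) (hHt s (hst.trans ht)),
      ENNReal.toReal_add (hQt s (hst.trans ht)) (hHt t ht)] at h2'
    rw [abs_of_nonneg (by linarith)]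
    linarith
  have hcont : ContinuousOn (fun t => (Q t).toReal) (Set.Icc 0 z) := by
    have hc := continuousOn_ev hH
    rw [Metric.continuousOn_iff] at hc ⊢
    intro x hx ε hε
    obtain ⟨δ, hδ, hd⟩ := hc x hx ε hε
    refine ⟨δ, hδ, fun y hy hyx => lt_of_le_of_lt ?_ (hd y hy hyx)⟩
    rw [Real.dist_eq, Real.dist_eq]
    rcases le_total x y with hxy | hxy
    · exact (hmono x y hxy hy.2).trans (le_abs_self _)
    · rw [abs_sub_comm, abs_sub_comm (ev _ H).toReal]
      exact (hmono y x hxy hx.2).trans (le_abs_self _)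
  have hQ0 : Q 0 = 0 := by
    refine le_antisymm ((hQH 0).trans (le_of_eq ?_)) bot_le
    rw [ENNReal.ofReal_zero, ev_apply, tsum_eq_single 0 fun n hn => by simp [hn]]
    simp [hH0]
  have key := le_of_forbidden (a := a.toReal) (b := b.toReal) hz hcont
    ((ENNReal.toReal_lt_toReal hat hb).2 hab) (by simp [hQ0]) fun t ht hb' => by
      rw [ENNReal.toReal_le_toReal (hQt t ht.2) hb] at hb'
      rw [ENNReal.toReal_le_toReal (hQt t ht.2) hat]
      exact iSup_le (h t ht.1 ht.2 fun i => (le_iSup (fun i => ev _ (f i)) i).trans hb')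
  rw [ENNReal.toReal_le_toReal (hQt z le_rfl) hat] at key
  exact (le_iSup (fun i => ev _ (f i)) i).trans key

/-- Truncation of a power series. -/
def tr (N : ℕ) (f : Ser) : Ser := mk fun n => if n < N then coeff n f else 0

theorem coeff_tr (N n : ℕ) (f : Ser) : coeff n (tr N f) = if n < N then coeff n f else 0 := by
  simp [tr]

theorem tr_le (N : ℕ) (f : Ser) : tr N f ≤ f := fun n => by
  rw [coeff_tr]; split_ifs <;> simp

theorem tr_mono (N : ℕ) {f g : Ser} (h : f ≤ g) : tr N f ≤ tr N g := fun n => by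
  rw [coeff_tr, coeff_tr]; split_ifs
  · exact h n
  · exact le_rfl

theorem tr_mul_le (N : ℕ) (f g : Ser) : tr N (f * g) ≤ tr N f * tr N g := fun n => by
  rw [coeff_tr]; split_ifs with hn
  · rw [PowerSeries.coeff_mul, PowerSeries.coeff_mul]
    refine le_of_eq (Finset.sum_congr rfl fun i hi => ?_)
    have := Finset.HasAntidiagonal.mem_antidiagonal.1 hi
    rw [coeff_tr, coeff_tr, if_pos (by omega), if_pos (by omega)]
  · exact bot_le

theorem tr_geom_le (N : ℕ) (b : Ser) : tr N (geom b) ≤ geom (tr N b) := fun n => by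
  rw [coeff_tr]; split_ifs with hn
  · rw [geom, geom, coeff_psum, coeff_psum]
    refine ENNReal.tsum_le_tsum fun k => ?_
    have : tr N (b ^ k) ≤ tr N b ^ k := by
      induction k with
      | zero => simpa using tr_le N 1
      | succ k ih => rw [pow_succ, pow_succ]; exact (tr_mul_le _ _ _).trans (mul_le_mul' ih le_rfl)
    have h := this n
    rwa [coeff_tr, if_pos hn] at h
  · exact bot_le

theorem ev_tr_ne_top (N : ℕ) {f : Ser} (hf : FinC f) {z : ℝ≥0∞} (hz : z ≠ ⊤) :
    ev z (tr N f) ≠ ⊤ := by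
  rw [ev_apply, tsum_eq_sum (s := Finset.range N)]
  · refine ENNReal.sum_ne_top.2 fun n _ => ENNReal.mul_ne_top ?_ (ENNReal.pow_ne_top hz)
    exact ne_top_of_le_ne_top (hf n) (tr_le N f n)
  · intro n hn
    rw [coeff_tr, if_neg (by simpa using hn), zero_mul]

theorem ev_le_of_tr_le {f : Ser} {z B : ℝ≥0∞} (h : ∀ N, ev z (tr N f) ≤ B) : ev z f ≤ B := by
  rw [ev_apply]
  refine ENNReal.tsum_le_of_sum_range_le fun N => le_trans ?_ (h N)
  rw [ev_apply]
  refine le_trans (le_of_eq (Finset.sum_congr rfl fun n hn => ?_))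
    (ENNReal.sum_le_tsum (Finset.range N))
  rw [coeff_tr, if_pos (Finset.mem_range.1 hn)]

theorem Nd_tr (N : ℕ) (f : Ser) : Nd (tr N f) = tr N (Nd f) := by
  ext n; simp only [coeff_Nd, coeff_tr]; split_ifs <;> simp

theorem ev_le_add_ev_Nd (f : Ser) {z t : ℝ} (hz : 0 < z) (hzt : z ≤ t) :
    ev (ENNReal.ofReal t) f ≤ ev (ENNReal.ofReal z) f +
      ENNReal.ofReal ((t - z) / z) * ev (ENNReal.ofReal t) (Nd f) := by
  simp only [ev_apply, ← ENNReal.tsum_mul_left]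
  rw [← ENNReal.tsum_add]
  refine ENNReal.tsum_le_tsum fun n => ?_
  have ht : 0 < t := hz.trans_le hzt
  have h1 : t ^ n ≤ z ^ n + (t - z) / z * (n * t ^ n) := by
    have h2 := one_add_mul_le_pow (a := z / t - 1) (by
      have : 0 ≤ z / t := by positivity
      linarith) n
    have h3 : (1 + (z / t - 1)) ^ n * t ^ n = z ^ n := by
      rw [← mul_pow]; congr 1; field_simp; ring
    have h4 := mul_le_mul_of_nonneg_right h2 (pow_nonneg ht.le n)
    rw [h3] at h4
    have h5 : (t - z) / t ≤ (t - z) / z := div_le_div_of_nonneg_left (by linarith) hz hzt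
    have h6 : z / t - 1 = -((t - z) / t) := by field_simp; ring
    rw [h6] at h4
    have h7 : (t - z) / t * (n * t ^ n) ≤ (t - z) / z * (n * t ^ n) := by gcongr
    nlinarith
  have h2 := ENNReal.ofReal_le_ofReal h1
  have h0 : 0 ≤ (t - z) / z := div_nonneg (by linarith) hz.le
  rw [ENNReal.ofReal_add (by positivity) (by positivity), ENNReal.ofReal_mul h0,
    ENNReal.ofReal_mul (by positivity), ENNReal.ofReal_pow ht.le, ENNReal.ofReal_pow hz.le,
    ENNReal.ofReal_natCast] at h2
  simp only [coeff_Nd]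
  calc _ ≤ coeff n f * _ := mul_le_mul_right h2 _
    _ = _ := by ring

/-- A differential inequality forces the series to be finite slightly beyond any point at which it
is finite and the auxiliary series is small. -/
theorem exists_gt_ev_ne_top {f p : Ser} {M : ℝ≥0∞} {a : ℝ} (ha : 0 ≤ a) (hf : FinC f)
    (hM : M ≠ ⊤) (hM1 : 1 ≤ M) (hp : p ≤ C (ENNReal.ofReal a) * X ^ 2 * f ^ 2)
    (hN : Nd f ≤ geom (2 * C M * geom (C M * p) * p) * f ^ 2) {z : ℝ} (hz : 0 < z)
    (hχ : ev (ENNReal.ofReal z) f ≠ ⊤) (hs : M * ev (ENNReal.ofReal z) p ≤ 32⁻¹) :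
    ∃ t > z, ev (ENNReal.ofReal t) f ≠ ⊤ := by
  set V := (ev (ENNReal.ofReal z) f).toReal with hV
  have hV0 : 0 ≤ V := ENNReal.toReal_nonneg
  set q := (32 * M.toReal)⁻¹ with hq
  have hMr : 1 ≤ M.toReal := by simpa using ENNReal.toReal_mono hM hM1
  have hMq : M * ENNReal.ofReal q = 32⁻¹ := by
    rw [← ENNReal.ofReal_toReal hM, ← ENNReal.ofReal_mul (by linarith), hq, mul_inv, mul_comm,
      mul_assoc, inv_mul_cancel₀ (by linarith), mul_one, ENNReal.ofReal_inv_of_pos (by norm_num)]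
    norm_num
  have hq0 : 0 < q := by positivity
  obtain ⟨δ, hδ0, hδ⟩ := exists_pos_mul_lt (half_pos hq0) (a * z ^ 2 * (2 * V + 1))
  set δ' := min δ 1 with hδ'
  have hδ'0 : 0 < δ' := lt_min hδ0 one_pos
  have hδ'1 : δ' ≤ 1 := min_le_right _ _
  obtain ⟨τ₁, hτ₁, hτ₁'⟩ := exists_pos_mul_lt (half_pos hq0) (a * (2 * z + 1) * (V + 1) ^ 2)
  obtain ⟨τ₂, hτ₂, hτ₂'⟩ := exists_pos_mul_lt (half_pos hδ'0) (2 * (V + 1) ^ 2 / z)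
  set τ := min (min τ₁ τ₂) 1 with hτ
  have hτ0 : 0 < τ := lt_min (lt_min hτ₁ hτ₂) one_pos
  have hτ1 : τ ≤ 1 := min_le_right _ _
  have hττ₁ : τ ≤ τ₁ := (min_le_left _ _).trans (min_le_left _ _)
  have hττ₂ : τ ≤ τ₂ := (min_le_left _ _).trans (min_le_right _ _)
  have main : ∀ N, (ev (ENNReal.ofReal (z + τ)) (tr N f)).toReal -
      (ev (ENNReal.ofReal z) (tr N f)).toReal ≤ δ' / 2 := fun N => by
    set u : ℝ → ℝ := fun t => (ev (ENNReal.ofReal t) (tr N f)).toReal with hu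
    have hfin : ∀ t, ev (ENNReal.ofReal t) (tr N f) ≠ ⊤ := fun t =>
      ev_tr_ne_top N hf ENNReal.ofReal_ne_top
    have huV : u z ≤ V := ENNReal.toReal_mono hχ (ev_mono _ (tr_le N f))
    have hu0 : ∀ t, 0 ≤ u t := fun t => ENNReal.toReal_nonneg
    have hof : ∀ t, ENNReal.ofReal (u t) = ev (ENNReal.ofReal t) (tr N f) := fun t =>
      ENNReal.ofReal_toReal (hfin t)
    refine le_of_forbidden (F := fun t => u t - u z) (x := z) (y := z + τ) (a := δ' / 2) (b := δ')
      (by linarith) ?_ (by linarith) (by simpa using by linarith) fun t ht htb => ?_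
    · refine ContinuousOn.sub ?_ continuousOn_const
      exact (continuousOn_ev (hfin (z + τ))).mono (Set.Icc_subset_Icc hz.le le_rfl)
    have htz : 0 ≤ t := hz.le.trans ht.1
    have hut : u t ≤ u z + δ' := by simpa [add_comm] using htb
    set K : Ser := C (ENNReal.ofReal a) * X ^ 2 * tr N f ^ 2 with hK
    have hpK : tr N p ≤ K := by
      refine (tr_mono N hp).trans ?_
      rw [sq f]
      refine (tr_mul_le N _ _).trans ?_
      rw [hK, sq (tr N f)]
      exact mul_le_mul' (tr_le _ _) (tr_mul_le _ _ _)
    have hevK : ∀ t, 0 ≤ t → ev (ENNReal.ofReal t) K = ENNReal.ofReal (a * t ^ 2 * u t ^ 2) :=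
      fun t ht => by
        rw [hK, map_mul, map_mul, map_pow, map_pow, ev_C, ev_X, ← hof, ← ENNReal.ofReal_pow ht,
          ← ENNReal.ofReal_pow (hu0 _), ← ENNReal.ofReal_mul ha, ← ENNReal.ofReal_mul (by positivity)]
    have hKt : ev (ENNReal.ofReal t) K ≤ ev (ENNReal.ofReal z) K + ENNReal.ofReal q := by
      rw [hevK t htz, hevK z hz.le, ← ENNReal.ofReal_add (by have := hu0 z; positivity) hq0.le]
      refine ENNReal.ofReal_le_ofReal ?_
      have h1 : u t ^ 2 ≤ (u z + δ') ^ 2 := pow_le_pow_left₀ (hu0 t) hut 2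
      have h2 : (u z + δ') ^ 2 ≤ u z ^ 2 + (2 * V + 1) * δ' := by nlinarith
      have h3 : (u z + δ') ^ 2 ≤ (V + 1) ^ 2 :=
        pow_le_pow_left₀ (by linarith [hu0 z]) (by linarith) 2
      have h4 : t ^ 2 ≤ z ^ 2 + (2 * z + 1) * τ := by nlinarith [ht.1, ht.2]
      have h5 : a * z ^ 2 * ((2 * V + 1) * δ') ≤ q / 2 := by
        refine le_trans ?_ hδ.le
        rw [mul_assoc (a * z ^ 2)]
        gcongr
        exact min_le_left _ _
      have h6 : a * ((2 * z + 1) * τ) * (V + 1) ^ 2 ≤ q / 2 := by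
        refine le_trans ?_ hτ₁'.le
        calc _ = a * (2 * z + 1) * (V + 1) ^ 2 * τ := by ring
          _ ≤ _ := by gcongr
      calc a * t ^ 2 * u t ^ 2 ≤ a * (z ^ 2 + (2 * z + 1) * τ) * (u z + δ') ^ 2 := by gcongr
        _ = a * z ^ 2 * (u z + δ') ^ 2 + a * ((2 * z + 1) * τ) * (u z + δ') ^ 2 := by ring
        _ ≤ a * z ^ 2 * (u z ^ 2 + (2 * V + 1) * δ') + a * ((2 * z + 1) * τ) * (V + 1) ^ 2 := by
          gcongr
        _ ≤ _ := by linarith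
    have hpt : M * ev (ENNReal.ofReal t) (tr N p) ≤ 16⁻¹ := by
      have h1 := (ev_add_ev_le hpK (ENNReal.ofReal_le_ofReal ht.1)).trans
        (add_le_add_right hKt _)
      have h2 : ev (ENNReal.ofReal t) (tr N p) ≤
          ev (ENNReal.ofReal z) (tr N p) + ENNReal.ofReal q := by
        refine (ENNReal.add_le_add_iff_right (a := ev (ENNReal.ofReal z) K)
          (by rw [hevK z hz.le]; simp)).1 (h1.trans (le_of_eq (by ring)))
      calc _ ≤ M * (ev (ENNReal.ofReal z) p + ENNReal.ofReal q) := by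
            gcongr
            exact h2.trans (add_le_add_left (ev_mono _ (tr_le N p)) _)
        _ ≤ 32⁻¹ + 32⁻¹ := by rw [mul_add, hMq]; gcongr
        _ = 16⁻¹ := by
          rw [← two_mul, show (32 : ℝ≥0∞) = 2 * 16 by norm_num,
            ENNReal.mul_inv (by simp) (by simp), ← mul_assoc, ENNReal.mul_inv_cancel (by simp)
            (by simp), one_mul]
    have hNt : ev (ENNReal.ofReal t) (Nd (tr N f)) ≤ 2 * ev (ENNReal.ofReal t) (tr N f) ^ 2 := by
      have h1 : Nd (tr N f) ≤
          geom (2 * C M * geom (C M * tr N p) * tr N p) * (tr N f) ^ 2 := by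
        rw [Nd_tr]
        refine (tr_mono N hN).trans ((tr_mul_le _ _ _).trans ?_)
        rw [sq f, sq (tr N f)]
        refine mul_le_mul' ((tr_geom_le _ _).trans (geom_mono ?_)) (tr_mul_le _ _ _)
        refine (tr_mul_le _ _ _).trans (mul_le_mul' ((tr_mul_le _ _ _).trans ?_) le_rfl)
        refine mul_le_mul' (tr_le _ _) ((tr_geom_le _ _).trans (geom_mono ?_))
        exact (tr_mul_le _ _ _).trans (mul_le_mul' (tr_le _ _) le_rfl)
      refine (ev_mono _ h1).trans ?_
      rw [map_mul, map_pow]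
      gcongr
      refine ev_geom_le ?_
      have h2 : ev (ENNReal.ofReal t) (geom (C M * tr N p)) ≤ 2 := by
        refine ev_geom_le ?_
        rw [map_mul, ev_C]
        exact hpt.trans (by gcongr; norm_num)
      rw [map_mul, map_mul, map_mul, ev_C, map_ofNat]
      calc _ = 2 * ev (ENNReal.ofReal t) (geom (C M * tr N p)) *
            (M * ev (ENNReal.ofReal t) (tr N p)) := by ring
        _ ≤ 2 * 2 * 16⁻¹ := by gcongr
        _ ≤ 2⁻¹ := by
          rw [← div_eq_mul_inv, ENNReal.div_le_iff (by simp) (by simp), show (16 : ℝ≥0∞) = 2 * 8 by norm_num,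
            ← mul_assoc, ENNReal.inv_mul_cancel (by simp) (by simp)]
          norm_num
    have h1 := (ev_le_add_ev_Nd (tr N f) hz ht.1).trans
      (add_le_add_right (mul_le_mul_right hNt _) _)
    have h0 : 0 ≤ (t - z) / z := div_nonneg (by linarith [ht.1]) hz.le
    rw [← hof, ← hof, ← ENNReal.ofReal_pow (hu0 _), show (2 : ℝ≥0∞) = ENNReal.ofReal 2 by simp,
      ← ENNReal.ofReal_mul (by norm_num), ← ENNReal.ofReal_mul h0, ← ENNReal.ofReal_add (hu0 _)
      (by positivity), ENNReal.ofReal_le_ofReal_iff (by have := hu0 z; positivity)] at h1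
    have h2 : u t ^ 2 ≤ (V + 1) ^ 2 := pow_le_pow_left₀ (hu0 t) (by linarith) 2
    have h3 : (t - z) / z * (2 * u t ^ 2) ≤ δ' / 2 := by
      refine le_trans ?_ hτ₂'.le
      calc _ ≤ τ₂ / z * (2 * (V + 1) ^ 2) := by
            gcongr
            linarith [ht.2]
        _ = _ := by ring
    linarith
  refine ⟨z + τ, by linarith, ne_top_of_le_ne_top (b := ENNReal.ofReal (V + δ' / 2))
    ENNReal.ofReal_ne_top (ev_le_of_tr_le fun N => ?_)⟩
  have hfin : ev (ENNReal.ofReal (z + τ)) (tr N f) ≠ ⊤ := ev_tr_ne_top N hf ENNReal.ofReal_ne_top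
  rw [← ENNReal.ofReal_toReal hfin]
  refine ENNReal.ofReal_le_ofReal ?_
  have : (ev (ENNReal.ofReal z) (tr N f)).toReal ≤ V :=
    ENNReal.toReal_mono hχ (ev_mono _ (tr_le N f))
  linarith [main N]

end Ser

section

open Ser PowerSeries

section Bootstrap

variable {d : ℕ} {w : List (Pt d) → ℝ≥0∞} {M q : ℝ≥0∞}

section Moments

variable {z : ℝ≥0∞} (htr : ∀ a x y, GS w ∅ (a + x) (a + y) = GS w ∅ x y)
  (hw : ∀ l, w l ≤ M) (hM1 : 1 ≤ M)
  (hQ : ∀ x y, ev z (kmul J (kpow (GS w ∅) 100) x y) ≤ q) (hq : 2 ^ 400 * M * q ≤ 1)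
include htr hw hM1 hQ hq

theorem ev_Wd_psum_Pl_le (hM : M ≠ ⊤) (b : Bool) :
    ev z (Wd 3 (psum fun v => Pl w b v)) ≤ (2 ^ 20)⁻¹ := by
  refine le_trans (ev_mono z (Wd_mono 3 (le_trans (psum_mono fun v => ?_) (psum_Pl_le hw hM htr))))
    (ev_Wd_ph_le htr hw hM1 hQ hq)
  cases b
  · exact le_add_of_nonneg_left (Ser.zero_le _)
  · exact le_add_of_nonneg_right (Ser.zero_le _)

theorem tsum_ev_Pl_le (hM : M ≠ ⊤) (b : Bool) : ∑' v, ev z (Pl w b v) ≤ (2 ^ 20)⁻¹ := by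
  rw [← ev_psum]
  exact (ev_mono z (le_Wd 3 _)).trans (ev_Wd_psum_Pl_le htr hw hM1 hQ hq hM b)

theorem tsum_ev_Pl_mul_le (hM : M ≠ ⊤) (b : Bool) :
    ∑' v, ev z (Pl w b v) * (dist1 0 v : ℝ≥0∞) ^ 2 ≤ (2 ^ 20)⁻¹ := by
  refine le_trans (ENNReal.tsum_le_tsum fun v => ev_mul_pow_le
    (fun m hm => coeff_Pl_of_lt b v hm) 2 z) ?_
  rw [← ev_psum, ← Wd_psum]
  exact (ev_mono z (Wd_le_Wd (by norm_num) _)).trans (ev_Wd_psum_Pl_le htr hw hM1 hQ hq hM b)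

end Moments

variable (htr : ∀ a x y, GS w ∅ (a + x) (a + y) = GS w ∅ x y)
include htr

theorem psum_kpow (n : ℕ) : (psum fun x => kpow (GS w ∅) n 0 x) = Ch w ^ n := by
  induction n with
  | zero =>
    rw [pow_zero]
    refine (psum_single _ (0 : Pt d) fun j hj => ?_).trans (by simp [kpow])
    simp [kpow, hj.symm]
  | succ n ih =>
    simp only [kpow]
    rw [psum_kmul (kpow_translation htr n), ih, pow_succ']
    rfl

theorem kmul_J_kpow_le (n : ℕ) (x y : Pt d) :
    kmul J (kpow (GS w ∅) n) x y ≤ C (2 * d : ℝ≥0∞) * X * Ch w ^ n := by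
  have h := kmul_translation J_translation (kpow_translation htr n) x 0 (y - x)
  rw [add_zero, add_sub_cancel] at h
  rw [h, ← psum_kpow htr, ← psum_J, ← psum_kmul (kpow_translation htr n)]
  exact le_psum _ (y - x)

theorem bootstrap (hw : ∀ l, w l ≤ M) (hM1 : 1 ≤ M) (hM : M ≠ ⊤) (hd : 0 < d)
    (hp : ∀ (σ : Equiv.Perm (Fin d)) b v, Pl w b (v ∘ σ.symm) = Pl w b v) {a : ℝ≥0∞}
    (hK : 2 * 12 ^ 100 * ∫⁻ k, ‖1 - ss k‖ₑ * (ENNReal.ofReal (ss k))⁻¹ ^ 100 ∂tor d ≤ a)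
    (haq : a < q) (hq : 2 ^ 400 * M * q ≤ 1) {z : ℝ} (hz : 0 ≤ z)
    (hχ : ev (ENNReal.ofReal z) (Ch w) ≠ ⊤) :
    (∀ x y, ev (ENNReal.ofReal z) (kmul J (kpow (GS w ∅) 100) x y) ≤ q) ∧ z * d ≤ 1 := by
  have hqt : q ≠ ⊤ := by
    rintro rfl
    rw [ENNReal.mul_top (by simp; intro h; simp [h] at hM1)] at hq
    simp at hq
  have key : ∀ t, 0 ≤ t → t ≤ z →
      (∀ x y, ev (ENNReal.ofReal t) (kmul J (kpow (GS w ∅) 100) x y) ≤ q) →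
      t * d ≤ 1 ∧ ∀ k, ‖ft (fun x => ev (ENNReal.ofReal t) (GS w ∅ 0 x)) k‖ * ss k ≤ 12 := by
    intro t ht htz hQ
    have h8 : ((2 : ℝ≥0∞) ^ 20)⁻¹ ≤ 8⁻¹ := ENNReal.inv_le_inv.2 (by norm_num)
    have h16 : ((2 : ℝ≥0∞) ^ 20)⁻¹ ≤ 16⁻¹ := ENNReal.inv_le_inv.2 (by norm_num)
    have h3 := fun b => (tsum_ev_Pl_le htr hw hM1 hQ hq hM b).trans h8
    have h4 := fun b => (tsum_ev_Pl_mul_le htr hw hM1 hQ hq hM b).trans h16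
    have := norm_ft_mul_ss_le (z := ENNReal.ofReal t) htr hd
      (by rw [← ev_psum]; exact ev_ofReal_ne_top htz hχ) ENNReal.ofReal_ne_top
      (ev_gS_le hw hQ hq)
      h3 h4
      (fun σ b v => by rw [hp])
    rwa [ENNReal.toReal_ofReal ht] at this
  have hQ : ∀ i : Pt d × Pt d,
      ev (ENNReal.ofReal z) (kmul J (kpow (GS w ∅) 100) i.1 i.2) ≤ a := by
    refine iSup_ev_le_of_bootstrap
      (f := fun i : Pt d × Pt d => kmul J (kpow (GS w ∅) 100) i.1 i.2) (fun i => kmul_J_kpow_le htr 100 i.1 i.2) ?_ hz ?_ haq hqt ?_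
    · simp
    · rw [map_mul, map_mul, map_pow, ev_C, ev_X]
      exact ENNReal.mul_ne_top (ENNReal.mul_ne_top (by finiteness) ENNReal.ofReal_ne_top)
        (ENNReal.pow_ne_top hχ)
    · intro t ht htz hQ i
      obtain ⟨h1, h2⟩ := key t ht htz fun x y => hQ (x, y)
      refine (ev_kmul_J_kpow_le htr hd (by rw [← ev_psum]; exact ev_ofReal_ne_top htz hχ)
        ENNReal.ofReal_ne_top (by rwa [ENNReal.toReal_ofReal ht]) h2 _ _ _).trans hK
  exact ⟨fun x y => (hQ (x, y)).trans haq.le, (key z hz le_rfl fun x y => (hQ (x, y)).trans haq.le).1⟩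

end Bootstrap

end

section

open Ser PowerSeries

theorem Ser.ev_le_of_forall_lt {f : Ser} {z : ℝ} (hz : 0 < z) {B : ℝ≥0∞}
    (h : ∀ t, 0 ≤ t → t < z → ev (ENNReal.ofReal t) f ≤ B) : ev (ENNReal.ofReal z) f ≤ B := by
  rw [ev_apply]
  refine ENNReal.tsum_le_of_sum_range_le fun N => ?_
  have ht : Filter.Tendsto (fun t : ℝ => ∑ n ∈ Finset.range N, coeff n f * ENNReal.ofReal t ^ n)
      (nhdsWithin z (Set.Iio z))
      (nhds (∑ n ∈ Finset.range N, coeff n f * ENNReal.ofReal z ^ n)) := by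
    refine tendsto_finsetSum _ fun n _ => ENNReal.Tendsto.const_mul ?_ (Or.inl ?_)
    · exact ((ENNReal.continuous_pow n).comp ENNReal.continuous_ofReal).continuousAt.mono_left
        nhdsWithin_le_nhds
    · simp [hz]
  refine le_of_tendsto ht ?_
  filter_upwards [Ioo_mem_nhdsLT hz] with t ht
  refine le_trans ?_ (h t ht.1.le ht.2)
  rw [ev_apply]
  exact ENNReal.sum_le_tsum _

section Critical

variable {d : ℕ} {lam : List (Pt d) → ℝ≥0}

theorem cN_eq (n : ℕ) : cN lam n = coeff n (Ch (lw lam)) := by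
  have := tsum_walk lam (fun _ => 1) n
  simp only [one_mul] at this
  rw [cN, Ch, coeff_psum, ← this]

theorem msd_eq (n : ℕ) :
    msd lam n = coeff n (psum fun x => C (sqNormE x) * GS (lw lam) ∅ 0 x) := by
  rw [msd, tsum_walk, coeff_psum]
  simp only [coeff_C_mul]

theorem chi_eq (z : ℝ) : chi lam z = ev (ENNReal.ofReal z) (Ch (lw lam)) := by
  simp only [chi, ev_apply, cN_eq]

theorem coeff_Ch_le {w : List (Pt d) → ℝ≥0∞} {M : ℝ≥0∞} (hw : ∀ l, w l ≤ M) (hM1 : 1 ≤ M)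
    (n : ℕ) : coeff n (Ch w) ≤ (2 * d * M) ^ n := by
  have := tsum_coeff_CS_le hw hM1 n [] 0 ∅
  simpa [Ch, coeff_psum, GS] using this

theorem Nd_Ch_le {w : List (Pt d) → ℝ≥0∞} {M : ℝ≥0∞} (hw : ∀ l, w l ≤ M)
    (htr : ∀ a x y, GS w ∅ (a + x) (a + y) = GS w ∅ x y) :
    Nd (Ch w) ≤ geom (2 * C M * geom (C M * kmul J (kmul (kmul (GS w ∅) (GS w ∅)) J) 0 0) *
      kmul J (kmul (kmul (GS w ∅) (GS w ∅)) J) 0 0) * Ch w ^ 2 := by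
  rw [Ch, Nd_psum, sq]
  rw [← psum_kmul (A := GS w ∅) htr]
  rw [mul_psum]
  refine psum_mono fun x => (le_add_of_nonneg_left (Ser.zero_le _)).trans
    ((number_GS_le hw htr ∅ 0 x).trans (mul_le_mul' (geom_mono ?_) le_rfl))
  refine mul_le_mul' (mul_le_mul' le_rfl ?_) le_rfl
  rw [gS_eq w (by simp)]
  refine geom_mono ((rS_le_JG hw _ _).trans (mul_le_mul' le_rfl ?_))
  exact kmul_mono (fun _ _ => le_rfl) (kmul_mono (le_kmul_GS w _) fun _ _ => le_rfl) _ _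

theorem kmul_JGGJ_le {w : List (Pt d) → ℝ≥0∞}
    (htr : ∀ a x y, GS w ∅ (a + x) (a + y) = GS w ∅ x y) :
    kmul J (kmul (kmul (GS w ∅) (GS w ∅)) J) 0 0 ≤
      C (ENNReal.ofReal (4 * d ^ 2)) * X ^ 2 * Ch w ^ 2 := by
  refine (le_psum (fun y => kmul J (kmul (kmul (GS w ∅) (GS w ∅)) J) 0 y) 0).trans (le_of_eq ?_)
  have h1 := kmul_translation htr htr
  rw [psum_kmul (kmul_translation h1 J_translation), psum_kmul J_translation, psum_kmul htr,
    psum_J, ← Ch, ENNReal.ofReal_mul (by norm_num), ENNReal.ofReal_pow (by simp)]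
  simp only [map_mul, map_pow, ENNReal.ofReal_natCast, map_natCast, map_ofNat,
    ENNReal.ofReal_ofNat]
  ring

theorem critical_point (hs : SymmAssumption lam) {M : ℝ≥0}
    (hb : ∀ l, IsSAPList l → lam l ≤ M) (hM1 : 1 ≤ M) (hd : 0 < d) {a q : ℝ≥0∞}
    (hK : 2 * 12 ^ 100 * ∫⁻ k, ‖1 - ss k‖ₑ * (ENNReal.ofReal (ss k))⁻¹ ^ 100 ∂tor d ≤ a)
    (haq : a < q) (hq : 2 ^ 400 * M * q ≤ 1) :
    0 < zc lam ∧ (∀ z < zc lam, chi lam z ≠ ⊤) ∧ chi lam (zc lam) = ⊤ ∧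
      ∀ x y, ev (ENNReal.ofReal (zc lam)) (kmul J (kpow (GS (lw lam) ∅) 100) x y) ≤ q := by
  have htr := GS_lw_translation hs
  have hw := lw_le hb
  have hM1' : (1 : ℝ≥0∞) ≤ M := by exact_mod_cast hM1
  have hM : (M : ℝ≥0∞) ≠ ⊤ := ENNReal.coe_ne_top
  have hboot := fun (z : ℝ) (hz : 0 ≤ z) (h : chi lam z ≠ ⊤) =>
    bootstrap htr hw hM1' hM hd (fun σ b v => Pl_lw_perm hs σ b v) hK haq hq hz (chi_eq z ▸ h)
  have hd' : (0 : ℝ) < d := by exact_mod_cast hd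
  have hMr : (0 : ℝ) < M := by exact_mod_cast hM1.trans_lt' one_pos
  have hbdd : BddAbove {z : ℝ | 0 ≤ z ∧ chi lam z < ⊤} :=
    ⟨1 / d, fun z hz => by rw [le_div_iff₀ hd']; exact (hboot z hz.1 hz.2.ne).2⟩
  have hmem : 1 / (4 * d * M : ℝ) ∈ {z : ℝ | 0 ≤ z ∧ chi lam z < ⊤} := by
    refine ⟨by positivity, ?_⟩
    have h1 : ∀ n, cN lam n * ENNReal.ofReal (1 / (4 * d * M : ℝ)) ^ n ≤ 2⁻¹ ^ n := fun n => by
      refine (mul_le_mul_left ((cN_eq n).trans_le (coeff_Ch_le hw hM1' n)) _).trans ?_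
      rw [← mul_pow]
      refine pow_le_pow_left₀ bot_le (le_of_eq ?_) n
      have h2 : (2 * d * M : ℝ≥0∞) = ENNReal.ofReal (2 * d * M) := by
        rw [ENNReal.ofReal_mul (by positivity), ENNReal.ofReal_mul (by positivity)]
        simp
      have h3 : (2⁻¹ : ℝ≥0∞) = ENNReal.ofReal 2⁻¹ := by
        rw [ENNReal.ofReal_inv_of_pos (by norm_num)]; simp
      rw [h2, h3, ← ENNReal.ofReal_mul (by positivity)]
      congr 1
      field_simp
      norm_num
    refine (ENNReal.tsum_le_tsum h1).trans_lt ?_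
    rw [ENNReal.tsum_geometric]
    simp
  have hpos : 0 < zc lam := lt_of_lt_of_le (by positivity) (le_csSup hbdd hmem)
  have hfin : ∀ z < zc lam, chi lam z ≠ ⊤ := fun z hz => by
    obtain ⟨t, ht, hzt⟩ := exists_lt_of_lt_csSup ⟨_, hmem⟩ hz
    rw [chi_eq]
    exact ev_ofReal_ne_top hzt.le (chi_eq t ▸ ht.2.ne)
  have hQ : ∀ x y, ev (ENNReal.ofReal (zc lam)) (kmul J (kpow (GS (lw lam) ∅) 100) x y) ≤ q :=
    fun x y => ev_le_of_forall_lt hpos fun t ht htz => (hboot t ht (hfin t htz)).1 x y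
  refine ⟨hpos, hfin, ?_, hQ⟩
  by_contra htop
  obtain ⟨t, ht, h⟩ := exists_gt_ev_ne_top (f := Ch (lw lam))
    (p := kmul J (kmul (kmul (GS (lw lam) ∅) (GS (lw lam) ∅)) J) 0 0) (M := M) (a := 4 * d ^ 2)
    (by positivity) (fun n => ne_top_of_le_ne_top (by finiteness) (coeff_Ch_le hw hM1' n)) hM hM1'
    (kmul_JGGJ_le htr) (Nd_Ch_le hw htr) hpos (chi_eq (zc lam) ▸ htop) (by
      have h1 := kmul_GJ_le (w := lw lam) 2 0 0
      rw [show kpow (GS (lw lam) ∅) 2 = kmul (GS (lw lam) ∅) (GS (lw lam) ∅) by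
        rw [← one_add_one_eq_two, ← kpow_add, kpow_one]] at h1
      have h2 := (ev_mono (ENNReal.ofReal (zc lam)) h1).trans (ev_JG_le hQ (by norm_num) 0 0)
      calc _ ≤ (M : ℝ≥0∞) * q := mul_le_mul_right h2 _
        _ = 2 ^ 0 * M * q := by ring
        _ ≤ (2 ^ 400)⁻¹ := two_pow_mul_le 0 (by norm_num) hq
        _ ≤ 32⁻¹ := ENNReal.inv_le_inv.2
          (le_trans (by norm_num) (pow_le_pow_right₀ one_le_two (by norm_num : 5 ≤ 400))))
  have : t ≤ zc lam := le_csSup hbdd ⟨hpos.le.trans ht.le, by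
    rw [chi_eq]; exact h.lt_top⟩
  linarith

end Critical

end

namespace Ser

open PowerSeries

/-- The series of absolute values of the coefficients. -/
def ab (f : PowerSeries ℝ) : Ser := mk fun n => ‖coeff n f‖ₑ

@[simp] theorem coeff_ab (n : ℕ) (f : PowerSeries ℝ) : coeff n (ab f) = ‖coeff n f‖ₑ := coeff_mk _ _

theorem ab_add_le (f g : PowerSeries ℝ) : ab (f + g) ≤ ab f + ab g := fun n => by
  simpa using enorm_add_le _ _

theorem ab_neg (f : PowerSeries ℝ) : ab (-f) = ab f := by ext n; simp

theorem ab_sub_le (f g : PowerSeries ℝ) : ab (f - g) ≤ ab f + ab g := by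
  rw [sub_eq_add_neg, ← ab_neg g]; exact ab_add_le _ _

theorem ab_mul_le (f g : PowerSeries ℝ) : ab (f * g) ≤ ab f * ab g := fun n => by
  rw [coeff_ab, coeff_mul, coeff_mul]
  refine (enorm_sum_le _ _).trans (le_of_eq (Finset.sum_congr rfl fun p _ => ?_))
  rw [enorm_mul, coeff_ab, coeff_ab]

theorem ab_C (a : ℝ) : ab (C a) = C ‖a‖ₑ := by
  ext n; rw [coeff_ab, coeff_C, coeff_C]; split_ifs <;> simp

theorem ab_one : ab 1 = 1 := by
  rw [← map_one (C (R := ℝ)), ab_C]; simp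

theorem ab_X : ab X = X := by
  ext n; rw [coeff_ab, coeff_X, coeff_X]; split_ifs <;> simp

/-- Power series whose coefficients have a finite absolute first moment. -/
def WS (f : PowerSeries ℝ) : Prop := ev 1 (Wd 1 (ab f)) ≠ ⊤

theorem WS.add {f g : PowerSeries ℝ} (hf : WS f) (hg : WS g) : WS (f + g) := by
  refine ne_top_of_le_ne_top (ENNReal.add_ne_top.2 ⟨hf, hg⟩) ?_
  rw [← map_add, ← Wd_add]
  exact ev_mono _ (Wd_mono _ (ab_add_le f g))

theorem WS.mul {f g : PowerSeries ℝ} (hf : WS f) (hg : WS g) : WS (f * g) :=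
  ne_top_of_le_ne_top (ENNReal.mul_ne_top hf hg)
    ((ev_mono _ (Wd_mono _ (ab_mul_le f g))).trans (ev_Wd_mul_le _ _ _ _))

theorem WS_C (a : ℝ) : WS (C a) := by
  rw [WS, ab_C, Wd_C, ev_C]; exact enorm_ne_top

theorem WS_X : WS X := by
  rw [WS, ab_X, Wd_X, map_mul, ev_C, ev_X]; simp

theorem WS_one : WS 1 := by
  rw [← map_one (C (R := ℝ))]; exact WS_C 1

/-- Absolute convergence of a real power series. -/
def Sm (t : ℝ) (f : PowerSeries ℝ) : Prop := Summable fun n => ‖coeff n f * t ^ n‖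

/-- The value of a real power series. -/
def rv (t : ℝ) (f : PowerSeries ℝ) : ℝ := ∑' n, coeff n f * t ^ n

variable {t : ℝ} {f g : PowerSeries ℝ}

theorem Sm.hasSum (hf : Sm t f) : HasSum (fun n => coeff n f * t ^ n) (rv t f) :=
  (Summable.of_norm hf).hasSum

theorem coeff_mul_mul_pow (n : ℕ) : coeff n (f * g) * t ^ n =
    ∑ p ∈ Finset.HasAntidiagonal.antidiagonal n, (coeff p.1 f * t ^ p.1) * (coeff p.2 g * t ^ p.2) := by
  rw [coeff_mul, Finset.sum_mul]
  refine Finset.sum_congr rfl fun p hp => ?_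
  rw [← Finset.HasAntidiagonal.mem_antidiagonal.1 hp, pow_add]
  ring

theorem Sm.mul (hf : Sm t f) (hg : Sm t g) : Sm t (f * g) := by
  simp only [Sm, coeff_mul_mul_pow]
  exact summable_norm_sum_mul_antidiagonal_of_summable_norm
    (f := fun n => coeff n f * t ^ n) (g := fun n => coeff n g * t ^ n) hf hg

theorem rv_mul (hf : Sm t f) (hg : Sm t g) : rv t (f * g) = rv t f * rv t g := by
  simp only [rv, coeff_mul_mul_pow]
  exact (tsum_mul_tsum_eq_tsum_sum_antidiagonal_of_summable_norm hf hg).symm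

theorem Sm.add (hf : Sm t f) (hg : Sm t g) : Sm t (f + g) := by
  refine Summable.of_nonneg_of_le (fun _ => norm_nonneg _) (fun n => ?_) (Summable.add hf hg)
  rw [map_add, add_mul]
  exact norm_add_le _ _

theorem Sm.neg (hf : Sm t f) : Sm t (-f) := by
  simpa [Sm] using hf

theorem rv_add (hf : Sm t f) (hg : Sm t g) : rv t (f + g) = rv t f + rv t g := by
  refine HasSum.tsum_eq ?_
  simp only [map_add, add_mul]
  exact hf.hasSum.add hg.hasSum

theorem rv_neg : rv t (-f) = -rv t f := by
  simp [rv, tsum_neg]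

theorem Sm.sub (hf : Sm t f) (hg : Sm t g) : Sm t (f - g) := by
  rw [sub_eq_add_neg]; exact hf.add hg.neg

theorem rv_sub (hf : Sm t f) (hg : Sm t g) : rv t (f - g) = rv t f - rv t g := by
  rw [sub_eq_add_neg, rv_add hf hg.neg, rv_neg, sub_eq_add_neg]

theorem Sm_C (a : ℝ) : Sm t (C a) := by
  refine summable_of_ne_finset_zero (s := {0}) fun n hn => ?_
  rw [coeff_C, if_neg (by simpa using hn)]; simp

theorem rv_C (a : ℝ) : rv t (C a) = a := by
  refine (tsum_eq_single 0 fun n hn => ?_).trans (by simp)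
  rw [coeff_C, if_neg hn, zero_mul]

theorem Sm_one : Sm t 1 := by rw [← map_one (C (R := ℝ))]; exact Sm_C 1

theorem rv_one : rv t 1 = 1 := by rw [← map_one (C (R := ℝ))]; exact rv_C 1

theorem Sm_X : Sm t X := by
  refine summable_of_ne_finset_zero (s := {1}) fun n hn => ?_
  rw [coeff_X, if_neg (by simpa using hn)]; simp

theorem rv_X : rv t X = t := by
  refine (tsum_eq_single 1 fun n hn => ?_).trans (by simp)
  rw [coeff_X, if_neg hn, zero_mul]

theorem Sm_of_ev_ab_ne_top (h : ev 1 (ab f) ≠ ⊤) (ht : 0 ≤ t) (ht1 : t ≤ 1) : Sm t f := by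
  simp only [ev_apply, one_pow, mul_one, coeff_ab] at h
  refine Summable.of_nonneg_of_le (fun _ => norm_nonneg _) (fun n => ?_) (ENNReal.summable_toReal h)
  rw [toReal_enorm, norm_mul, norm_pow, Real.norm_of_nonneg ht]
  exact mul_le_of_le_one_right (norm_nonneg _) (pow_le_one₀ ht ht1)

theorem WS.sm (hf : WS f) (ht : 0 ≤ t) (ht1 : t ≤ 1) : Sm t f :=
  Sm_of_ev_ab_ne_top (ne_top_of_le_ne_top hf (ev_mono _ (le_Wd 1 _))) ht ht1

theorem abs_rv_le {c : ℝ} (hc : 0 ≤ c) (h : ev 1 (ab f) ≤ ENNReal.ofReal c) (ht : 0 ≤ t)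
    (ht1 : t ≤ 1) : |rv t f| ≤ c := by
  have hs := Sm_of_ev_ab_ne_top (ne_top_of_le_ne_top ENNReal.ofReal_ne_top h) ht ht1
  refine (norm_tsum_le_tsum_norm hs).trans ?_
  have h1 := ENNReal.toReal_mono ENNReal.ofReal_ne_top h
  rw [ENNReal.toReal_ofReal hc] at h1
  refine le_trans ?_ h1
  simp only [ev_apply, one_pow, mul_one, coeff_ab] at h ⊢
  have h2 := ne_top_of_le_ne_top ENNReal.ofReal_ne_top h
  rw [ENNReal.tsum_toReal_eq fun n => enorm_ne_top]
  refine Summable.tsum_le_tsum (fun n => ?_) hs (ENNReal.summable_toReal h2)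
  rw [toReal_enorm, norm_mul, norm_pow, Real.norm_of_nonneg ht]
  exact mul_le_of_le_one_right (norm_nonneg _) (pow_le_one₀ ht ht1)

theorem tendsto_rv (hf : Sm 1 f) :
    Filter.Tendsto (fun t => rv t f) (nhdsWithin 1 (Set.Iio 1)) (nhds (rv 1 f)) := by
  refine Real.tendsto_tsum_powerSeries_nhdsWithin_lt (f := fun n => coeff n f) ?_
  have := hf.hasSum.tendsto_sum_nat
  simpa using this

end Ser

namespace Ser

open PowerSeries

variable {f g e y u a : PowerSeries ℝ} {β : ℝ}

theorem tsum_tsum_add (e : ℕ → ℝ≥0∞) :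
    ∑' n, ∑' j, e (n + j) = ∑' m, ((m + 1 : ℕ) : ℝ≥0∞) * e m := by
  rw [← ENNReal.tsum_prod (f := fun n j => e (n + j)),
    ← (Finset.HasAntidiagonal.sigmaAntidiagonalEquivProd (A := ℕ)).tsum_eq, ENNReal.tsum_sigma']
  refine tsum_congr fun m => ?_
  rw [tsum_fintype]
  have : ∀ b : Finset.HasAntidiagonal.antidiagonal m, e ((b : ℕ × ℕ).1 + (b : ℕ × ℕ).2) = e m :=
    fun b => by rw [Finset.HasAntidiagonal.mem_antidiagonal.1 b.2]
  refine (Finset.sum_congr rfl fun b _ => this b).trans ?_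
  rw [Finset.sum_const, nsmul_eq_mul]
  simp

theorem ev_one_Wd (j : ℕ) (f : Ser) :
    ev 1 (Wd j f) = ∑' n, ((n + 1 : ℕ) : ℝ≥0∞) ^ j * coeff n f := by
  simp [ev_apply]

theorem coeff_mul_one_sub_X (n : ℕ) :
    coeff (n + 1) (f * (1 - X)) = coeff (n + 1) f - coeff n f := by
  rw [mul_sub, mul_one, map_sub, coeff_succ_mul_X]

theorem coeff_eq_sum (h : f * (1 - X) = e) (n : ℕ) :
    coeff n f = ∑ m ∈ Finset.range (n + 1), coeff m e := by
  induction n with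
  | zero => rw [← h]; simp [mul_sub]
  | succ n ih =>
    rw [Finset.sum_range_succ, ← ih, ← h, coeff_mul_one_sub_X]
    ring

theorem rv_sub_sum (he : Sm 1 e) (n : ℕ) :
    rv 1 e - ∑ m ∈ Finset.range n, coeff m e = ∑' j, coeff (n + j) e := by
  have h := he.hasSum.summable
  simp only [one_pow, mul_one] at h
  have := h.sum_add_tsum_nat_add n
  simp only [rv, one_pow, mul_one]
  rw [← this, add_sub_cancel_left]
  exact tsum_congr fun j => by rw [add_comm]

theorem enorm_coeff_sub_le (he : Sm 1 e) (h : f * (1 - X) = e) (n : ℕ) :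
    ‖coeff n f - rv 1 e‖ₑ ≤ ∑' j, ‖coeff (n + 1 + j) e‖ₑ := by
  rw [coeff_eq_sum h, ← enorm_neg, neg_sub, rv_sub_sum he]
  exact enorm_tsum_le_tsum_enorm

theorem mul_enorm_coeff_sub_le (he : Sm 1 e) (h : f * (1 - X) = e) (n : ℕ) :
    (n + 1 : ℕ) * ‖coeff n f - rv 1 e‖ₑ ≤ ev 1 (Wd 1 (ab e)) := by
  refine (mul_le_mul_right (enorm_coeff_sub_le he h n) _).trans ?_
  rw [ev_one_Wd, ← ENNReal.tsum_mul_left]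
  refine le_trans (ENNReal.tsum_le_tsum fun j => ?_)
    (ENNReal.tsum_comp_le_tsum_of_injective (add_right_injective (n + 1)) _)
  rw [coeff_ab, pow_one]
  gcongr
  omega

theorem enorm_coeff_sub_mul_le (he : Sm 1 e) (h : y * (1 - X) ^ 2 = e) (n : ℕ) :
    ‖coeff n y - (n + 1) * rv 1 e‖ₑ ≤ ev 1 (Wd 1 (ab e)) := by
  have h1 : y * (1 - X) * (1 - X) = e := by rw [← h]; ring
  have h2 : coeff n y - (n + 1) * rv 1 e =
      ∑ m ∈ Finset.range (n + 1), (coeff m (y * (1 - X)) - rv 1 e) := by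
    rw [coeff_eq_sum rfl]
    simp
  rw [h2]
  refine (enorm_sum_le _ _).trans ?_
  refine (Finset.sum_le_sum fun m _ => enorm_coeff_sub_le he h1 m).trans ?_
  refine (ENNReal.sum_le_tsum _).trans ?_
  have h3 : ∀ m, ∑' j, ‖coeff (m + 1 + j) e‖ₑ ≤ ∑' j, ‖coeff (m + j) e‖ₑ := fun m => by
    have := ENNReal.tsum_comp_le_tsum_of_injective (add_right_injective 1)
      (fun j => ‖coeff (m + j) e‖ₑ)
    simpa only [← add_assoc] using this
  refine (ENNReal.tsum_le_tsum h3).trans (le_of_eq ?_)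
  rw [tsum_tsum_add fun m => ‖coeff m e‖ₑ, ev_one_Wd]
  simp

theorem critical_eq (hu : ev 1 (ab u) ≤ ENNReal.ofReal (1 / 4))
    (ha : a = (1 + u) * (1 + C β * X * a)) (h0 : ∀ n, 0 ≤ coeff n a)
    (hfin : ∀ t, 0 ≤ t → t < 1 → Sm t a) (hdiv : ¬ Sm 1 a) : β * rv 1 (1 + u) = 1 := by
  have hut : ∀ t, 0 ≤ t → t ≤ 1 → Sm t u := fun t =>
    Sm_of_ev_ab_ne_top (ne_top_of_le_ne_top ENNReal.ofReal_ne_top hu)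
  have hs : ∀ t, 0 ≤ t → t ≤ 1 → rv t (1 + u) ≤ 2 ∧ 0 < rv t (1 + u) := fun t ht ht1 => by
    rw [rv_add Sm_one (hut t ht ht1), rv_one]
    have := abs_le.1 (abs_rv_le (by norm_num) hu ht ht1)
    constructor <;> linarith [this.1, this.2]
  have hst : ∀ t, 0 ≤ t → t ≤ 1 → Sm t (1 + u) := fun t ht ht1 => Sm_one.add (hut t ht ht1)
  have hrec : ∀ t, 0 ≤ t → t < 1 → rv t a * (1 - β * t * rv t (1 + u)) = rv t (1 + u) := by
    intro t ht ht1
    have h1 : Sm t (C β * X) := (Sm_C β).mul Sm_X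
    have h2 := hfin t ht ht1
    have h3 : rv t a = rv t (1 + u) * (1 + β * t * rv t a) := by
      conv_lhs => rw [ha]
      rw [rv_mul (hst t ht ht1.le) (Sm_one.add (h1.mul h2)), rv_add Sm_one (h1.mul h2), rv_one,
        rv_mul h1 h2, rv_mul (Sm_C β) Sm_X, rv_C, rv_X]
    linear_combination h3
  have hnn : ∀ t, 0 ≤ t → 0 ≤ rv t a := fun t ht =>
    tsum_nonneg fun n => mul_nonneg (h0 n) (pow_nonneg ht n)
  have hpos : ∀ t, 0 ≤ t → t < 1 → 0 < 1 - β * t * rv t (1 + u) := by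
    intro t ht ht1
    by_contra! h
    have := mul_nonpos_of_nonneg_of_nonpos (hnn t ht) h
    linarith [hrec t ht ht1, (hs t ht ht1.le).2]
  have hlim : Filter.Tendsto (fun t => 1 - β * t * rv t (1 + u)) (nhdsWithin 1 (Set.Iio 1))
      (nhds (1 - β * 1 * rv 1 (1 + u))) :=
    tendsto_const_nhds.sub ((tendsto_const_nhds.mul
      (Filter.tendsto_id.mono_left nhdsWithin_le_nhds)).mul (tendsto_rv (hst 1 zero_le_one le_rfl)))
  set L := 1 - β * 1 * rv 1 (1 + u) with hL
  have hnear : ∀ᶠ t in nhdsWithin (1 : ℝ) (Set.Iio 1), t ∈ Set.Ioo (0 : ℝ) 1 :=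
    Ioo_mem_nhdsLT one_pos
  have hL0 : 0 ≤ L := ge_of_tendsto hlim (hnear.mono fun t ht => (hpos t ht.1.le ht.2).le)
  rcases hL0.eq_or_lt with h | h
  · linarith
  · exfalso
    have hev : ∀ᶠ t in nhdsWithin (1 : ℝ) (Set.Iio 1), rv t a ≤ 4 / L := by
      filter_upwards [hnear, hlim.eventually (lt_mem_nhds (half_lt_self h))] with t ht hlt
      rw [le_div_iff₀ h]
      have h1 := hrec t ht.1.le ht.2
      have h2 := mul_le_mul_of_nonneg_left hlt.le (hnn t ht.1.le)
      linarith [(hs t ht.1.le ht.2.le).1]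
    have hpart : ∀ N, ∑ n ∈ Finset.range N, coeff n a ≤ 4 / L := by
      intro N
      have hc : Filter.Tendsto (fun t : ℝ => ∑ n ∈ Finset.range N, coeff n a * t ^ n)
          (nhdsWithin 1 (Set.Iio 1)) (nhds (∑ n ∈ Finset.range N, coeff n a * 1 ^ n)) := by
        refine Filter.Tendsto.mono_left ?_ nhdsWithin_le_nhds
        exact (by fun_prop : Continuous fun t : ℝ =>
          ∑ n ∈ Finset.range N, coeff n a * t ^ n).tendsto 1
      simp only [one_pow, mul_one] at hc
      refine le_of_tendsto hc ?_
      filter_upwards [hnear, hev] with t ht hle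
      refine le_trans ?_ hle
      exact (hfin t ht.1.le ht.2).hasSum.summable.sum_le_tsum _
        fun n _ => mul_nonneg (h0 n) (pow_nonneg ht.1.le n)
    refine hdiv ?_
    have := summable_of_sum_range_le h0 hpart
    simpa [Sm, abs_of_nonneg (h0 _)] using this

theorem exists_renewal (hu : ev 1 (Wd 2 (ab u)) ≤ ENNReal.ofReal (1 / 8)) (hβ : 0 ≤ β)
    (hβ2 : β ≤ 2) (h1 : β * rv 1 (1 + u) = 1) :
    ∃ E : PowerSeries ℝ, WS E ∧ 0 < rv 1 E ∧ 1 - X = (1 - C β * X * (1 + u)) * E := by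
  have hu0 : Sm 1 u := Sm_of_ev_ab_ne_top (ne_top_of_le_ne_top ENNReal.ofReal_ne_top
    ((ev_mono 1 (le_Wd 2 _)).trans hu)) zero_le_one le_rfl
  set B : PowerSeries ℝ := mk fun n => 1 - β * ∑ j ∈ Finset.range n, coeff j (1 + u) with hB
  have hBX : B * (1 - X) = 1 - C β * X * (1 + u) := by
    ext n
    cases n with
    | zero => simp [hB, mul_sub, mul_assoc]
    | succ n =>
      rw [coeff_mul_one_sub_X, hB, coeff_mk, coeff_mk, Finset.sum_range_succ, map_sub, mul_assoc,
        coeff_C_mul, coeff_succ_X_mul, coeff_one, if_neg n.succ_ne_zero]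
      ring
  have hv : ∀ n, coeff n (ab (B - 1)) ≤ ENNReal.ofReal β * ∑' j, ‖coeff (n + j) u‖ₑ := by
    intro n
    rw [coeff_ab]
    rcases Nat.eq_zero_or_pos n with rfl | hn
    · simp [hB]
    · have h2 : coeff n (B - 1) = β * ∑' j, coeff (n + j) u := by
        have h3 := rv_sub_sum (Sm_one.add hu0) n
        have h4 : ∀ j, coeff (n + j) (1 + u) = coeff (n + j) u := fun j => by
          rw [map_add, coeff_one, if_neg (by omega), zero_add]
        simp only [h4] at h3
        rw [map_sub, coeff_one, if_neg hn.ne', ← h3, hB, coeff_mk]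
        linear_combination -h1
      rw [h2, enorm_mul, Real.enorm_of_nonneg hβ]
      gcongr
      exact enorm_tsum_le_tsum_enorm
  have hvW : ev 1 (Wd 1 (ab (B - 1))) ≤ ENNReal.ofReal (1 / 4) := by
    have h2 : ∑' n, ((n + 1 : ℕ) : ℝ≥0∞) * ∑' j, ‖coeff (n + j) u‖ₑ ≤ ENNReal.ofReal (1 / 8) := by
      refine le_trans (le_trans (ENNReal.tsum_le_tsum fun n => ?_)
        (tsum_tsum_add fun m => ((m + 1 : ℕ) : ℝ≥0∞) * ‖coeff m u‖ₑ).le) (le_trans ?_ hu)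
      · rw [← ENNReal.tsum_mul_left]
        refine ENNReal.tsum_le_tsum fun j => ?_
        gcongr
        omega
      · rw [ev_one_Wd]
        refine (tsum_congr fun m => ?_).le
        rw [coeff_ab]
        ring
    rw [ev_one_Wd]
    calc _ ≤ ∑' n, ENNReal.ofReal β * (((n + 1 : ℕ) : ℝ≥0∞) * ∑' j, ‖coeff (n + j) u‖ₑ) := by
          refine ENNReal.tsum_le_tsum fun n => ?_
          rw [pow_one, mul_left_comm]
          exact mul_le_mul_right (hv n) _
      _ ≤ ENNReal.ofReal 2 * ENNReal.ofReal (1 / 8) := by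
          rw [ENNReal.tsum_mul_left]
          gcongr
      _ = _ := by rw [← ENNReal.ofReal_mul (by norm_num)]; norm_num
  have hB0 : constantCoeff B = 1 := by
    rw [← coeff_zero_eq_constantCoeff_apply, hB, coeff_mk]; simp
  have hBE : B * B⁻¹ = 1 := PowerSeries.mul_inv_cancel B (by simp [hB0])
  have hv0 : coeff 0 (ab (B - 1)) = 0 := by rw [coeff_ab]; simp [hB0]
  have hE : ab B⁻¹ ≤ 1 * geom (ab (B - 1)) := by
    refine le_geom hv0 ?_
    conv_lhs => rw [show B⁻¹ = 1 - (B - 1) * B⁻¹ by linear_combination hBE]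
    refine (ab_sub_le _ _).trans (add_le_add ab_one.le (ab_mul_le _ _))
  have hWE : WS B⁻¹ := by
    refine ne_top_of_le_ne_top (b := 2) (by simp) ((ev_mono 1 (Wd_mono 1 hE)).trans ?_)
    rw [one_mul]
    refine ev_Wd_geom_le (hvW.trans ?_)
    rw [show (2⁻¹ : ℝ≥0∞) = ENNReal.ofReal 2⁻¹ by
      rw [ENNReal.ofReal_inv_of_pos (by norm_num)]; simp]
    exact ENNReal.ofReal_le_ofReal (by norm_num)
  have hWv : WS (B - 1) := ne_top_of_le_ne_top ENNReal.ofReal_ne_top hvW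
  have hvS := hWv.sm zero_le_one le_rfl
  have hBS : Sm 1 B := by simpa using Sm_one.add hvS
  have hBpos : 0 < rv 1 B := by
    have h2 := abs_le.1 (abs_rv_le (by norm_num) ((ev_mono 1 (le_Wd 1 _)).trans hvW)
      zero_le_one le_rfl)
    have h3 := rv_add Sm_one hvS
    rw [rv_one, add_sub_cancel] at h3
    linarith [h2.1]
  refine ⟨B⁻¹, hWE, ?_, by rw [← hBX]; linear_combination (X - 1) * hBE⟩
  have h2 := rv_mul hBS (hWE.sm zero_le_one le_rfl)
  rw [hBE, rv_one] at h2
  exact pos_of_mul_pos_right (h2 ▸ one_pos) hBpos.le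

end Ser

section

open Ser PowerSeries

section SecondMoment

variable {d : ℕ}

theorem sqNormE_eq (x : Pt d) : sqNormE x = ((∑ i, (x i).natAbs ^ 2 : ℕ) : ℝ≥0∞) := by
  simp [sqNormE]

theorem sqNormE_le (x : Pt d) : sqNormE x ≤ (dist1 0 x : ℝ≥0∞) ^ 2 := by
  rw [sqNormE_eq]
  have h : ∑ i, (x i).natAbs ^ 2 ≤ dist1 0 x ^ 2 := by
    have : dist1 0 x = ∑ i, (x i).natAbs := Finset.sum_congr rfl fun i _ => by simp
    rw [this]
    exact Finset.sum_sq_le_sq_sum_of_nonneg fun i _ => Nat.zero_le _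
  exact_mod_cast h

theorem sqNormE_of_adj {x : Pt d} (h : Adj 0 x) : sqNormE x = 1 := by
  refine le_antisymm ((sqNormE_le x).trans (by rw [show dist1 0 x = 1 from h]; simp)) ?_
  have h1 : dist1 0 x ≤ ∑ i, (x i).natAbs ^ 2 := Finset.sum_le_sum fun i _ => by
    simpa using Nat.le_self_pow two_ne_zero (x i).natAbs
  rw [sqNormE_eq]
  rw [show dist1 0 x = 1 from h] at h1
  exact_mod_cast h1

theorem sqNormE_parallelogram (u y : Pt d) :
    sqNormE (u + y) + sqNormE (u - y) = 2 * sqNormE u + 2 * sqNormE y := by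
  simp only [sqNormE_eq]
  norm_cast
  rw [Finset.mul_sum, Finset.mul_sum, ← Finset.sum_add_distrib, ← Finset.sum_add_distrib]
  refine Finset.sum_congr rfl fun i _ => ?_
  zify
  simp only [sq_abs, Pi.add_apply, Pi.sub_apply]
  ring

/-- The series of second moments of a family indexed by lattice points. -/
def m2 (f : Pt d → Ser) : Ser := psum fun x => C (sqNormE x) * f x

theorem m2_add (f g : Pt d → Ser) : m2 (fun x => f x + g x) = m2 f + m2 g := by
  simp only [m2, mul_add, psum_add]

theorem m2_const_mul (a : Ser) (f : Pt d → Ser) : m2 (fun x => a * f x) = a * m2 f := by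
  simp only [m2, mul_psum, mul_left_comm]

theorem m2_le {f : Pt d → Ser} (h : ∀ x m, m < dist1 0 x → coeff m (f x) = 0) :
    m2 f ≤ Wd 2 (psum f) := by
  rw [m2, Wd_psum]
  refine psum_mono fun x n => ?_
  rw [coeff_C_mul, coeff_Wd]
  rcases lt_or_ge n (dist1 0 x) with hn | hn
  · simp [h x n hn]
  · gcongr
    refine (sqNormE_le x).trans ?_
    gcongr
    omega

theorem m2_translate {H : Pt d → Ser} (hH : ∀ x, H (-x) = H x) (u : Pt d) :
    (psum fun x => C (sqNormE (u + x)) * H x) = C (sqNormE u) * psum H + m2 H := by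
  have h1 : (psum fun x => C (sqNormE (u - x)) * H x) =
      psum fun x => C (sqNormE (u + x)) * H x := by
    rw [← psum_equiv (Equiv.neg (Pt d))]
    congr 1; funext x
    simp [hH]
  have h2 : (psum fun x => C (sqNormE (u + x)) * H x) + (psum fun x => C (sqNormE (u + x)) * H x) =
      C 2 * (C (sqNormE u) * psum H + m2 H) := by
    conv_lhs => enter [2]; rw [← h1]
    rw [← psum_add, mul_add, m2, mul_psum, mul_psum, mul_psum, ← psum_add]
    congr 1; funext x
    rw [← mul_assoc, ← mul_assoc, ← map_mul, ← map_mul, ← add_mul, ← add_mul, ← map_add, ← map_add,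
      ← sqNormE_parallelogram]
  ext n
  have h3 := congrArg (coeff n) h2
  rw [map_add, coeff_C_mul, ← two_mul] at h3
  exact (ENNReal.mul_right_inj (by simp) (by simp)).1 h3

theorem m2_kmul {A B : Pt d → Pt d → Ser} (hB : ∀ a x y, B (a + x) (a + y) = B x y)
    (hn : ∀ x, B 0 (-x) = B 0 x) : (m2 fun x => kmul A B 0 x) =
      (m2 fun x => A 0 x) * (psum fun x => B 0 x) + (psum fun x => A 0 x) * m2 fun x => B 0 x := by
  have h : ∀ u, (psum fun x => C (sqNormE x) * (A 0 u * B u x)) =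
      C (sqNormE u) * A 0 u * (psum fun x => B 0 x) + A 0 u * m2 fun x => B 0 x := fun u => by
    rw [mul_comm (C _), mul_assoc, ← mul_add, ← m2_translate hn, mul_psum,
      ← psum_equiv (Equiv.addLeft u)]
    congr 1; funext x
    have := hB u 0 x
    rw [add_zero] at this
    rw [Equiv.coe_addLeft, this]
    ring
  rw [m2]
  simp only [kmul, mul_psum]
  rw [psum_comm]
  simp only [h]
  rw [psum_add, ← psum_mul, ← psum_mul, ← mul_psum]
  rfl

theorem m2_J : (m2 fun x : Pt d => J 0 x) = C (2 * d : ℝ≥0∞) * X := by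
  rw [← psum_J, m2]
  congr 1; funext x
  unfold J
  split_ifs with h
  · rw [sqNormE_of_adj h, map_one, one_mul]
  · rw [mul_zero]

variable {w : List (Pt d) → ℝ≥0∞} (htr : ∀ a x y, GS w ∅ (a + x) (a + y) = GS w ∅ x y)
  (hneg : ∀ x y, GS w ∅ (-x) (-y) = GS w ∅ x y)
include htr hneg

theorem m2_Ut : (m2 fun x => Ut w 0 x) =
    C (2 * d : ℝ≥0∞) * X * (Ch w + m2 fun x => GS w ∅ 0 x) := by
  simp only [Ut, m2_add]
  rw [m2_kmul htr fun x => by simpa using hneg 0 x, m2_J, psum_J, ← Ch, mul_add, m2,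
    psum_single _ 0 fun x hx => by rw [if_neg hx.symm, mul_zero]]
  simp [sqNormE]

omit htr in
theorem Ut_neg (x : Pt d) : Ut w 0 (-x) = Ut w 0 x := by
  have h : kmul J (GS w ∅) 0 (-x) = kmul J (GS w ∅) 0 x := by
    rw [kmul, ← psum_equiv (Equiv.neg (Pt d)), kmul]
    congr 1; funext u
    have h1 := J_image isLatticeIso_neg 0 u
    have h2 := hneg u x
    simp only [Equiv.neg_apply, neg_zero] at h1 ⊢
    rw [h1, h2]
  rw [Ut, Ut, h]
  simp only [eq_comm (a := (0 : Pt d)), neg_eq_zero]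

/-- The lace expansion for second moments. -/
theorem lace_second_moment :
    (m2 fun x => GS w ∅ 0 x) +
      ((m2 fun v => Pl w true v) * (1 + C (2 * d : ℝ≥0∞) * X * Ch w) +
        (psum fun v => Pl w true v) *
          (C (2 * d : ℝ≥0∞) * X * (Ch w + m2 fun x => GS w ∅ 0 x))) =
    gS w ∅ 0 * (C (2 * d : ℝ≥0∞) * X * (Ch w + m2 fun x => GS w ∅ 0 x)) +
      ((m2 fun v => Pl w false v) * (1 + C (2 * d : ℝ≥0∞) * X * Ch w) +
        (psum fun v => Pl w false v) *
          (C (2 * d : ℝ≥0∞) * X * (Ch w + m2 fun x => GS w ∅ 0 x))) := by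
  have hm : ∀ b, (m2 fun x => psum fun v => Pl w b v * Ut w v x) =
      (m2 fun v => Pl w b v) * (1 + C (2 * d : ℝ≥0∞) * X * Ch w) + (psum fun v => Pl w b v) *
          (C (2 * d : ℝ≥0∞) * X * (Ch w + m2 fun x => GS w ∅ 0 x)) := fun b => by
    rw [← psum_Ut htr, ← m2_Ut htr hneg]
    exact m2_kmul (A := fun _ v => Pl w b v) (Ut_translation htr) (Ut_neg hneg)
  rw [← hm, ← hm, ← m2_Ut htr hneg, ← m2_const_mul, ← m2_add, ← m2_add]
  congr 1; funext x
  exact lace_convolution w x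

end SecondMoment

end

namespace Ser

open PowerSeries

variable {ρ : ℝ} {f g : Ser}

/-- The real power series obtained by rescaling the variable by `ρ`. -/
def rs (ρ : ℝ) (f : Ser) : PowerSeries ℝ := mk fun n => (coeff n f).toReal * ρ ^ n

@[simp] theorem coeff_rs (n : ℕ) : coeff n (rs ρ f) = (coeff n f).toReal * ρ ^ n := coeff_mk _ _

theorem rs_add (hf : FinC f) (hg : FinC g) : rs ρ (f + g) = rs ρ f + rs ρ g := by
  ext n
  simp only [coeff_rs, map_add, ENNReal.toReal_add (hf n) (hg n), add_mul]

theorem rs_mul (hf : FinC f) (hg : FinC g) : rs ρ (f * g) = rs ρ f * rs ρ g := by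
  ext n
  rw [coeff_rs, coeff_mul, coeff_mul, ENNReal.toReal_sum fun p _ =>
    ENNReal.mul_ne_top (hf _) (hg _), Finset.sum_mul]
  refine Finset.sum_congr rfl fun p hp => ?_
  rw [coeff_rs, coeff_rs, ENNReal.toReal_mul, ← Finset.HasAntidiagonal.mem_antidiagonal.1 hp,
    pow_add]
  ring

theorem rs_one : rs ρ 1 = 1 := by
  ext n; rw [coeff_rs, coeff_one, coeff_one]; split_ifs with h <;> simp [h]

theorem rs_C_mul_X (c : ℝ≥0∞) : rs ρ (C c * X) = C (c.toReal * ρ) * X := by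
  ext n
  rw [coeff_rs, coeff_C_mul, coeff_C_mul, coeff_X, coeff_X]
  split_ifs with h <;> simp [h]

theorem finC_C_mul_X {c : ℝ≥0∞} (hc : c ≠ ⊤) : FinC (C c * X) := fun n => by
  rw [coeff_C_mul, coeff_X]; split_ifs <;> simp [hc]

theorem finC_of_ev (hρ : 0 < ρ) (h : ev (ENNReal.ofReal ρ) f ≠ ⊤) : FinC f := fun n hn => by
  rw [ev_apply] at h
  refine ENNReal.ne_top_of_tsum_ne_top h n ?_
  rw [hn, ENNReal.top_mul]
  exact pow_ne_zero _ (by simpa using hρ)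

theorem ev_Wd_ab_rs_le (hρ : 0 ≤ ρ) (j : ℕ) (f : Ser) :
    ev 1 (Wd j (ab (rs ρ f))) ≤ ev (ENNReal.ofReal ρ) (Wd j f) := by
  rw [ev_apply, ev_apply]
  refine ENNReal.tsum_le_tsum fun n => ?_
  rw [coeff_Wd, coeff_Wd, coeff_ab, coeff_rs, one_pow, mul_one, mul_assoc, enorm_mul, enorm_pow,
    Real.enorm_of_nonneg hρ]
  gcongr
  rw [Real.enorm_of_nonneg ENNReal.toReal_nonneg]
  exact ENNReal.ofReal_toReal_le

theorem sm_rs_iff (hρ : 0 < ρ) {t : ℝ} (ht : 0 ≤ t) (hf : FinC f) :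
    Sm t (rs ρ f) ↔ ev (ENNReal.ofReal (ρ * t)) f ≠ ⊤ := by
  have h : ∀ n, ‖coeff n (rs ρ f) * t ^ n‖ = (coeff n f * ENNReal.ofReal (ρ * t) ^ n).toReal :=
    fun n => by
      rw [coeff_rs, Real.norm_of_nonneg (by positivity), ENNReal.toReal_mul, ENNReal.toReal_pow,
        ENNReal.toReal_ofReal (by positivity), mul_pow, mul_assoc]
  have hfin : ∀ n, coeff n f * ENNReal.ofReal (ρ * t) ^ n ≠ ⊤ := fun n =>
    ENNReal.mul_ne_top (hf n) (by finiteness)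
  simp only [Sm, h, ev_apply]
  refine ⟨fun hs => ?_, ENNReal.summable_toReal⟩
  have := hs.tsum_ofReal_ne_top
  simpa only [ENNReal.ofReal_toReal (hfin _)] using this

theorem rv_rs (hρ : 0 < ρ) {t : ℝ} (ht : 0 ≤ t) (h : ev (ENNReal.ofReal (ρ * t)) f ≠ ⊤) :
    rv t (rs ρ f) = (ev (ENNReal.ofReal (ρ * t)) f).toReal := by
  rw [toReal_ev (by positivity) h, rv]
  refine tsum_congr fun n => ?_
  rw [coeff_rs, mul_pow, mul_assoc]

end Ser

namespace Ser

open PowerSeries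

variable {u σ a y e f : PowerSeries ℝ} {β : ℝ}

theorem exists_abs_le_of_enorm_le {x : ℕ → ℝ} {B : ℝ≥0∞} (hB : B ≠ ⊤) (h : ∀ n, ‖x n‖ₑ ≤ B) :
    ∃ K, ∀ n, |x n| ≤ K :=
  ⟨B.toReal, fun n => by
    have := ENNReal.toReal_mono hB (h n)
    rwa [toReal_enorm] at this⟩

/-- Asymptotics of the susceptibility and of the second moment from the lace expansion. -/
theorem exists_asymptotics (hu : ev 1 (Wd 2 (ab u)) ≤ ENNReal.ofReal (1 / 8))
    (hσ : ev 1 (Wd 1 (ab σ)) ≤ ENNReal.ofReal (1 / 8)) (hβ : 0 ≤ β)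
    (ha : a = (1 + u) * (1 + C β * X * a)) (h0 : ∀ n, 0 ≤ coeff n a)
    (hfin : ∀ t, 0 ≤ t → t < 1 → Sm t a) (hdiv : ¬ Sm 1 a)
    (hy : y = σ * (1 + C β * X * a) + (1 + u) * (C β * X * (a + y))) :
    ∃ A B K : ℝ, 0 < A ∧ 0 < B ∧ (∀ n : ℕ, (n + 1) * |coeff n a - A| ≤ K) ∧
      (∀ n : ℕ, |coeff n y - (n + 1) * B| ≤ K) ∧
      Filter.Tendsto (fun t => rv t a * (1 - t)) (nhdsWithin 1 (Set.Iio 1)) (nhds A) := by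
  have hu0 := (ev_mono 1 (le_Wd 2 (ab u))).trans hu
  have hβs : β * rv 1 (1 + u) = 1 := critical_eq (hu0.trans (ENNReal.ofReal_le_ofReal
    (by norm_num))) ha h0 hfin hdiv
  have hWu : WS u := ne_top_of_le_ne_top ENNReal.ofReal_ne_top
    ((ev_mono 1 (Wd_le_Wd one_le_two _)).trans hu)
  have hWσ : WS σ := ne_top_of_le_ne_top ENNReal.ofReal_ne_top hσ
  have hWs : WS (1 + u) := WS_one.add hWu
  have hs1 : 7 / 8 ≤ rv 1 (1 + u) := by
    rw [rv_add Sm_one (hWu.sm zero_le_one le_rfl), rv_one]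
    have := (abs_le.1 (abs_rv_le (by norm_num) hu0 zero_le_one le_rfl)).1
    linarith
  have hσ1 : -(1 / 8) ≤ rv 1 σ := (abs_le.1 (abs_rv_le (by norm_num)
    ((ev_mono 1 (le_Wd 1 _)).trans hσ) zero_le_one le_rfl)).1
  obtain ⟨E, hE, hE1, hDE⟩ := exists_renewal hu hβ (by nlinarith) hβs
  have hWe : WS ((1 + u) * E) := hWs.mul hE
  have hae : a * (1 - X) = (1 + u) * E := by
    rw [hDE]; linear_combination E * ha
  have hWκ : WS ((σ + C β * X * ((1 + u) * (1 + u))) * (E * E)) :=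
    (hWσ.add (((WS_C β).mul WS_X).mul (hWs.mul hWs))).mul (hE.mul hE)
  have hyκ : y * (1 - X) ^ 2 = (σ + C β * X * ((1 + u) * (1 + u))) * (E * E) := by
    rw [hDE]
    linear_combination (1 - C β * X * (1 + u)) * E ^ 2 * hy +
      (C β * X * (σ + (1 + u))) * E ^ 2 * ha
  have one := fun {f} (h : WS f) => h.sm zero_le_one le_rfl
  have hA : 0 < rv 1 ((1 + u) * E) := by
    rw [rv_mul (one hWs) (one hE)]
    exact mul_pos (by linarith) hE1
  have hB : 0 < rv 1 ((σ + C β * X * ((1 + u) * (1 + u))) * (E * E)) := by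
    have h1 := one (((WS_C β).mul WS_X).mul (hWs.mul hWs))
    rw [rv_mul ((one hWσ).add h1) (one (hE.mul hE)), rv_mul (one hE) (one hE), rv_add (one hWσ) h1,
      rv_mul ((Sm_C _).mul Sm_X) (one (hWs.mul hWs)), rv_mul (Sm_C _) Sm_X, rv_C, rv_X,
      rv_mul (one hWs) (one hWs), mul_one, ← mul_assoc β, hβs, one_mul]
    exact mul_pos (by linarith) (mul_pos hE1 hE1)
  obtain ⟨K₁, hK₁⟩ := exists_abs_le_of_enorm_le (x := fun n : ℕ =>
    (n + 1) * (coeff n a - rv 1 ((1 + u) * E))) hWe fun n => by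
      refine le_of_eq_of_le ?_ (mul_enorm_coeff_sub_le (one hWe) hae n)
      rw [enorm_mul]
      congr 1
      rw [← Nat.cast_succ, Real.enorm_natCast]
  obtain ⟨K₂, hK₂⟩ := exists_abs_le_of_enorm_le hWκ (enorm_coeff_sub_mul_le (one hWκ) hyκ)
  refine ⟨_, _, max K₁ K₂, hA, hB, fun n => ?_, fun n => (hK₂ n).trans (le_max_right _ _), ?_⟩
  · refine le_trans ?_ ((hK₁ n).trans (le_max_left _ _))
    rw [abs_mul, abs_of_nonneg (by positivity : (0 : ℝ) ≤ n + 1)]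
  · refine (tendsto_rv (one hWe)).congr' ?_
    filter_upwards [Ioo_mem_nhdsLT zero_lt_one] with t ht
    rw [← hae, rv_mul (hfin t ht.1.le ht.2) (Sm_one.sub Sm_X), rv_sub Sm_one Sm_X, rv_one, rv_X]

end Ser

theorem exists_abs_div_sub_le {a y : ℕ → ℝ} {A B K : ℝ} (hA : 0 < A) (hB : 0 < B)
    (ha : ∀ n : ℕ, (n + 1) * |a n - A| ≤ K) (hy : ∀ n : ℕ, |y n - (n + 1) * B| ≤ K) :
    ∃ L, ∀ n : ℕ, |y n / a n - B / A * n| ≤ L := by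
  obtain ⟨N, hN⟩ := exists_nat_ge (2 * K / A)
  set L := (A * K + A * B + B * K) / (A * (A / 2))
  have hK : 0 ≤ K := (abs_nonneg _).trans (hy 0)
  refine ⟨L + ∑ n ∈ Finset.range N, |y n / a n - B / A * n|, fun n => ?_⟩
  rcases lt_or_ge n N with h | h
  · have h1 : 0 ≤ L := by positivity
    have h2 := Finset.single_le_sum (f := fun n : ℕ => |y n / a n - B / A * n|)
      (fun _ _ => abs_nonneg _) (Finset.mem_range.2 h)
    linarith
  · have hn : 2 * K / A ≤ n := hN.trans (by exact_mod_cast h)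
    rw [div_le_iff₀ hA] at hn
    have h1 : A / 2 ≤ a n := by
      have h3 : |a n - A| ≤ A / 2 := by
        by_contra hc
        have h4 := ha n
        have h5 : (n + 1) * (A / 2) ≤ (n + 1) * |a n - A| := by gcongr; exact (not_le.1 hc).le
        nlinarith
      linarith [(abs_le.1 h3).1]
    have h2 : |A * y n - B * n * a n| ≤ A * K + A * B + B * K := by
      have e : A * y n - B * n * a n = A * (y n - (n + 1) * B) + A * B - B * (n * (a n - A)) := by
        ring
      have h3 : |(n : ℝ) * (a n - A)| ≤ K := by
        rw [abs_mul, Nat.abs_cast]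
        refine le_trans ?_ (ha n)
        gcongr
        linarith
      rw [e]
      refine (abs_sub _ _).trans (add_le_add ((abs_add_le _ _).trans (add_le_add ?_ ?_)) ?_)
      · rw [abs_mul, abs_of_pos hA]; gcongr; exact hy n
      · rw [abs_of_pos (by positivity)]
      · rw [abs_mul, abs_of_pos hB]; gcongr
    have han : 0 < a n := lt_of_lt_of_le (by positivity) h1
    have h3 : y n / a n - B / A * n = (A * y n - B * n * a n) / (A * a n) := by
      field_simp
    rw [h3, abs_div, abs_of_pos (mul_pos hA han)]
    refine le_add_of_le_of_nonneg ?_ (Finset.sum_nonneg fun _ _ => abs_nonneg _)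
    exact div_le_div₀ (by positivity) h2 (by positivity) (by gcongr)

section

open Ser PowerSeries

theorem exists_dimension {ε : ℝ≥0∞} (hε : ε ≠ 0) : ∃ d₀ : ℕ, ∀ d : ℕ, d₀ ≤ d → 0 < d ∧
    2 * 12 ^ 100 * ∫⁻ k, ‖1 - ss k‖ₑ * (ENNReal.ofReal (ss k))⁻¹ ^ 100 ∂tor d ≤ ε := by
  obtain ⟨K, hK, h⟩ := exists_lintegral_le
  have h1 : Filter.Tendsto (fun d : ℕ => 2 * 12 ^ 100 * K * (d : ℝ≥0∞)⁻¹ ^ (1 / 2 : ℝ))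
      Filter.atTop (nhds (2 * 12 ^ 100 * K * 0 ^ (1 / 2 : ℝ))) :=
    ENNReal.Tendsto.const_mul (((ENNReal.continuous_rpow_const).tendsto 0).comp
      ENNReal.tendsto_inv_nat_nhds_zero) (Or.inr (by finiteness))
  rw [ENNReal.zero_rpow_of_pos (by norm_num), mul_zero] at h1
  obtain ⟨N, hN⟩ := Filter.eventually_atTop.1 (h1.eventually_lt_const (pos_iff_ne_zero.2 hε))
  refine ⟨max N 800, fun d hd => ⟨by omega, ?_⟩⟩
  refine le_trans ?_ (hN d (le_trans (le_max_left _ _) hd)).le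
  calc _ ≤ 2 * 12 ^ 100 * ((d : ℝ≥0∞)⁻¹ ^ (1 / 2 : ℝ) * K) := by
        gcongr; exact h d (le_trans (le_max_right _ _) hd)
    _ = _ := by ring

section Asymptotics

variable {d : ℕ} {lam : List (Pt d) → ℝ≥0}

theorem exists_lww_asymptotics (hs : SymmAssumption lam) {M : ℝ≥0}
    (hb : ∀ l, IsSAPList l → lam l ≤ M) (hM1 : 1 ≤ M) (hd : 0 < d) {a q : ℝ≥0∞}
    (hK : 2 * 12 ^ 100 * ∫⁻ k, ‖1 - ss k‖ₑ * (ENNReal.ofReal (ss k))⁻¹ ^ 100 ∂tor d ≤ a)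
    (haq : a < q) (hq : 2 ^ 400 * M * q ≤ 1) :
    0 < zc lam ∧ ∃ A B K : ℝ, 0 < A ∧ 0 < B ∧
      (∀ n : ℕ, (n + 1) * |(cN lam n).toReal * zc lam ^ n - A| ≤ K) ∧
      (∀ n : ℕ, |(msd lam n).toReal * zc lam ^ n - (n + 1) * B| ≤ K) ∧
      Filter.Tendsto (fun t => (chi lam (zc lam * t)).toReal * (1 - t))
        (nhdsWithin 1 (Set.Iio 1)) (nhds A) := by
  obtain ⟨hpos, hfin, htop, hQ⟩ := critical_point hs hb hM1 hd hK haq hq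
  refine ⟨hpos, ?_⟩
  set ρ := zc lam
  set w := lw lam
  have htr := GS_lw_translation hs
  have hneg := GS_lw_neg hs
  have hw := lw_le hb
  have hM1' : (1 : ℝ≥0∞) ≤ M := by exact_mod_cast hM1
  have hM : (M : ℝ≥0∞) ≠ ⊤ := ENNReal.coe_ne_top
  have hP := ev_Wd_psum_Pl_le htr hw hM1' hQ hq hM
  have hr := ev_Wd_sub_gS_le htr hw hM1' hQ hq
  have htop20 : ((2 ^ 20)⁻¹ : ℝ≥0∞) ≠ ⊤ := by simp
  have h20 : ((2 ^ 20)⁻¹ : ℝ≥0∞) ≤ ENNReal.ofReal (1 / 32) := by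
    rw [one_div, ENNReal.ofReal_inv_of_pos (by norm_num)]
    exact ENNReal.inv_le_inv.2 (by norm_num)
  have hm : ∀ b, Wd 1 (m2 fun v => Pl w b v) ≤ Wd 3 (psum fun v => Pl w b v) := fun b n => by
    have := m2_le (f := fun v => Pl w b v) (fun v m h => coeff_Pl_of_lt b v h) n
    rw [coeff_Wd] at this ⊢
    rw [coeff_Wd, pow_one, show 3 = 1 + 2 from rfl, pow_add, pow_one, mul_assoc]
    gcongr
  have hmP := fun b => (ev_mono (ENNReal.ofReal ρ) (hm b)).trans (hP b)
  have fin_of : ∀ {j f}, ev (ENNReal.ofReal ρ) (Wd j f) ≤ (2 ^ 20)⁻¹ → FinC f := fun h =>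
    finC_of_ev hpos (ne_top_of_le_ne_top htop20 ((ev_mono _ (le_Wd _ _)).trans h))
  have fP := fun b => fin_of (hP b)
  have fm := fun b => fin_of (hmP b)
  have fr := fin_of hr
  have fX : FinC (C (2 * d : ℝ≥0∞) * X) := finC_C_mul_X (by finiteness)
  have fCh : FinC (Ch w) := fun n =>
    ne_top_of_le_ne_top (by finiteness) (coeff_Ch_le hw hM1' n)
  have fy : FinC (m2 fun x => GS w ∅ 0 x) := by
    refine FinC.mono (fun n => ?_)
      (m2_le (f := fun x => GS w ∅ 0 x) fun x m h => coeff_GS_of_lt ∅ h)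
    rw [coeff_Wd]
    exact ENNReal.mul_ne_top (by finiteness) (fCh n)
  have hg := gS_rec w (S := ∅) (v := (0 : Pt d)) (by simp)
  have fg : FinC (gS w ∅ 0) := by rw [hg]; exact finC_one.add fr
  set u := rs ρ (rS w ∅ 0 * gS w ∅ 0) + rs ρ (psum fun v => Pl w false v) -
    rs ρ (psum fun v => Pl w true v) with hu
  set σ := rs ρ (m2 fun v => Pl w false v) - rs ρ (m2 fun v => Pl w true v) with hσ
  have hgr : rs ρ (gS w ∅ 0) = 1 + rs ρ (rS w ∅ 0 * gS w ∅ 0) := by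
    conv_lhs => rw [hg]
    rw [rs_add finC_one fr, rs_one]
  have hX : rs ρ (C (2 * d : ℝ≥0∞) * X) = C (2 * d * ρ) * X := by
    rw [rs_C_mul_X]; simp
  have hsum := congrArg (rs ρ) (lace_sum (w := w) htr)
  have hmom := congrArg (rs ρ) (lace_second_moment (w := w) htr hneg)
  have f1 := finC_one.add (fX.mul fCh)
  have f2 := fX.mul (fCh.add fy)
  rw [rs_add fCh ((fP true).mul f1), rs_mul (fP true) f1, rs_mul (fg.add (fP false)) f1,
    rs_add fg (fP false), rs_add finC_one (fX.mul fCh), rs_mul fX fCh, rs_one, hX, hgr] at hsum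
  rw [rs_add fy (((fm true).mul f1).add ((fP true).mul f2)),
    rs_add (fg.mul f2) (((fm false).mul f1).add ((fP false).mul f2)), rs_mul fg f2,
    rs_add ((fm true).mul f1) ((fP true).mul f2), rs_add ((fm false).mul f1) ((fP false).mul f2),
    rs_mul (fm true) f1, rs_mul (fP true) f2, rs_mul (fm false) f1, rs_mul (fP false) f2,
    rs_mul fX (fCh.add fy), rs_add fCh fy, rs_add finC_one (fX.mul fCh), rs_mul fX fCh, rs_one,
    hX, hgr] at hmom
  have hsm : ∀ t, 0 ≤ t → (Sm t (rs ρ (Ch w)) ↔ chi lam (ρ * t) ≠ ⊤) := fun t ht => by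
    rw [sm_rs_iff hpos ht fCh, chi_eq]
  have hlt : ∀ t, t < 1 → chi lam (ρ * t) ≠ ⊤ := fun t ht => hfin _ (by nlinarith)
  have hrs : ∀ {j f}, ev (ENNReal.ofReal ρ) (Wd j f) ≤ (2 ^ 20)⁻¹ →
      ev 1 (Wd j (ab (rs ρ f))) ≤ ENNReal.ofReal (1 / 32) := fun h =>
    (ev_Wd_ab_rs_le hpos.le _ _).trans (h.trans h20)
  have hsub : ∀ (j : ℕ) (f g : PowerSeries ℝ), ev 1 (Wd j (ab (f - g))) ≤
      ev 1 (Wd j (ab f)) + ev 1 (Wd j (ab g)) := fun j f g => by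
    rw [← map_add, ← Wd_add]; exact ev_mono _ (Wd_mono _ (ab_sub_le f g))
  have hadd : ∀ (j : ℕ) (f g : PowerSeries ℝ), ev 1 (Wd j (ab (f + g))) ≤
      ev 1 (Wd j (ab f)) + ev 1 (Wd j (ab g)) := fun j f g => by
    rw [← map_add, ← Wd_add]; exact ev_mono _ (Wd_mono _ (ab_add_le f g))
  have h23 : ∀ {f}, ev (ENNReal.ofReal ρ) (Wd 3 f) ≤ (2 ^ 20)⁻¹ →
      ev (ENNReal.ofReal ρ) (Wd 2 f) ≤ (2 ^ 20)⁻¹ := fun h =>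
    (ev_mono _ (Wd_le_Wd (by norm_num) _)).trans h
  have hu8 : ev 1 (Wd 2 (ab u)) ≤ ENNReal.ofReal (1 / 8) := by
    refine (hsub 2 _ _).trans ((add_le_add ((hadd 2 _ _).trans
      (add_le_add (hrs (h23 hr)) (hrs (h23 (hP false))))) (hrs (h23 (hP true)))).trans ?_)
    rw [← ENNReal.ofReal_add (by norm_num) (by norm_num),
      ← ENNReal.ofReal_add (by norm_num) (by norm_num)]
    exact ENNReal.ofReal_le_ofReal (by norm_num)
  have hσ8 : ev 1 (Wd 1 (ab σ)) ≤ ENNReal.ofReal (1 / 8) := by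
    refine (hsub 1 _ _).trans ((add_le_add (hrs (hmP false)) (hrs (hmP true))).trans ?_)
    rw [← ENNReal.ofReal_add (by norm_num) (by norm_num)]
    exact ENNReal.ofReal_le_ofReal (by norm_num)
  obtain ⟨A, B, K, hA, hB, h1, h2, h3⟩ := exists_asymptotics hu8 hσ8
    (a := rs ρ (Ch w)) (y := rs ρ (m2 fun x => GS w ∅ 0 x)) (β := 2 * d * ρ) (by positivity)
    (by rw [hu]; linear_combination hsum) (fun n => by rw [coeff_rs]; positivity)
    (fun t ht ht1 => (hsm t ht).2 (hlt t ht1)) (by rw [hsm 1 zero_le_one, mul_one, htop]; simp)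
    (by rw [hu, hσ]; linear_combination hmom)
  refine ⟨A, B, K, hA, hB, fun n => ?_, fun n => ?_, h3.congr' ?_⟩
  · simpa [cN_eq] using h1 n
  · simpa [msd_eq, m2] using h2 n
  · filter_upwards [Ioo_mem_nhdsLT zero_lt_one] with t ht
    rw [rv_rs hpos ht.1.le (by rw [← chi_eq]; exact hlt t ht.2), chi_eq]

end Asymptotics

theorem le_mul_rpow {K δ : ℝ} (hK : 0 ≤ K) (hδ : δ ≤ 1) {n : ℕ} (hn : 1 ≤ n) :
    K ≤ K * (n : ℝ) ^ (1 - δ) :=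
  le_mul_of_one_le_right hK (Real.one_le_rpow (by exact_mod_cast hn) (by linarith))

end

/-- **Mean-field behaviour of λ-LWW in high dimensions (general loop activities).**
Let `λ = (λ_η)` be a family of nonnegative loop activities (given on `ℤ^d` for each
dimension `d`) satisfying the symmetry assumption and the boundedness assumption
(uniformly in `d`).  Then there exists `d₀ = d₀(λ)` such that for every `d ≥ d₀` there
are constants `A > 0` and `D > 0` with:
(1) the susceptibility diverges linearly: `χ_λ(z)·(z_c − z) → A·z_c` as `z ↑ z_c`;
(2) for every `δ < 1`, `c_n^λ = A·z_c^{−n}·(1 + O(n^{−δ}))`;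
(3) λ-LWW is diffusive: for every `δ < 1`, `⟨|ω_n|²⟩_n^λ = D·n·(1 + O(n^{−δ}))`. -/
theorem main_theorem (Λ : ∀ d : ℕ, List (Pt d) → ℝ≥0)
    (hsym : ∀ d : ℕ, SymmAssumption (Λ d))
    (hbdd : ∃ M : ℝ≥0, ∀ d : ℕ, ∀ l : List (Pt d), IsSAPList l → Λ d l ≤ M) :
    ∃ d₀ : ℕ, ∀ d : ℕ, d₀ ≤ d →
      ∃ A D : ℝ, 0 < A ∧ 0 < D ∧
        (Filter.Tendsto
          (fun z : ℝ => (chi (Λ d) z).toReal * (zc (Λ d) - z))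
          (nhdsWithin (zc (Λ d)) (Set.Iio (zc (Λ d))))
          (nhds (A * zc (Λ d)))) ∧
        (∀ δ : ℝ, δ < 1 → ∃ C : ℝ, ∀ n : ℕ, 1 ≤ n →
          |(cN (Λ d) n).toReal * zc (Λ d) ^ n - A| ≤ C * (n : ℝ) ^ (-δ)) ∧
        (∀ δ : ℝ, δ < 1 → ∃ C : ℝ, ∀ n : ℕ, 1 ≤ n →
          |meanSq (Λ d) n - D * (n : ℝ)| ≤ C * (n : ℝ) ^ (1 - δ)) := by
  obtain ⟨M, hM⟩ := hbdd
  set q : ℝ≥0∞ := (2 ^ 400 * (max M 1 : ℝ≥0))⁻¹ with hq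
  have hq0 : q ≠ 0 := ENNReal.inv_ne_zero.2 (by finiteness)
  have hqt : q ≠ ⊤ := ENNReal.inv_ne_top.2 (mul_ne_zero (by simp)
    (by simp))
  obtain ⟨d₀, hd₀⟩ := exists_dimension (ENNReal.half_pos hq0).ne'
  refine ⟨d₀, fun d hd => ?_⟩
  obtain ⟨hd0, hK⟩ := hd₀ d hd
  obtain ⟨hρ, A, B, K, hA, hB, h1, h2, h3⟩ := exists_lww_asymptotics (hsym d)
    (fun l hl => (hM d l hl).trans (le_max_left M 1)) (le_max_right M 1) hd0 hK
    (ENNReal.half_lt_self hq0 hqt) (by rw [hq]; exact ENNReal.mul_inv_le_one _)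
  set ρ := zc (Λ d)
  have hK0 : 0 ≤ K := (abs_nonneg _).trans (h2 0)
  obtain ⟨L, hL⟩ := exists_abs_div_sub_le hA hB h1 h2
  refine ⟨A, B / A, hA, div_pos hB hA, ?_, fun δ hδ => ⟨K, fun n hn => ?_⟩,
    fun δ hδ => ⟨L, fun n hn => ?_⟩⟩
  · have ht : Filter.Tendsto (fun z : ℝ => z / ρ) (nhdsWithin ρ (Set.Iio ρ))
        (nhdsWithin 1 (Set.Iio 1)) := by
      refine tendsto_nhdsWithin_iff.2 ⟨?_, ?_⟩
      · have : Filter.Tendsto (fun z : ℝ => z / ρ) (nhds ρ) (nhds (ρ / ρ)) :=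
          Filter.tendsto_id.div_const ρ
        rw [div_self hρ.ne'] at this
        exact this.mono_left nhdsWithin_le_nhds
      · filter_upwards [self_mem_nhdsWithin] with z hz
        exact (div_lt_one hρ).2 hz
    refine ((h3.comp ht).mul_const ρ).congr fun z => ?_
    simp only [Function.comp]
    rw [mul_div_cancel₀ z hρ.ne', mul_assoc, sub_mul, one_mul, div_mul_cancel₀ z hρ.ne']
  · have hn0 : (0 : ℝ) < n := by exact_mod_cast hn
    have h4 : (n : ℝ) * |(cN (Λ d) n).toReal * ρ ^ n - A| ≤ K * (n : ℝ) ^ (1 - δ) := by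
      refine le_trans ?_ ((h1 n).trans (le_mul_rpow hK0 hδ.le hn))
      gcongr
      linarith
    rw [Real.rpow_sub hn0, Real.rpow_one, ← mul_div_assoc, mul_comm K, mul_div_assoc,
      mul_le_mul_iff_right₀ hn0] at h4
    rwa [Real.rpow_neg hn0.le, ← div_eq_mul_inv]
  · have h4 : meanSq (Λ d) n = (msd (Λ d) n).toReal * ρ ^ n / ((cN (Λ d) n).toReal * ρ ^ n) := by
      rw [meanSq, ENNReal.toReal_div, mul_div_mul_right _ _ (pow_pos hρ n).ne']
    rw [h4]
    exact (hL n).trans (le_mul_rpow ((abs_nonneg _).trans (hL 0)) hδ.le hn)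

end LWW
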